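/- Let q be a prime power with q ≡ 3 (mod 8), let k be an algebraically closed field of characteristic 2, and let G = PSL_3(q) be the quotient of SL_3(q) by its center. Then every simple kG-module is algebraic. -/

import Mathlib

open CategoryTheory CategoryTheory.MonoidalCategory

namespace AlgebraicModule

variable {k G : Type} [Field k] [Monoid G]

/-- `N` is a direct summand of `M`, i.e. a retract of `M`. -/
def IsSummand (N M : FDRep k G) : Prop :=
  ∃ (i : N ⟶ M) (r : M ⟶ N), i ≫ r = 𝟙 N

/-- `M` is an indecomposable module: it is nonzero and is not the direct sum of two
nonzero submodules (equivalently, its only idempotent endomorphisms are `0` and `1`). -/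
def Indecomposable (M : FDRep k G) : Prop :=
  ¬ Limits.IsZero M ∧ ∀ e : M ⟶ M, e ≫ e = e → e = 0 ∨ e = 𝟙 M

/-- `tensorPow M n` is the tensor power `M^{⊗ (n + 1)}`, with diagonal `G`-action. -/
noncomputable def tensorPow (M : FDRep k G) : ℕ → FDRep k G
  | 0 => M
  | n + 1 => tensorPow M n ⊗ M

/-- `M` is algebraic: only finitely many isomorphism classes of indecomposable modules
occur as direct summands of the tensor powers `M^{⊗ n}` for `n ≥ 1`. -/
noncomputable def IsAlgebraic (M : FDRep k G) : Prop :=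
  ∃ L : List (FDRep k G), ∀ N : FDRep k G, Indecomposable N →
    (∃ n : ℕ, IsSummand N (tensorPow M n)) → ∃ N' ∈ L, Nonempty (N ≅ N')

end AlgebraicModule

open AlgebraicModule

/-- `PSL_n(F)`: the quotient of `SL_n(F)` by its center. -/
abbrev PSL (n : ℕ) (F : Type) [Field F] : Type :=
  Matrix.SpecialLinearGroup (Fin n) F ⧸ Subgroup.center (Matrix.SpecialLinearGroup (Fin n) F)

namespace Alg

def Eqv {k G V W : Type} [Field k] [Group G] [AddCommGroup V] [Module k V] [AddCommGroup W]
    [Module k W] (ρ : Representation k G V) (σ : Representation k G W) (f : V →ₗ[k] W) : Prop :=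
  ∀ g v, f (ρ g v) = σ g (f v)

def Summ {k G V W : Type} [Field k] [Group G] [AddCommGroup V] [Module k V] [AddCommGroup W]
    [Module k W] (ρ : Representation k G V) (σ : Representation k G W) : Prop :=
  ∃ (i : V →ₗ[k] W) (r : W →ₗ[k] V), Eqv ρ σ i ∧ Eqv σ ρ r ∧ ∀ v, r (i v) = v

def Indec {k G V : Type} [Field k] [Group G] [AddCommGroup V] [Module k V]
    (ρ : Representation k G V) : Prop :=
  Nontrivial V ∧ ∀ e : V →ₗ[k] V, Eqv ρ ρ e → (∀ v, e (e v) = e v) →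
    (∀ v, e v = 0) ∨ (∀ v, e v = v)

def IsoR {k G V W : Type} [Field k] [Group G] [AddCommGroup V] [Module k V] [AddCommGroup W]
    [Module k W] (ρ : Representation k G V) (σ : Representation k G W) : Prop :=
  ∃ e : V ≃ₗ[k] W, Eqv ρ σ e.toLinearMap

/-- bundled finite-dimensional representation -/
structure RP (k G : Type) [Field k] [Group G] where
  V : Type
  [acg : AddCommGroup V]
  [mod : Module k V]
  [fd : FiniteDimensional k V]
  ρ : Representation k G V

attribute [instance] RP.acg RP.mod RP.fd

section
variable {k G V W X : Type} [Field k] [Group G] [AddCommGroup V] [Module k V] [AddCommGroup W]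
    [Module k W] [AddCommGroup X] [Module k X]
    {ρ : Representation k G V} {σ : Representation k G W} {τ : Representation k G X}

theorem Eqv.comp {f : V →ₗ[k] W} {g : W →ₗ[k] X} (hg : Eqv σ τ g) (hf : Eqv ρ σ f) :
    Eqv ρ τ (g ∘ₗ f) := by
  intro a v; simp [hf a v, hg a]

theorem Eqv.pow {f : Module.End k V} (hf : Eqv ρ ρ f) (n : ℕ) : Eqv ρ ρ (f ^ n) := by
  induction n with
  | zero => intro a v; simp
  | succ n ih => intro a v; rw [pow_succ]; simp [hf a v, ih a]

theorem Summ.trans (h : Summ ρ σ) (h' : Summ σ τ) : Summ ρ τ := by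
  obtain ⟨i, r, hi, hr, h⟩ := h
  obtain ⟨i', r', hi', hr', h'⟩ := h'
  exact ⟨i' ∘ₗ i, r ∘ₗ r', hi'.comp hi, hr.comp hr', fun v => by simp [h, h']⟩

theorem fitting [FiniteDimensional k V] (h : Indec ρ) {f : Module.End k V} (hf : Eqv ρ ρ f) :
    IsNilpotent f ∨ IsUnit f := by
  obtain ⟨n, hn⟩ := (f.eventually_isCompl_ker_pow_range_pow).exists_forall_of_atTop
  have hc := hn (n+1) (by omega)
  have hfp := hf.pow (n+1)
  set F := f ^ (n+1) with hF
  let e := (LinearMap.range F).projection (LinearMap.ker F) hc.symm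
  have he : Eqv ρ ρ e := by
    intro g v
    obtain ⟨a, b, hab, -⟩ := Submodule.existsUnique_add_of_isCompl hc v
    rw [← hab]
    have ha : F (a : V) = 0 := a.2
    obtain ⟨c, hc'⟩ := b.2
    have h1 : ∀ x, F x = 0 → e x = 0 := fun x hx => by
      exact (Submodule.projection_apply_eq_zero_iff hc.symm).2 hx
    have h2 : ∀ x, e (F x) = F x := fun x =>
      Submodule.projection_apply_of_mem_left hc.symm ⟨x, rfl⟩
    rw [map_add, map_add, map_add, map_add, h1 a ha, h1 (ρ g a) (by rw [hfp, ha, map_zero]),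
      ← hc', ← hfp, h2, h2, map_zero, hfp]
  have hee : ∀ v, e (e v) = e v := fun v =>
    Submodule.projection_apply_of_mem_left hc.symm (Submodule.projection_apply_mem hc.symm v)
  rcases h.2 e he hee with h0 | h1
  · left
    refine ⟨n+1, ?_⟩
    ext v
    have := Submodule.projection_apply_of_mem_left hc.symm ⟨v, rfl⟩
    rw [← this]; exact h0 _
  · right
    have hinj : Function.Injective F := by
      rw [← LinearMap.ker_eq_bot]
      rw [eq_bot_iff]
      intro x hx
      have := (Submodule.projection_apply_eq_zero_iff hc.symm).2 hx
      rw [← h1 x]; exact this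
    have hfi : Function.Injective f := by
      rw [hF, pow_succ] at hinj
      exact Function.Injective.of_comp (f := ⇑(f^n)) hinj
    exact (LinearMap.isUnit_iff_ker_eq_bot f).2 (LinearMap.ker_eq_bot.2 hfi)

theorem unit_inv {f : Module.End k V} (hf : Eqv ρ ρ f) (hu : IsUnit f) :
    ∃ u : Module.End k V, Eqv ρ ρ u ∧ (∀ v, u (f v) = v) ∧ ∀ v, f (u v) = v := by
  obtain ⟨u, rfl⟩ := hu
  have h1 : ∀ v, (↑u⁻¹ : Module.End k V) ((u : Module.End k V) v) = v := fun v => by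
    rw [← Module.End.mul_apply, Units.inv_mul]; rfl
  have h2 : ∀ v, (u : Module.End k V) ((↑u⁻¹ : Module.End k V) v) = v := fun v => by
    rw [← Module.End.mul_apply, Units.mul_inv]; rfl
  refine ⟨↑u⁻¹, fun g v => ?_, h1, h2⟩
  conv_lhs => rw [← h2 v]
  rw [← hf, h1]

theorem unit_of_add [FiniteDimensional k V] (h : Indec ρ) {f g : Module.End k V} (hf : Eqv ρ ρ f)
    (hu : IsUnit (f + g)) (hg : Eqv ρ ρ g) : IsUnit f ∨ IsUnit g := by
  have hfg : Eqv ρ ρ (f + g) := fun a v => by simp [hf a, hg a]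
  obtain ⟨u, hu1, hu2, hu3⟩ := unit_inv hfg hu
  have hff : Eqv ρ ρ (u * f) := hu1.comp hf
  have hs : u * f + u * g = 1 := by
    ext v; simpa using hu2 v
  have huu : IsUnit u := ⟨⟨u, f + g, by ext v; simpa using hu2 v,
    by ext v; simpa using hu3 v⟩, rfl⟩
  rcases fitting h hff with hn | hu'
  · right
    have : IsUnit (u * g) := by
      rw [show u * g = 1 - u * f from by rw [← hs]; simp]
      exact IsNilpotent.isUnit_one_sub hn
    obtain ⟨w, hw⟩ := huu
    rw [← hw] at this
    simpa using this
  · left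
    obtain ⟨w, hw⟩ := huu
    rw [← hw] at hu'
    simpa using hu'

theorem unit_of_sum [FiniteDimensional k V] (h : Indec ρ) {ι : Type*} (s : Finset ι)
    (f : ι → Module.End k V) (hf : ∀ i, Eqv ρ ρ (f i)) (hu : IsUnit (∑ i ∈ s, f i)) :
    ∃ i ∈ s, IsUnit (f i) := by
  classical
  induction s using Finset.induction_on with
  | empty =>
    exfalso
    have := h.1
    rw [Finset.sum_empty] at hu
    exact not_isUnit_zero hu
  | insert a s ha ih =>
    rw [Finset.sum_insert ha] at hu
    have hs : Eqv ρ ρ (∑ i ∈ s, f i) := fun g v => by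
      simp [LinearMap.sum_apply, hf _ g v, map_sum]
    rcases unit_of_add h (hf a) hu hs with h1 | h1
    · exact ⟨a, by simp, h1⟩
    · obtain ⟨i, hi, h2⟩ := ih h1
      exact ⟨i, by simp [hi], h2⟩

/-- factoring a unit through `σ` makes `ρ` a summand -/
theorem summ_of_unit {α : V →ₗ[k] W} {β : W →ₗ[k] V} (hα : Eqv ρ σ α) (hβ : Eqv σ ρ β)
    (hu : IsUnit (β ∘ₗ α : Module.End k V)) : Summ ρ σ := by
  obtain ⟨u, h1, h2, h3⟩ := unit_inv (hβ.comp hα) hu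
  exact ⟨α, u ∘ₗ β, hα, h1.comp hβ, fun v => by simpa using h2 v⟩

theorem iso_of_summ (h : Indec ρ) (h' : Indec σ) (hs : Summ ρ σ) : IsoR ρ σ := by
  obtain ⟨i, r, hi, hr, hir⟩ := hs
  have := h.1
  rcases h'.2 (i ∘ₗ r) (hi.comp hr) (fun v => by simp [hir]) with h0 | h1
  · exfalso
    obtain ⟨v, hv⟩ := exists_ne (0 : V)
    apply hv
    have := h0 (i v)
    simp only [LinearMap.comp_apply, hir] at this
    rw [← hir v, this, map_zero]
  · exact ⟨LinearEquiv.ofLinearMap i r (by ext v; simpa using h1 v) (by ext v; simpa using hir v),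
      fun g v => by simpa using hi g v⟩

def subR (ρ : Representation k G V) (p : Submodule k V) (hp : ∀ g, ∀ v ∈ p, ρ g v ∈ p) :
    Representation k G p where
  toFun g := (ρ g).restrict (hp g)
  map_one' := by ext; simp
  map_mul' a b := by ext; simp

theorem finite_summ (n : ℕ) : ∀ (X : RP k G), Module.finrank k X.V ≤ n →
    ∃ L : List (RP k G), ∀ N : RP k G, Indec N.ρ → Summ N.ρ X.ρ → ∃ Y ∈ L, IsoR N.ρ Y.ρ := by
  induction n with
  | zero =>
    intro X hX
    refine ⟨[], fun N hN hs => ?_⟩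
    exfalso
    obtain ⟨i, r, hi, hr, hir⟩ := hs
    have := hN.1
    obtain ⟨v, hv⟩ := exists_ne (0 : N.V)
    have : Subsingleton X.V := Module.finrank_zero_iff.1 (Nat.le_zero.1 hX)
    apply hv
    rw [← hir v, Subsingleton.elim (i v) 0, map_zero]
  | succ n ih =>
    intro X hX
    by_cases hXi : Indec X.ρ
    · exact ⟨[X], fun N hN hs => ⟨X, by simp, iso_of_summ hN hXi hs⟩⟩
    by_cases ht : Nontrivial X.V
    swap
    · rw [not_nontrivial_iff_subsingleton] at ht
      exact ih X (by rw [Module.finrank_zero_of_subsingleton]; omega)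
    simp only [Indec, ht, true_and, not_forall] at hXi
    obtain ⟨e, he, hee, hne⟩ := hXi
    rw [not_or] at hne
    let p := LinearMap.range e
    let q := LinearMap.ker e
    have hp : ∀ g, ∀ v ∈ p, X.ρ g v ∈ p := by
      rintro g _ ⟨w, rfl⟩; exact ⟨X.ρ g w, he g w⟩
    have hq : ∀ g, ∀ v ∈ q, X.ρ g v ∈ q := by
      intro g v hv
      have hv : e v = 0 := hv
      show e _ = 0
      rw [he, hv, map_zero]
    have hpl : p ≠ ⊤ := by
      intro h
      apply hne.2
      intro v
      have : v ∈ p := by rw [h]; trivial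
      obtain ⟨w, rfl⟩ := this
      exact hee w
    have hql : q ≠ ⊤ := by
      intro h
      apply hne.1
      intro v
      have : v ∈ q := by rw [h]; trivial
      exact this
    obtain ⟨L1, h1⟩ := ih ⟨p, subR X.ρ p hp⟩ (by
      have := Submodule.finrank_lt hpl; dsimp only; omega)
    obtain ⟨L2, h2⟩ := ih ⟨q, subR X.ρ q hq⟩ (by
      have := Submodule.finrank_lt hql; dsimp only; omega)
    refine ⟨L1 ++ L2, fun N hN hs => ?_⟩
    obtain ⟨i, r, hi, hr, hir⟩ := hs
    have he2 : Eqv X.ρ X.ρ (LinearMap.id - e) := fun g v => by simp [he g v]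
    have hone : IsUnit (r ∘ₗ e ∘ₗ i + r ∘ₗ (LinearMap.id - e) ∘ₗ i : Module.End k N.V) := by
      have : (r ∘ₗ e ∘ₗ i + r ∘ₗ (LinearMap.id - e) ∘ₗ i : Module.End k N.V) = 1 := by
        ext v; simp [hir]
      rw [this]; exact isUnit_one
    rcases unit_of_add hN (hr.comp (he.comp hi)) hone (hr.comp (he2.comp hi)) with hu | hu
    · obtain ⟨Y, hY, hY2⟩ := h1 N hN (summ_of_unit (α := e.rangeRestrict ∘ₗ i)
        (β := r ∘ₗ p.subtype) (σ := subR X.ρ p hp)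
        (fun g v => by
          ext
          simp [subR, hi g v, he g]) (fun g v => by
          simp [subR, hr g]) hu)
      exact ⟨Y, by simp [hY], hY2⟩
    · have hmem : ∀ v, (LinearMap.id - e : X.V →ₗ[k] X.V) v ∈ q := fun v => by
        show e _ = 0
        simp [hee]
      obtain ⟨Y, hY, hY2⟩ := h2 N hN (summ_of_unit
        (α := (LinearMap.codRestrict q (LinearMap.id - e) hmem) ∘ₗ i)
        (β := r ∘ₗ q.subtype) (σ := subR X.ρ q hq)
        (fun g v => by
          ext
          simp [subR, hi g v, he g]) (fun g v => by
          simp [subR, hr g]) hu)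
      exact ⟨Y, by simp [hY], hY2⟩

theorem finite_summ_list (L : List (RP k G)) :
    ∃ L' : List (RP k G), ∀ N : RP k G, Indec N.ρ → (∃ X ∈ L, Summ N.ρ X.ρ) →
      ∃ Y ∈ L', IsoR N.ρ Y.ρ := by
  induction L with
  | nil => exact ⟨[], by simp⟩
  | cons X L ih =>
    obtain ⟨L1, h1⟩ := ih
    obtain ⟨L2, h2⟩ := finite_summ _ X le_rfl
    refine ⟨L1 ++ L2, fun N hN ⟨Z, hZ, hs⟩ => ?_⟩
    rcases List.mem_cons.1 hZ with rfl | hZ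
    · obtain ⟨Y, hY, hi⟩ := h2 N hN hs
      exact ⟨Y, by simp [hY], hi⟩
    · obtain ⟨Y, hY, hi⟩ := h1 N hN ⟨Z, hZ, hs⟩
      exact ⟨Y, by simp [hY], hi⟩

end
end Alg

namespace Alg
open Polynomial

section
variable {k G V W : Type} [Field k] [Group G] [AddCommGroup V] [Module k V] [AddCommGroup W]
    [Module k W]
    {ρ : Representation k G V} {σ : Representation k G W}

theorem eqv_of_gen [Finite G] {r : G} (hr : ∀ x, x ∈ Subgroup.zpowers r) {f : V →ₗ[k] W}
    (h : ∀ v, f (ρ r v) = σ r (f v)) : Eqv ρ σ f := by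
  intro g
  have := hr g
  rw [← mem_powers_iff_mem_zpowers] at this
  obtain ⟨n, rfl⟩ := this
  induction n with
  | zero => intro v; simp
  | succ n ih =>
    intro v
    dsimp only at *
    rw [pow_succ, map_mul, map_mul, Module.End.mul_apply, Module.End.mul_apply, ih, h]

theorem cyc_finite_ideals (n : ℕ) (hn : 0 < n) :
    Finite {I : Ideal k[X] // (X ^ n - 1 : k[X]) ∈ I} := by
  have h0 : (X ^ n - 1 : k[X]) ≠ 0 := by
    have := (monic_X_pow_sub_C (1 : k) hn.ne').ne_zero
    simpa using this
  have : Fintype {I : Ideal k[X] // I ∣ Ideal.span {(X ^ n - 1 : k[X])}} :=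
    UniqueFactorizationMonoid.fintypeSubtypeDvd _ (by
      simpa [Ideal.zero_eq_bot, Ideal.span_singleton_eq_bot] using h0)
  simp only [Ideal.dvd_span_singleton] at this
  exact Finite.of_fintype _

theorem cyc_fd (n : ℕ) (hn : 0 < n) (I : Ideal k[X]) (h : (X ^ n - 1 : k[X]) ∈ I) :
    Module.Finite k (k[X] ⧸ I) := by
  have hm : (X ^ n - 1 : k[X]).Monic := by
    have := (monic_X_pow_sub_C (1 : k) hn.ne')
    simpa using this
  have := hm.finite_quotient
  have hle : Ideal.span {(X ^ n - 1 : k[X])} ≤ I := by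
    rw [Ideal.span_le]; simpa using h
  exact Module.Finite.of_surjective (Ideal.Quotient.factorₐ k hle).toLinearMap
    (Ideal.Quotient.factor_surjective hle)

noncomputable def cycUnit (n : ℕ) (hn : 0 < n) (I : Ideal k[X]) (h : (X ^ n - 1 : k[X]) ∈ I) :
    (k[X] ⧸ I)ˣ where
  val := Ideal.Quotient.mk I X
  inv := Ideal.Quotient.mk I (X ^ (n-1))
  val_inv := by
    rw [← map_mul, ← pow_succ', Nat.sub_add_cancel hn, ← map_one (Ideal.Quotient.mk I),
      Ideal.Quotient.eq]; exact h
  inv_val := by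
    rw [← map_mul, ← pow_succ, Nat.sub_add_cancel hn, ← map_one (Ideal.Quotient.mk I),
      Ideal.Quotient.eq]; exact h

theorem cycUnit_ord (n : ℕ) (hn : 0 < n) (I : Ideal k[X]) (h : (X ^ n - 1 : k[X]) ∈ I) :
    orderOf (cycUnit n hn I h) ∣ n := by
  rw [orderOf_dvd_iff_pow_eq_one]
  ext
  simp only [cycUnit, Units.val_pow_eq_pow_val, Units.val_one]
  rw [← map_pow, ← map_one (Ideal.Quotient.mk I), Ideal.Quotient.eq]; exact h

noncomputable def cycRP [Finite G] (r : G) (hr : ∀ x, x ∈ Subgroup.zpowers r)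
    (I : Ideal k[X]) (h : (X ^ (orderOf r) - 1 : k[X]) ∈ I) : RP k G where
  V := k[X] ⧸ I
  fd := cyc_fd _ (orderOf_pos r) I h
  ρ := ((Algebra.lmul k (k[X] ⧸ I)).toMonoidHom).comp ((Units.coeHom _).comp
    (monoidHomOfForallMemZpowers hr (cycUnit_ord _ (orderOf_pos r) I h)))

theorem cycRP_gen [Finite G] (r : G) (hr : ∀ x, x ∈ Subgroup.zpowers r)
    (I : Ideal k[X]) (h : (X ^ (orderOf r) - 1 : k[X]) ∈ I) (v : k[X] ⧸ I) :
    ((cycRP r hr I h).ρ r : k[X] ⧸ I →ₗ[k] k[X] ⧸ I) v = (X : k[X]) • v := by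
  have : (cycRP r hr I h).ρ r = Algebra.lmul k (k[X] ⧸ I) (Ideal.Quotient.mk I X) := by
    show Algebra.lmul k (k[X] ⧸ I) (monoidHomOfForallMemZpowers hr
      (cycUnit_ord _ (orderOf_pos r) I h) r).val = _
    rw [monoidHomOfForallMemZpowers_apply_gen]
    rfl
  rw [this]
  obtain ⟨w, rfl⟩ := Ideal.Quotient.mk_surjective v
  rfl

theorem cyc_decomp (k G : Type) [Field k] [Group G] [Finite G] [IsCyclic G] :
    ∃ S : Set (RP k G), S.Finite ∧ ∀ N : RP k G,
      ∃ (ι : Type) (_ : Fintype ι) (J : ι → RP k G) (α : ∀ i, N.V →ₗ[k] (J i).V)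
        (β : ∀ i, (J i).V →ₗ[k] N.V), (∀ i, J i ∈ S) ∧ (∀ i, Eqv N.ρ (J i).ρ (α i)) ∧
        (∀ i, Eqv (J i).ρ N.ρ (β i)) ∧ ∀ v, ∑ i, β i (α i v) = v := by
  classical
  obtain ⟨r, hr⟩ := IsCyclic.exists_generator (α := G)
  have := cyc_finite_ideals (k := k) _ (orderOf_pos r)
  refine ⟨Set.range (fun I : {I : Ideal k[X] // (X ^ (orderOf r) - 1 : k[X]) ∈ I} =>
    cycRP r hr I.1 I.2), Set.finite_range _, fun N => ?_⟩
  obtain ⟨ι, _, p, hp, e, ⟨E⟩⟩ := Module.equiv_directSum_of_isTorsion (R := k[X])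
    (M := Module.AEval' (N.ρ r)) (Module.AEval.isTorsion_of_finiteDimensional _ _ _)
  have hann : ∀ x : Module.AEval' (N.ρ r), (X ^ (orderOf r) - 1 : k[X]) • x = 0 := by
    intro x
    obtain ⟨m, rfl⟩ := (Module.AEval'.of (N.ρ r)).surjective x
    rw [sub_smul, Module.AEval'.X_pow_smul_of, ← map_pow, pow_orderOf_eq_one, map_one, one_smul,
      one_smul, sub_self]
  let E' : Module.AEval' (N.ρ r) ≃ₗ[k[X]] DirectSum ι (fun i => k[X] ⧸ (Ideal.span {p i ^ e i})) := E
  have hmem : ∀ i, (X ^ (orderOf r) - 1 : k[X]) ∈ (Ideal.span {p i ^ e i}) := by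
    intro i
    have h1 := hann (E'.symm (DirectSum.lof k[X] ι (fun i => k[X] ⧸ (Ideal.span {p i ^ e i})) i
      (Ideal.Quotient.mk _ 1)))
    rw [← map_smul, ← map_smul, LinearEquiv.map_eq_zero_iff] at h1
    have h2 := congrArg (DirectSum.component k[X] ι
      (fun i => k[X] ⧸ (Ideal.span {p i ^ e i})) i) h1
    rw [DirectSum.component.lof_self, map_zero] at h2
    rw [← Ideal.Quotient.eq_zero_iff_mem]
    refine Eq.trans ?_ h2
    conv_lhs => rw [← mul_one (X ^ orderOf r - 1 : k[X])]
    rfl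
  let O := Module.AEval'.of (N.ρ r)
  let α : ∀ i, N.V →ₗ[k] (k[X] ⧸ (Ideal.span {p i ^ e i})) := fun i =>
    ((DirectSum.component k[X] ι (fun i => k[X] ⧸ (Ideal.span {p i ^ e i})) i ∘ₗ
      E'.toLinearMap).restrictScalars k) ∘ₗ O.toLinearMap
  let β : ∀ i, (k[X] ⧸ (Ideal.span {p i ^ e i})) →ₗ[k] N.V := fun i =>
    O.symm.toLinearMap ∘ₗ ((E'.symm.toLinearMap ∘ₗ
      (DirectSum.lof k[X] ι (fun i => k[X] ⧸ (Ideal.span {p i ^ e i})) i)).restrictScalars k)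
  have h1 : ∀ i v, α i (N.ρ r v) = (X : k[X]) • α i v := by
    intro i v
    show (DirectSum.component k[X] ι (fun i => k[X] ⧸ (Ideal.span {p i ^ e i})) i)
      (E' (O (N.ρ r v))) = (X : k[X]) • (DirectSum.component k[X] ι
        (fun i => k[X] ⧸ (Ideal.span {p i ^ e i})) i) (E' (O v))
    rw [← map_smul, ← map_smul, ← Module.AEval'.X_smul_of]
  have h2 : ∀ i v, β i ((X : k[X]) • v) = N.ρ r (β i v) := by
    intro i v
    show O.symm (E'.symm (DirectSum.lof k[X] ι
      (fun i => k[X] ⧸ (Ideal.span {p i ^ e i})) i ((X : k[X]) • v))) =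
      N.ρ r (O.symm (E'.symm (DirectSum.lof k[X] ι
        (fun i => k[X] ⧸ (Ideal.span {p i ^ e i})) i v)))
    rw [map_smul, map_smul]
    exact Module.AEval'.of_symm_X_smul _ _
  have h3 : ∀ v, ∑ i, β i (α i v) = v := by
    intro v
    apply O.injective
    apply E'.injective
    have hβ : ∀ i x, O (β i x) =
      E'.symm (DirectSum.lof k[X] ι (fun i => k[X] ⧸ (Ideal.span {p i ^ e i})) i x) := fun i x =>
        O.apply_symm_apply _
    rw [map_sum, map_sum]
    simp only [hβ, LinearEquiv.apply_symm_apply]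
    exact DirectSum.sum_univ_of (E' (O v))
  exact ⟨ι, inferInstance, fun i => cycRP r hr _ (hmem i), α, β, fun i => ⟨⟨_, hmem i⟩, rfl⟩,
    fun i => eqv_of_gen hr fun v => (h1 i v).trans (cycRP_gen r hr _ (hmem i) (α i v)).symm,
    fun i => eqv_of_gen hr fun v =>
      (congrArg (β i) (cycRP_gen r hr _ (hmem i) v)).trans (h2 i v), h3⟩
end

section
variable {k G V : Type} [Field k] [Group G] [AddCommGroup V] [Module k V]

theorem sum_coset {A : Type*} [AddCommMonoid A] (R : Subgroup G) [Fintype (G ⧸ R)] (Φ : G → A)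
    (hΦ : ∀ g, ∀ r ∈ R, Φ (g * r) = Φ g) (h : G) :
    ∑ q : G ⧸ R, Φ (h * q.out) = ∑ q : G ⧸ R, Φ q.out := by
  have key : ∀ a b : G, (a : G ⧸ R) = b → Φ a = Φ b := by
    intro a b hab
    rw [QuotientGroup.eq] at hab
    rw [← hΦ a _ hab]; simp
  rw [← Equiv.sum_comp (MulAction.toPerm h : Equiv.Perm (G ⧸ R)) (fun q => Φ q.out)]
  refine Finset.sum_congr rfl fun q _ => key _ _ ?_
  rw [QuotientGroup.out_eq', MulAction.toPerm_apply]
  conv_rhs => rw [← QuotientGroup.out_eq' q]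
  rfl

theorem summ_coind [Finite G] (ρ : Representation k G V) (R : Subgroup G) [Fintype (G ⧸ R)]
    {J : Type} [AddCommGroup J] [Module k J] (τ : Representation k R J)
    (α : V →ₗ[k] J) (β : J →ₗ[k] V) (hα : Eqv (ρ.comp R.subtype) τ α)
    (hβ : Eqv τ (ρ.comp R.subtype) β)
    (hu : IsUnit (∑ q : G ⧸ R, ρ q.out * (β ∘ₗ α) * ρ q.out⁻¹ : Module.End k V)) :
    Summ ρ (Representation.coind R.subtype τ) := by
  let A : V →ₗ[k] Representation.coindV R.subtype τ :=
    LinearMap.codRestrict _ (LinearMap.pi fun g => α ∘ₗ ρ g) (by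
      intro v r g
      have := hα r (ρ g v)
      simpa using this)
  let B : Representation.coindV R.subtype τ →ₗ[k] V :=
    (∑ q : G ⧸ R, ρ q.out ∘ₗ β ∘ₗ LinearMap.proj q.out⁻¹) ∘ₗ Submodule.subtype _
  have hB : ∀ f, B f = ∑ q : G ⧸ R, ρ q.out (β (f.1 q.out⁻¹)) := fun f => by
    simp [B]
  have hA : ∀ v x, (A v).1 x = α (ρ x v) := fun v x => rfl
  have hco : ∀ h f x, (Representation.coind R.subtype τ h f).1 x = f.1 (x * h) := fun _ _ _ => rfl
  refine summ_of_unit (α := A) (β := B) (fun g v => ?_) (fun h f => ?_) ?_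
  · ext x
    rw [hco, hA, hA, map_mul, Module.End.mul_apply]
  · rw [hB, hB]
    have h1 : ∀ (f : Representation.coindV R.subtype τ) (g : G), ∀ r ∈ R,
        ρ (g * r) (β (f.1 (g * r)⁻¹)) = ρ g (β (f.1 g⁻¹)) := by
      intro f g r hr
      have h2 := f.2 (⟨r, hr⟩ : R)⁻¹ g⁻¹
      have h3 := hβ (⟨r, hr⟩ : R)⁻¹ (f.1 g⁻¹)
      simp only [Subgroup.subtype_apply, InvMemClass.coe_inv] at h2
      rw [mul_inv_rev, h2, h3]
      simp
    rw [← sum_coset R (fun g => ρ g (β ((Representation.coind R.subtype τ h f).1 g⁻¹))) (h1 _) h]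
    rw [map_sum]
    refine Finset.sum_congr rfl fun q _ => ?_
    rw [hco, map_mul, mul_inv_rev, inv_mul_cancel_right, Module.End.mul_apply]
  · convert hu using 1
    ext v
    rw [LinearMap.comp_apply, hB]
    simp [hA, LinearMap.sum_apply]

end
end Alg

namespace Alg
open scoped TensorProduct

def InGood {k G V : Type} [Field k] [Group G] [AddCommGroup V] [Module k V]
    (ρ : Representation k G V) (e : V →ₗ[k] V) : Prop :=
  ∃ (Y : Type) (_ : Fintype Y) (_ : MulAction G Y) (φ : Y → V →ₗ[k] V),
    (∀ g y v, φ (g • y) v = ρ g (φ y (ρ g⁻¹ v))) ∧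
    (∀ y, IsCyclic (MulAction.stabilizer G y) ∨ ∃ (m : V) (f : V →ₗ[k] k),
      (∀ g ∈ MulAction.stabilizer G y, ρ g m = m ∧ ∀ v, f (ρ g v) = f v) ∧
      ∀ v, φ y v = f v • m) ∧
    ∀ v, ∑ y, φ y v = e v

abbrev Good {k G V : Type} [Field k] [Group G] [AddCommGroup V] [Module k V]
    (ρ : Representation k G V) : Prop := InGood ρ LinearMap.id

section
variable {k G V W : Type} [Field k] [Group G] [AddCommGroup V] [Module k V] [AddCommGroup W]
    [Module k W]
    {ρ : Representation k G V} {σ : Representation k G W}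

theorem InGood.add {e e' : V →ₗ[k] V} (h : InGood ρ e) (h' : InGood ρ e') : InGood ρ (e + e') := by
  obtain ⟨Y, _, _, φ, h1, h2, h3⟩ := h
  obtain ⟨Y', _, _, φ', h1', h2', h3'⟩ := h'
  let _ : MulAction G (Y ⊕ Y') :=
    { smul := fun g => Sum.map (g • ·) (g • ·)
      one_smul := by rintro (y | y) <;> simp [HSMul.hSMul] <;> exact one_smul _ _
      mul_smul := by rintro a b (y | y) <;> simp [HSMul.hSMul] <;> exact mul_smul _ _ _ }
  have hl : ∀ (g : G) (y : Y), g • (Sum.inl y : Y ⊕ Y') = Sum.inl (g • y) := fun _ _ => rfl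
  have hr : ∀ (g : G) (y : Y'), g • (Sum.inr y : Y ⊕ Y') = Sum.inr (g • y) := fun _ _ => rfl
  have sl : ∀ y : Y, MulAction.stabilizer G (Sum.inl y : Y ⊕ Y') = MulAction.stabilizer G y := by
    intro y; ext g; simp [MulAction.mem_stabilizer_iff, hl]
  have sr : ∀ y : Y', MulAction.stabilizer G (Sum.inr y : Y ⊕ Y') = MulAction.stabilizer G y := by
    intro y; ext g; simp [MulAction.mem_stabilizer_iff, hr]
  refine ⟨Y ⊕ Y', inferInstance, inferInstance, Sum.elim φ φ', ?_, ?_, ?_⟩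
  · rintro g (y | y) v
    · exact h1 g y v
    · exact h1' g y v
  · rintro (y | y)
    · rw [sl]; exact h2 y
    · rw [sr]; exact h2' y
  · intro v
    simp [h3, h3']

theorem Good.summ (h : Good σ) (hs : Summ ρ σ) : Good ρ := by
  obtain ⟨i, r, hi, hr, hir⟩ := hs
  obtain ⟨Y, _, _, φ, h1, h2, h3⟩ := h
  refine ⟨Y, inferInstance, inferInstance, fun y => r ∘ₗ φ y ∘ₗ i, ?_, ?_, ?_⟩
  · intro g y v
    simp [h1, hi _ v, hr g]
  · intro y
    rcases h2 y with hc | ⟨m, f, hf, hm⟩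
    · exact Or.inl hc
    · refine Or.inr ⟨r m, f ∘ₗ i, fun g hg => ⟨?_, fun v => ?_⟩, fun v => ?_⟩
      · rw [← hr, (hf g hg).1]
      · simp [hi g v, (hf g hg).2]
      · simp [hm]
  · intro v
    simp only [LinearMap.comp_apply]
    rw [← map_sum, h3]; simp [hir]

theorem Good.tprod (h : Good ρ) (h' : Good σ) : Good (ρ.tprod σ) := by
  obtain ⟨Y, _, _, φ, h1, h2, h3⟩ := h
  obtain ⟨Y', _, _, φ', h1', h2', h3'⟩ := h'
  have hst : ∀ (y : Y) (y' : Y'), MulAction.stabilizer G (y, y') =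
      MulAction.stabilizer G y ⊓ MulAction.stabilizer G y' := by
    intro y y'; ext g; simp [MulAction.mem_stabilizer_iff, Subgroup.mem_inf]
  have cyc : ∀ {A B : Subgroup G}, A ≤ B → IsCyclic B → IsCyclic A := fun h hB =>
    isCyclic_of_injective (Subgroup.inclusion h) (Subgroup.inclusion_injective h)
  refine ⟨Y × Y', inferInstance, inferInstance,
    fun y => TensorProduct.map (φ y.1) (φ' y.2), ?_, ?_, ?_⟩
  · rintro g ⟨y, y'⟩ v
    have : TensorProduct.map (φ (g • y)) (φ' (g • y')) = (ρ.tprod σ g) ∘ₗ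
        TensorProduct.map (φ y) (φ' y') ∘ₗ (ρ.tprod σ g⁻¹) := by
      ext a b
      simp [h1, h1']
    exact LinearMap.congr_fun this v
  · rintro ⟨y, y'⟩
    rw [hst]
    rcases h2 y with hc | ⟨m, f, hf, hm⟩
    · exact Or.inl (cyc inf_le_left hc)
    rcases h2' y' with hc | ⟨m', f', hf', hm'⟩
    · exact Or.inl (cyc inf_le_right hc)
    refine Or.inr ⟨m ⊗ₜ m', LinearMap.mul' k k ∘ₗ TensorProduct.map f f', fun g hg => ⟨?_, ?_⟩, ?_⟩
    · simp [(hf g hg.1).1, (hf' g hg.2).1]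
    · intro v
      have : (LinearMap.mul' k k ∘ₗ TensorProduct.map f f') ∘ₗ (ρ.tprod σ g) =
          LinearMap.mul' k k ∘ₗ TensorProduct.map f f' := by
        ext a b
        simp [(hf g hg.1).2, (hf' g hg.2).2]
      exact LinearMap.congr_fun this v
    · intro v
      have : TensorProduct.map (φ y) (φ' y') =
          (LinearMap.mul' k k ∘ₗ TensorProduct.map f f').smulRight (m ⊗ₜ[k] m') := by
        ext a b
        simp [hm, hm', TensorProduct.smul_tmul, TensorProduct.tmul_smul, smul_smul, mul_comm]
      exact LinearMap.congr_fun this v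
  · intro v
    have : ∑ y : Y × Y', TensorProduct.map (φ y.1) (φ' y.2) = LinearMap.id := by
      ext a b
      simp only [TensorProduct.AlgebraTensorModule.curry_apply, LinearMap.restrictScalars_self,
        TensorProduct.curry_apply, LinearMap.sum_apply, TensorProduct.map_tmul, LinearMap.id_apply]
      rw [Fintype.sum_prod_type]
      simp only [← TensorProduct.tmul_sum, h3', ← TensorProduct.sum_tmul, h3, LinearMap.id_apply]
    rw [← LinearMap.sum_apply, this]

theorem Good.of_index [Finite G] (H : Subgroup G) (hodd : (H.index : k) = 1)
    (h : Good (ρ.comp H.subtype)) : Good ρ := by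
  classical
  obtain ⟨Y, _, _, φ, h1, h2, h3⟩ := h
  have hmem : ∀ (g : G) (q : G ⧸ H), (g • q).out⁻¹ * g * q.out ∈ H := by
    intro g q
    rw [mul_assoc, ← QuotientGroup.eq, QuotientGroup.out_eq']
    conv_lhs => rw [← QuotientGroup.out_eq' q]
    rfl
  let hh : G → G ⧸ H → H := fun g q => ⟨_, hmem g q⟩
  let _ : SMul G ((G ⧸ H) × Y) := ⟨fun g z => (g • z.1, hh g z.1 • z.2)⟩
  have hsm : ∀ (g : G) (z : (G ⧸ H) × Y), g • z = (g • z.1, hh g z.1 • z.2) := fun _ _ => rfl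
  let _ : MulAction G ((G ⧸ H) × Y) :=
    { one_smul := by
        rintro ⟨q, y⟩
        rw [hsm]
        have : hh 1 q = 1 := by ext; simp [hh]
        simp [this]
      mul_smul := by
        rintro a b ⟨q, y⟩
        rw [hsm, hsm, hsm]
        have : hh (a * b) q = hh a (b • q) * hh b q := by
          ext; simp [hh, mul_assoc, mul_smul]
        simp [this, mul_smul] }
  have hρ : ∀ a b v, ρ a (ρ b v) = ρ (a * b) v := fun a b v => by simp
  have hfix : ∀ g (q : G ⧸ H) (y : Y), g ∈ MulAction.stabilizer G (q, y) →
      g • q = q ∧ hh g q ∈ MulAction.stabilizer H y := by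
    intro g q y hg
    rw [MulAction.mem_stabilizer_iff, hsm] at hg
    exact ⟨congrArg Prod.fst hg, congrArg Prod.snd hg⟩
  have : Fintype (G ⧸ H) := Fintype.ofFinite _
  refine ⟨(G ⧸ H) × Y, inferInstance, inferInstance,
    fun z => ρ z.1.out ∘ₗ φ z.2 ∘ₗ ρ z.1.out⁻¹, ?_, ?_, ?_⟩
  · rintro g ⟨q, y⟩ v
    rw [hsm]
    simp only [LinearMap.comp_apply]
    rw [h1]
    simp only [MonoidHom.comp_apply, Subgroup.subtype_apply]
    simp only [hρ]
    have e1 : (g • q).out * (hh g q : G) = g * q.out := by simp [hh, mul_assoc]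
    have e2 : ((hh g q)⁻¹ : H) * (g • q).out⁻¹ = q.out⁻¹ * g⁻¹ := by simp [hh, mul_assoc]
    rw [e1, e2]
  · rintro ⟨q, y⟩
    rcases h2 y with hc | ⟨m, f, hf, hm⟩
    · left
      let F : MulAction.stabilizer G (q, y) →* MulAction.stabilizer H y :=
        { toFun := fun g => ⟨hh g q, (hfix g q y g.2).2⟩
          map_one' := by ext; simp [hh]
          map_mul' := by
            intro a b
            ext
            simp only [hh, Subgroup.coe_mul]
            have ha := (hfix a q y a.2).1
            have hb := (hfix b q y b.2).1
            rw [mul_smul, hb, ha]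
            simp [mul_assoc] }
      refine isCyclic_of_injective F ?_
      intro a b hab
      have := congrArg (fun x : MulAction.stabilizer H y => ((x : H) : G)) hab
      simp only [F, hh, MonoidHom.coe_mk, OneHom.coe_mk] at this
      rw [(hfix a q y a.2).1, (hfix b q y b.2).1] at this
      ext
      simpa using this
    · right
      have key : ∀ g ∈ MulAction.stabilizer G (q, y), g * q.out = q.out * (hh g q : G) := by
        intro g hg
        simp only [hh]
        rw [(hfix g q y hg).1]; simp [mul_assoc]
      refine ⟨ρ q.out m, f ∘ₗ ρ q.out⁻¹, fun g hg => ⟨?_, ?_⟩, ?_⟩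
      · rw [hρ, key g hg, ← hρ]
        exact congrArg _ (hf _ (hfix g q y hg).2).1
      · intro v
        simp only [LinearMap.comp_apply, hρ]
        have : q.out⁻¹ * g = (hh g q : G) * q.out⁻¹ := by
          have := key g hg
          rw [inv_mul_eq_iff_eq_mul, ← mul_assoc, eq_mul_inv_iff_mul_eq, this]
        rw [this, ← hρ]
        exact (hf _ (hfix g q y hg).2).2 _
      · intro v
        simp [hm]
  · intro v
    rw [Fintype.sum_prod_type]
    simp only [LinearMap.comp_apply]
    simp only [← map_sum, h3, LinearMap.id_apply, hρ, mul_inv_cancel, map_one,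
      Module.End.one_apply]
    rw [Finset.sum_const, Finset.card_univ, ← Nat.card_eq_fintype_card]
    change H.index • v = v
    rw [← Nat.cast_smul_eq_nsmul k, hodd, one_smul]

end

section
variable {k G : Type} [Field k] [Group G]

noncomputable def coindRP [Finite G] (R : Subgroup G) (J : RP k R) : RP k G where
  V := Representation.coindV R.subtype J.ρ
  ρ := Representation.coind R.subtype J.ρ

def trivRP (k G : Type) [Field k] [Group G] : RP k G where
  V := k
  ρ := Representation.trivial k G k

theorem finite_good (k G : Type) [Field k] [Group G] [Finite G] :
    ∃ S : Set (RP k G), S.Finite ∧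
    ∀ N : RP k G, Indec N.ρ → Good N.ρ → ∃ X ∈ S, Summ N.ρ X.ρ := by
  classical
  have hS : ∀ R : Subgroup G, ∃ S : Set (RP k R), S.Finite ∧ trivRP k R ∈ S ∧ (IsCyclic R →
      ∀ N : RP k R, ∃ (ι : Type) (_ : Fintype ι) (J : ι → RP k R) (α : ∀ i, N.V →ₗ[k] (J i).V)
        (β : ∀ i, (J i).V →ₗ[k] N.V), (∀ i, J i ∈ S) ∧ (∀ i, Eqv N.ρ (J i).ρ (α i)) ∧
        (∀ i, Eqv (J i).ρ N.ρ (β i)) ∧ ∀ v, ∑ i, β i (α i v) = v) := by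
    intro R
    by_cases hR : IsCyclic R
    · obtain ⟨S, hS, h⟩ := cyc_decomp k R
      refine ⟨insert (trivRP k R) S, hS.insert _, by simp, fun _ N => ?_⟩
      obtain ⟨ι, i1, J, α, β, h1, h2⟩ := h N
      exact ⟨ι, i1, J, α, β, fun i => by simp [h1], h2⟩
    · exact ⟨{trivRP k R}, by simp, by simp, fun h => absurd h hR⟩
  choose S hS1 hS2 hS3 using hS
  refine ⟨⋃ R, coindRP R '' (S R), Set.finite_iUnion fun R => (hS1 R).image _, ?_⟩
  intro N hN hg
  obtain ⟨Y, _, _, φ, h1, h2, h3⟩ := hg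
  have : Fintype G := Fintype.ofFinite _
  let ρ := N.ρ
  have : ∀ R : Subgroup G, Fintype (G ⧸ R) := fun _ => Fintype.ofFinite _
  -- it suffices to write the identity through a family
  have conj : ∀ (g : G) (y : Y), φ (g • y) = ρ g * φ y * ρ g⁻¹ := by
    intro g y; ext v; exact h1 g y v
  have trEqv : ∀ (R : Subgroup G) (θ : Module.End k N.V), (∀ r ∈ R, ρ r * θ = θ * ρ r) →
      Eqv ρ ρ (∑ q : G ⧸ R, ρ q.out * θ * ρ q.out⁻¹ : Module.End k N.V) := by
    intro R θ hθ h v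
    have hinv : ∀ g, ∀ r ∈ R, ρ (g * r) * θ * ρ (g * r)⁻¹ = ρ g * θ * ρ g⁻¹ := by
      intro g r hr
      rw [mul_inv_rev, map_mul, map_mul, mul_assoc (ρ g), hθ r hr]
      simp only [mul_assoc]
      rw [← mul_assoc (ρ r), ← map_mul, mul_inv_cancel, map_one, one_mul]
    have := sum_coset R (fun g => ρ g * θ * ρ g⁻¹) hinv h
    have h2 : ρ h * (∑ q : G ⧸ R, ρ q.out * θ * ρ q.out⁻¹) =
        (∑ q : G ⧸ R, ρ q.out * θ * ρ q.out⁻¹) * ρ h := by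
      conv_rhs => rw [← this]
      rw [Finset.mul_sum, Finset.sum_mul]
      refine Finset.sum_congr rfl fun q _ => ?_
      simp only [mul_inv_rev, map_mul, mul_assoc]
      rw [← map_mul ρ h⁻¹ h, inv_mul_cancel, map_one, mul_one]
    exact (LinearMap.congr_fun h2 v).symm
  have stabcomm : ∀ (y : Y), ∀ r ∈ MulAction.stabilizer G y, ρ r * φ y = φ y * ρ r := by
    intro y r hr
    have := conj r y
    rw [MulAction.mem_stabilizer_iff.1 hr] at this
    conv_rhs => rw [this]
    rw [mul_assoc, ← map_mul, inv_mul_cancel, map_one, mul_one]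
  let Ω := MulAction.orbitRel.Quotient G Y
  have : Fintype Ω := Fintype.ofFinite _
  let T : Ω → Module.End k N.V := fun ω =>
    ∑ q : G ⧸ MulAction.stabilizer G ω.out, ρ q.out * φ ω.out * ρ q.out⁻¹
  have hsum : ∑ ω, T ω = 1 := by
    have : ∑ y, φ y = 1 := by ext v; simpa using h3 v
    rw [← this, ← Equiv.sum_comp (MulAction.selfEquivSigmaOrbitsQuotientStabilizer G Y).symm φ,
      Fintype.sum_sigma]
    refine Finset.sum_congr rfl fun ω _ => Finset.sum_congr rfl fun q _ => ?_
    rw [← conj]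
    congr 1
    conv_rhs => rw [← QuotientGroup.out_eq' q]
    rfl
  obtain ⟨ω, -, hω⟩ := unit_of_sum hN Finset.univ T
    (fun ω => trEqv _ _ (stabcomm ω.out)) (by rw [hsum]; exact isUnit_one)
  set y := ω.out with hy
  let R := MulAction.stabilizer G y
  rcases h2 y with hc | ⟨m, f, hf, hm⟩
  · obtain ⟨ι, _, J, α, β, hJ, hα, hβ, hab⟩ := hS3 R hc ⟨N.V, ρ.comp R.subtype⟩
    dsimp only at α β hα hβ hab
    have hφ : Eqv (ρ.comp R.subtype) (ρ.comp R.subtype) (φ y) := fun r v =>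
      (LinearMap.congr_fun (stabcomm y r r.2) v).symm
    let U : ι → Module.End k N.V := fun i =>
      ∑ q : G ⧸ R, ρ q.out * (β i ∘ₗ (α i ∘ₗ φ y)) * ρ q.out⁻¹
    have hU : ∑ i, U i = T ω := by
      rw [Finset.sum_comm]
      refine Finset.sum_congr rfl fun q _ => ?_
      rw [← Finset.sum_mul, ← Finset.mul_sum]
      congr 2
      ext v
      simpa [LinearMap.sum_apply] using hab (φ y v)
    obtain ⟨i, -, hi⟩ := unit_of_sum hN Finset.univ U (fun i => trEqv _ _ (fun r hr => by
        have := (hβ i).comp ((hα i).comp hφ)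
        ext v
        exact (this ⟨r, hr⟩ v).symm)) (by rw [hU]; exact hω)
    refine ⟨coindRP R (J i), Set.mem_iUnion.2 ⟨R, _, hJ i, rfl⟩, ?_⟩
    exact summ_coind ρ R (J i).ρ (α i ∘ₗ φ y) (β i) ((hα i).comp hφ) (hβ i) hi
  · refine ⟨coindRP R (trivRP k R), Set.mem_iUnion.2 ⟨R, _, hS2 R, rfl⟩, ?_⟩
    refine summ_coind ρ R (trivRP k R).ρ f (LinearMap.toSpanSingleton k N.V m)
      (fun r v => (hf r r.2).2 v) (fun r v => ?_) ?_
    · have := (hf r r.2).1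
      have h4 : ∀ c : k, c • m = ρ r (c • m) := fun c => by rw [map_smul, this]
      exact h4 v
    · convert hω using 1
      refine Finset.sum_congr rfl fun q _ => ?_
      congr 2
      ext v
      exact (hm v).symm

theorem finite_good_iso (k G : Type) [Field k] [Group G] [Finite G] (H : Subgroup G)
    (hodd : (H.index : k) = 1) :
    ∃ L : List (RP k G), ∀ N : RP k G, Indec N.ρ → Good (N.ρ.comp H.subtype) →
      ∃ X ∈ L, IsoR N.ρ X.ρ := by
  obtain ⟨S, hS, h⟩ := finite_good k G
  obtain ⟨L', hL'⟩ := finite_summ_list hS.toFinset.toList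
  refine ⟨L', fun N hN hg => hL' N hN ?_⟩
  obtain ⟨X, hX, hs⟩ := h N hN (Good.of_index H hodd hg)
  exact ⟨X, by simpa using hX, hs⟩
end
end Alg

open CategoryTheory CategoryTheory.MonoidalCategory
open AlgebraicModule
namespace Alg

section
variable {k Q : Type} [Field k] [Group Q]

def lin {A B : FDRep k Q} (f : A ⟶ B) : A →ₗ[k] B := f.hom.hom.hom

theorem lin_eqv {A B : FDRep k Q} (f : A ⟶ B) : Eqv A.ρ B.ρ (lin f) := by
  intro g v
  have := f.comm g
  exact congrArg (fun (h : A.V ⟶ B.V) => h.hom.hom v) this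

theorem lin_comp {A B C : FDRep k Q} (f : A ⟶ B) (g : B ⟶ C) (v : A) :
    lin (f ≫ g) v = lin g (lin f v) := rfl

theorem lin_id {A : FDRep k Q} (v : A) : lin (𝟙 A) v = v := rfl

theorem lin_zero {A B : FDRep k Q} (v : A) : lin (0 : A ⟶ B) v = 0 := rfl

theorem lin_ext {A B : FDRep k Q} (f g : A ⟶ B) (h : ∀ v, lin f v = lin g v) : f = g := by
  apply Action.hom_ext
  apply InducedCategory.hom_ext
  apply ModuleCat.hom_ext
  exact LinearMap.ext h

def mkHom {A B : FDRep k Q} (f : A →ₗ[k] B) (h : Eqv A.ρ B.ρ f) : A ⟶ B :=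
  ⟨InducedCategory.homMk (ModuleCat.ofHom f), fun g => by
    apply InducedCategory.hom_ext
    apply ModuleCat.hom_ext
    exact LinearMap.ext (h g)⟩

theorem lin_mkHom {A B : FDRep k Q} (f : A →ₗ[k] B) (h : Eqv A.ρ B.ρ f) (v : A) :
    lin (mkHom f h) v = f v := rfl

theorem nontriv_of_not_zero {A : FDRep k Q} (h : ¬ Limits.IsZero A) : Nontrivial A := by
  by_contra hn
  rw [not_nontrivial_iff_subsingleton] at hn
  apply h
  rw [Limits.IsZero.iff_id_eq_zero]
  apply lin_ext
  intro v
  exact Subsingleton.elim _ _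

theorem good_tensor {G : Type} [Group G] (π : G →* Q) (A B : FDRep k Q)
    (hA : Good (A.ρ.comp π : Representation k G A))
    (hB : Good (B.ρ.comp π : Representation k G B)) :
    Good ((A ⊗ B).ρ.comp π : Representation k G (A ⊗ B : FDRep k Q)) := by
  have h := Good.tprod hA hB
  let e : (A ⊗ B : FDRep k Q) →ₗ[k] TensorProduct k A B := LinearMap.id (M := TensorProduct k A B)
  let e' : TensorProduct k A B →ₗ[k] (A ⊗ B : FDRep k Q) := LinearMap.id (M := TensorProduct k A B)
  exact h.summ ⟨e, e', fun g v => rfl, fun g v => rfl, fun v => rfl⟩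

theorem good_tensorPow {G : Type} [Group G] (π : G →* Q) (M : FDRep k Q)
    (hM : Good (M.ρ.comp π : Representation k G M)) (n : ℕ) :
    Good ((tensorPow M n).ρ.comp π : Representation k G (tensorPow M n)) := by
  induction n with
  | zero => exact hM
  | succ n ih => exact good_tensor π (tensorPow M n) M ih hM

theorem algebraic_of_good {G : Type} [Group G] [Finite G] (π : G →* Q)
    (hπ : Function.Surjective π) (H : Subgroup G) (hodd : (H.index : k) = 1) (M : FDRep k Q)
    (hM : Good (M.ρ.comp (π.comp H.subtype))) : IsAlgebraic M := by
  classical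
  obtain ⟨L, hL⟩ := finite_good_iso k G H hodd
  refine ⟨L.map (fun X => if h : ∃ N : FDRep k Q, IsoR (N.ρ.comp π : Representation k G N) X.ρ
    then h.choose else M), fun N hN ⟨n, i, r, hir⟩ => ?_⟩
  have hnt := nontriv_of_not_zero hN.1
  have hg : Good (N.ρ.comp (π.comp H.subtype)) :=
    (good_tensorPow (π.comp H.subtype) M hM n).summ ⟨lin i, lin r,
      fun g v => lin_eqv i _ v, fun g v => lin_eqv r _ v,
      fun v => by rw [← lin_comp, hir, lin_id]⟩
  have hind : Indec (N.ρ.comp π : Representation k G N) := by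
    refine ⟨hnt, fun e he hee => ?_⟩
    have he' : Eqv N.ρ N.ρ e := by
      intro q v
      obtain ⟨g, rfl⟩ := hπ q
      exact he g v
    rcases hN.2 (mkHom e he') (lin_ext _ _ fun v => hee v) with h | h
    · left; intro v; exact (lin_mkHom e he' v).symm.trans (by rw [h, lin_zero])
    · right; intro v; exact (lin_mkHom e he' v).symm.trans (by rw [h, lin_id])
  obtain ⟨X, hX, e, he⟩ := hL ⟨N, N.ρ.comp π⟩ hind hg
  refine ⟨_, List.mem_map.2 ⟨X, hX, rfl⟩, ?_⟩
  have hex : ∃ N : FDRep k Q, IsoR (N.ρ.comp π : Representation k G N) X.ρ := ⟨N, e, he⟩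
  rw [dif_pos hex]
  have key := hex.choose_spec
  generalize hex.choose = N' at key ⊢
  obtain ⟨e', he'⟩ := key
  dsimp only at e he
  have h1 : Eqv N.ρ N'.ρ (e'.symm.toLinearMap ∘ₗ e.toLinearMap) := by
    intro q v
    obtain ⟨g, rfl⟩ := hπ q
    apply e'.injective
    have := he g v
    have h2 := he' g (e'.symm (e v))
    simp only [LinearEquiv.coe_coe, MonoidHom.comp_apply, LinearEquiv.apply_symm_apply,
      LinearMap.comp_apply] at this h2 ⊢
    rw [h2, this]
  have h2 : Eqv N'.ρ N.ρ (e.symm.toLinearMap ∘ₗ e'.toLinearMap) := by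
    intro q v
    obtain ⟨g, rfl⟩ := hπ q
    apply e.injective
    have := he' g v
    have h2 := he g (e.symm (e' v))
    simp only [LinearEquiv.coe_coe, MonoidHom.comp_apply, LinearEquiv.apply_symm_apply,
      LinearMap.comp_apply] at this h2 ⊢
    rw [h2, this]
  exact ⟨⟨mkHom _ h1, mkHom _ h2, lin_ext _ _ fun v => by
    rw [lin_comp, lin_mkHom, lin_mkHom, lin_id]; simp, lin_ext _ _ fun v => by
    rw [lin_comp, lin_mkHom, lin_mkHom, lin_id]; simp⟩⟩

theorem simple_sub (M : FDRep k Q) (hM : Simple M) : Nontrivial M ∧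
    ∀ p : Submodule k M, (∀ g, ∀ v ∈ p, M.ρ g v ∈ p) → p = ⊥ ∨ p = ⊤ := by
  refine ⟨nontriv_of_not_zero (Simple.not_isZero M), fun p hp => ?_⟩
  let S : FDRep k Q := FDRep.of (subR M.ρ p hp)
  let f : S ⟶ M := mkHom (A := S) p.subtype (fun g v => rfl)
  have hlin : ∀ v : p, lin f v = v.1 := fun v => rfl
  have hmono : Mono f := by
    constructor
    intro Z a b hab
    apply lin_ext
    intro v
    have : lin (a ≫ f) v = lin (b ≫ f) v := by rw [hab]
    rw [lin_comp, lin_comp] at this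
    exact Subtype.ext this
  by_cases h0 : f = 0
  · left
    rw [eq_bot_iff]
    intro v hv
    have : lin f ⟨v, hv⟩ = 0 := by rw [h0]; rfl
    exact this
  · right
    have := (hM.mono_isIso_iff_nonzero f).2 h0
    rw [eq_top_iff]
    intro v _
    have h1 : lin f (lin (inv f) v) = v := by
      rw [← lin_comp, IsIso.inv_hom_id, lin_id]
    rw [← h1]
    exact (lin (inv f) v : p).2
end
end Alg

set_option linter.unusedSectionVars false
namespace Alg

section
variable {k G V : Type} [Field k] [Group G] [Finite G] [AddCommGroup V] [Module k V]
  [FiniteDimensional k V]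

/-- vectors fixed by a subgroup -/
def fixS (ρ : Representation k G V) (W : Subgroup G) : Submodule k V where
  carrier := {v | ∀ w ∈ W, ρ w v = v}
  add_mem' := by intro a b ha hb w hw; rw [map_add, ha w hw, hb w hw]
  zero_mem' := by intro w _; simp
  smul_mem' := by intro c v hv w hw; rw [map_smul, hv w hw]

/-- sum over a subgroup -/
noncomputable def avg (ρ : Representation k G V) (W : Subgroup G) : V →ₗ[k] V :=
  let _ := Fintype.ofFinite W
  ∑ w : W, ρ w

theorem avg_eq (ρ : Representation k G V) (W : Subgroup G) [Fintype W] (v : V) :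
    avg ρ W v = ∑ w : W, ρ w v := by
  unfold avg
  simp only [LinearMap.sum_apply]
  congr!

theorem avg_left (ρ : Representation k G V) (W : Subgroup G) (v : V) (w : G) (hw : w ∈ W) :
    ρ w (avg ρ W v) = avg ρ W v := by
  have := Fintype.ofFinite W
  rw [avg_eq, map_sum]
  exact Fintype.sum_equiv (Equiv.mulLeft (⟨w, hw⟩ : W)) _ _ (fun x => by simp)

theorem avg_mem (ρ : Representation k G V) (W : Subgroup G) (v : V) : avg ρ W v ∈ fixS ρ W :=
  fun w hw => avg_left ρ W v w hw

theorem avg_right (ρ : Representation k G V) (W : Subgroup G) (v : V) (w : G) (hw : w ∈ W) :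
    avg ρ W (ρ w v) = avg ρ W v := by
  have := Fintype.ofFinite W
  rw [avg_eq, avg_eq]
  exact Fintype.sum_equiv (Equiv.mulRight (⟨w, hw⟩ : W)) _ _ (fun x => by simp)

theorem avg_conj (ρ : Representation k G V) (W : Subgroup G) (v : V) (g : G)
    (hg : ∀ w, w ∈ W → g * w * g⁻¹ ∈ W) :
    avg ρ W (ρ g v) = ρ g (avg ρ W v) := by
  have := Fintype.ofFinite W
  rw [avg_eq, avg_eq, map_sum]
  symm
  have hinj : Function.Injective (fun x : W => (⟨g * x * g⁻¹, hg x x.2⟩ : W)) := by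
    intro x y h
    have := congrArg Subtype.val h
    exact Subtype.ext (mul_left_cancel (mul_right_cancel this))
  refine Fintype.sum_bijective _ (Finite.injective_iff_bijective.1 hinj) _ _ (fun x => ?_)
  simp [← Module.End.mul_apply, ← map_mul]

theorem avg_fix [CharP k 2] (ρ : Representation k G V) (W : Subgroup G) (hW : Odd (Nat.card W))
    (v : V) (hv : v ∈ fixS ρ W) : avg ρ W v = v := by
  have := Fintype.ofFinite W
  rw [avg_eq, Finset.sum_congr rfl (fun (x : W) _ => hv x x.2), Finset.sum_const, Finset.card_univ,
    ← Nat.card_eq_fintype_card, ← Nat.cast_smul_eq_nsmul k]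
  obtain ⟨m, hm⟩ := hW
  rw [hm]; push_cast
  have : (2 : k) = 0 := CharP.cast_eq_zero k 2
  rw [this]; simp

theorem good_of_W [CharP k 2] (ρ : Representation k G V) (P W : Subgroup G)
    (hn : ∀ g ∈ P, ∀ w, w ∈ W → g * w * g⁻¹ ∈ W)
    (hc : ∀ w ∈ W, w ≠ 1 → IsCyclic ((Subgroup.centralizer {w}).subgroupOf P))
    (B : Set V) (hB : LinearIndepOn k id B) (hs : ∀ v, avg ρ W v ∈ Submodule.span k B)
    (hP : ∀ g ∈ P, ∀ b ∈ B, ρ g b ∈ B) : Good (ρ.comp P.subtype) := by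
  classical
  have := Fintype.ofFinite W
  have hBf : B.Finite := LinearIndependent.setFinite hB
  have := hBf.fintype
  let bs := Module.Basis.span (v := fun b : B => b.1) hB
  have hr : Set.range (fun b : B => b.1) = B := by simp
  have he : ∀ v, avg ρ W v ∈ Submodule.span k (Set.range (fun b : B => b.1)) := by
    intro v; rw [hr]; exact hs v
  let f : B → V →ₗ[k] k := fun b => bs.coord b ∘ₗ (avg ρ W).codRestrict _ he
  have hf : ∀ v, ∑ b, f b v • b.1 = avg ρ W v := by
    intro v
    have h1 := bs.sum_repr ⟨avg ρ W v, he v⟩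
    have h2 := congrArg Subtype.val h1
    rw [Submodule.coe_sum] at h2
    refine Eq.trans ?_ h2
    refine Finset.sum_congr rfl fun b _ => ?_
    rw [Submodule.coe_smul, Module.Basis.span_apply hB b]
    rfl
  let _ : MulAction P B :=
    { smul := fun g b => ⟨ρ g b, hP g g.2 b b.2⟩
      one_smul := fun b => Subtype.ext (by change ρ 1 b.1 = b.1; simp)
      mul_smul := fun g h b => Subtype.ext (by
        change ρ (g * h : G) b.1 = ρ g (ρ h b.1); simp) }
  have hsm : ∀ (g : P) (b : B), ((g • b : B) : V) = ρ g b := fun _ _ => rfl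
  have hf2 : ∀ (g : P) (b : B) (v : V), f (g • b) (ρ g v) = f b v := by
    intro g b v
    have h1 : ∑ b : B, f (g • b) (ρ g v) • b.1 = ∑ b : B, f b v • b.1 := by
      have h3 : ρ g (∑ b : B, f (g • b) (ρ g v) • b.1) = ρ g (∑ b : B, f b v • b.1) := by
        rw [hf, ← avg_conj ρ W v g (hn g g.2), ← hf, map_sum]
        exact Fintype.sum_equiv (MulAction.toPerm g) _ _ (fun x => by simp [hsm])
      have := congrArg (ρ (g⁻¹ : G)) h3
      simpa [← Module.End.mul_apply, ← map_mul] using this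
    have h2 := Fintype.linearIndependent_iff.1 hB (fun b => f (g • b) (ρ g v) - f b v)
      (by simp only [sub_smul, Finset.sum_sub_distrib]; exact sub_eq_zero.2 h1) b
    exact sub_eq_zero.1 h2
  have g1 : InGood (ρ.comp P.subtype) (avg ρ W) := by
    refine ⟨B, inferInstance, inferInstance, fun b => (f b).smulRight b.1, ?_, ?_, ?_⟩
    · intro g b v
      have h1 := hf2 g b (ρ (g⁻¹ : G) v)
      have h2 : ρ g (ρ (g⁻¹ : G) v) = v := by simp [← Module.End.mul_apply, ← map_mul]
      rw [h2] at h1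
      simp [h1, hsm]
    · intro b
      refine Or.inr ⟨b.1, f b, fun g hg => ⟨?_, fun v => ?_⟩, fun v => rfl⟩
      · exact congrArg Subtype.val (MulAction.mem_stabilizer_iff.1 hg)
      · have h := hf2 g b v
        rw [MulAction.mem_stabilizer_iff.1 hg] at h
        exact h
    · intro v; simpa using hf v
  have g2 : InGood (ρ.comp P.subtype) (LinearMap.id - avg ρ W) := by
    let Y := {w : W // w ≠ 1}
    let _ : MulAction P Y :=
      { smul := fun g w => ⟨⟨g * w * g⁻¹, hn g g.2 w w.1.2⟩, by
          intro h
          apply w.2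
          have := congrArg Subtype.val h
          simp only [OneMemClass.coe_one] at this
          apply Subtype.ext
          simpa using this⟩
        one_smul := fun w => Subtype.ext (Subtype.ext (by
          change (1:G) * w.1.1 * (1:G)⁻¹ = _; simp))
        mul_smul := fun g h w => Subtype.ext (Subtype.ext (by
          change (g * h : G) * w.1.1 * (g * h : G)⁻¹ = g * (h * w.1.1 * (h:G)⁻¹) * (g:G)⁻¹
          group)) }
    have hsm : ∀ (g : P) (w : Y), ((g • w : Y).1 : G) = g * w.1 * (g : G)⁻¹ := fun _ _ => rfl
    refine ⟨Y, inferInstance, inferInstance, fun w => ρ w.1, ?_, ?_, ?_⟩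
    · intro g w v
      change ρ ((g • w : Y).1 : G) v = _
      rw [hsm]; simp
    · intro w
      left
      have h := hc w.1 w.1.2 (by intro h; exact w.2 (Subtype.ext h))
      have : MulAction.stabilizer P w = (Subgroup.centralizer {(w.1 : G)}).subgroupOf P := by
        ext g
        rw [MulAction.mem_stabilizer_iff, Subgroup.mem_subgroupOf,
          Subgroup.mem_centralizer_singleton_iff, Subtype.ext_iff, Subtype.ext_iff, hsm,
          mul_inv_eq_iff_eq_mul]
      rw [this]; exact h
    · intro v
      have h1 : avg ρ W v = v + ∑ w : Y, ρ w.1 v := by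
        rw [avg_eq, ← Finset.add_sum_erase _ _ (Finset.mem_univ (1 : W))]
        congr 1
        · simp
        · rw [← Finset.sum_subtype_of_mem (p := fun w : W => w ≠ 1) (fun w : W => ρ (w : G) v)]
          · refine Finset.sum_congr ?_ (fun _ _ => rfl)
            ext x; simp [x.2]
          · intro x hx; exact (Finset.mem_erase.1 hx).1
      have h2 : (2 : k) = 0 := CharP.cast_eq_zero k 2
      have h3 : ∀ x : V, -x = x := fun x => by
        rw [neg_eq_iff_add_eq_zero, ← two_smul k, h2, zero_smul]
      change ∑ w : Y, ρ w.1 v = v - avg ρ W v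
      rw [h1, sub_add_cancel_left, h3]
  have := g2.add g1
  simpa [Good] using this
end
end Alg

set_option linter.unusedSectionVars false
set_option linter.unusedVariables false
namespace Alg
open Matrix

abbrev M2 (F : Type) := Matrix (Fin 2) (Fin 2) F

section
variable {F : Type} [Field F]
def uu (x : F) : M2 F := !![1, x; 0, 1]
def dg (a b : F) : M2 F := !![a, 0; 0, b]
def w0 : M2 F := !![0, 1; -1, 0]
def kap (a b : F) : M2 F := !![a, -b; b, a]
def vv : M2 F := !![1, 0; 0, -1]

theorem kap_mul (a b c d : F) : kap a b * kap c d = kap (a*c-b*d) (a*d+b*c) := by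
  simp only [kap, Matrix.mul_fin_two]
  congr 1; ext i j; fin_cases i <;> fin_cases j <;> simp <;> ring
theorem kap_comm (a b c d : F) : kap a b * kap c d = kap c d * kap a b := by
  rw [kap_mul, kap_mul]; congr 1 <;> ring
theorem kap_det (a b : F) : (kap a b).det = a*a+b*b := by simp [kap, Matrix.det_fin_two]
theorem kap_one : kap (1:F) 0 = 1 := by
  ext i j; fin_cases i <;> fin_cases j <;> simp [kap]
theorem kap_smul (z a b : F) : z • kap a b = kap (z*a) (z*b) := by
  ext i j; fin_cases i <;> fin_cases j <;> simp [kap]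
theorem kap_pow (a b : F) (n : ℕ) : ∃ c d, kap a b ^ n = kap c d := by
  induction n with
  | zero => exact ⟨1, 0, by rw [kap_one, pow_zero]⟩
  | succ n ih => obtain ⟨c, d, h⟩ := ih; rw [pow_succ, h, kap_mul]; exact ⟨_, _, rfl⟩
theorem kap_inj {a b c d : F} (h : kap a b = kap c d) : a = c ∧ b = d := by
  have h1 := congrFun (congrFun h 0) 0
  have h2 := congrFun (congrFun h 1) 0
  simpa [kap] using And.intro h1 h2
theorem vv_sq : (vv : M2 F) * vv = 1 := by
  ext i j; fin_cases i <;> fin_cases j <;> simp [vv]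
theorem vv_kap (a b : F) : vv * kap a b = kap a (-b) * vv := by
  ext i j; fin_cases i <;> fin_cases j <;> simp [vv, kap]
theorem smul_kap (z : F) : z • (1 : M2 F) = kap z 0 := by rw [← kap_one, kap_smul]; simp

variable [Fintype F]

theorem neg_one_ns (hq : Fintype.card F % 8 = 3) : ¬ IsSquare (-1 : F) := by
  rw [FiniteField.isSquare_neg_one_iff]; omega

theorem two_ne (hq : Fintype.card F % 8 = 3) : (2 : F) ≠ 0 := by
  intro h
  apply neg_one_ns hq
  refine ⟨1, ?_⟩
  linear_combination -h

theorem exists_r (hq : Fintype.card F % 8 = 3) : ∃ r : F, r * r = -2 := by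
  have : IsSquare (-2 : F) := by rw [FiniteField.isSquare_neg_two_iff]; omega
  obtain ⟨r, hr⟩ := this
  exact ⟨r, hr.symm⟩

theorem sumsq (hq : Fintype.card F % 8 = 3) {a b : F} (h : a*a+b*b = 0) : a = 0 ∧ b = 0 := by
  by_cases hb : b = 0
  · subst hb; simpa using h
  · exfalso
    apply neg_one_ns hq
    refine ⟨a/b, ?_⟩
    field_simp
    linear_combination -h

theorem sq_xor (hq : Fintype.card F % 8 = 3) {x : F} (hx : x ≠ 0) : IsSquare (-x) ↔ ¬ IsSquare x := by
  constructor
  · rintro ⟨a, ha⟩ ⟨b, hb⟩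
    have := sumsq hq (a := a) (b := b) (by rw [← ha, ← hb]; ring)
    rw [this.2] at hb; simp at hb; exact hx hb
  · intro h
    have h2 : ringChar F ≠ 2 := by
      intro h2
      apply two_ne hq
      have := ringChar.Nat.cast_ringChar (R := F)
      rw [h2] at this
      exact_mod_cast this
    rw [FiniteField.isSquare_iff h2 hx] at h
    rw [FiniteField.isSquare_iff h2 (neg_ne_zero.2 hx), Odd.neg_pow (by
      rw [Nat.odd_iff]; omega)]
    rcases FiniteField.pow_dichotomy h2 hx with h' | h'
    · exact absurd h' h
    · rw [h']; ring

theorem kap_pow_q (hq : Fintype.card F % 8 = 3) (a b : F) :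
    kap a b ^ (Fintype.card F) = kap a (-b) := by
  obtain ⟨p, hp⟩ := CharP.exists F
  obtain ⟨n, hpr, hn⟩ := FiniteField.card F p
  have : Fact p.Prime := ⟨hpr⟩
  have h1 : ∀ a b : F, kap a b = a • (1 : M2 F) + b • kap 0 1 := by
    intro a b
    ext i j; fin_cases i <;> fin_cases j <;> simp [kap]
  have h2 : Commute (a • (1 : M2 F)) (b • kap 0 1) := by
    apply Commute.smul_left
    exact Commute.one_left _
  have h3 : kap (0:F) 1 ^ (Fintype.card F) = kap 0 (-1) := by
    have e : Fintype.card F = 4 * (Fintype.card F / 4) + 3 := by omega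
    rw [e, pow_add, pow_mul]
    have e4 : kap (0:F) 1 ^ 4 = 1 := by
      rw [show 4 = 2 + 2 from rfl, pow_add, pow_two, kap_mul, kap_mul, ← kap_one]
      congr 1 <;> ring
    rw [e4, one_pow, one_mul, pow_succ, pow_two, kap_mul, kap_mul]
    congr 1 <;> ring
  have hch : CharP (M2 F) p := inferInstance
  rw [h1 a b, h1 a (-b)]
  have h4 : (a • (1 : M2 F) + b • kap 0 1) ^ (Fintype.card F) =
      (a • (1 : M2 F)) ^ (Fintype.card F) + (b • kap 0 1) ^ (Fintype.card F) := by
    rw [hn]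
    exact add_pow_char_pow_of_commute p _ h2
  rw [h4, smul_pow, smul_pow, FiniteField.pow_card, FiniteField.pow_card, one_pow, h3]
  congr 1
  rw [kap_smul, kap_smul]; simp

theorem kap_pow_q1 (hq : Fintype.card F % 8 = 3) (a b : F) :
    kap a b ^ (Fintype.card F + 1) = (a*a+b*b) • (1 : M2 F) := by
  rw [pow_succ, kap_pow_q hq, kap_mul, smul_kap]; congr 1 <;> ring

open Classical in
/-- the odd order part of the norm one torus -/
noncomputable def TT (F : Type) [Field F] [Fintype F] : Finset (M2 F) :=
  Finset.univ.filter fun A => (∃ a b, A = kap a b) ∧ A.det = 1 ∧ A ^ ((Fintype.card F + 1) / 4) = 1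

theorem mem_TT {A : M2 F} : A ∈ TT F ↔
    (∃ a b, A = kap a b) ∧ A.det = 1 ∧ A ^ ((Fintype.card F + 1) / 4) = 1 := by
  simp [TT]

theorem TT_one : (1 : M2 F) ∈ TT F := mem_TT.2 ⟨⟨1, 0, kap_one.symm⟩, by simp, by simp⟩

theorem TT_comm {A B : M2 F} (hA : A ∈ TT F) (hB : ∃ a b, B = kap a b) : A * B = B * A := by
  obtain ⟨⟨a, b, rfl⟩, -⟩ := mem_TT.1 hA
  obtain ⟨c, d, rfl⟩ := hB
  exact kap_comm _ _ _ _

theorem TT_mul {A B : M2 F} (hA : A ∈ TT F) (hB : B ∈ TT F) : A * B ∈ TT F := by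
  have hB' := mem_TT.1 hB
  have hc : Commute A B := TT_comm hA hB'.1
  have hA' := mem_TT.1 hA
  refine mem_TT.2 ⟨?_, ?_, ?_⟩
  · obtain ⟨a, b, rfl⟩ := hA'.1
    obtain ⟨c, d, rfl⟩ := hB'.1
    exact ⟨_, _, kap_mul _ _ _ _⟩
  · rw [det_mul, hA'.2.1, hB'.2.1, one_mul]
  · rw [hc.mul_pow, hA'.2.2, hB'.2.2, one_mul]

theorem vv_conj_pow (A : M2 F) (n : ℕ) : (vv * A * vv) ^ n = vv * A ^ n * vv := by
  induction n with
  | zero => simp [vv_sq]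
  | succ n ih =>
    rw [pow_succ, ih, pow_succ]
    calc vv * A ^ n * vv * (vv * A * vv) = vv * A ^ n * (vv * vv) * A * vv := by noncomm_ring
      _ = _ := by rw [vv_sq]; noncomm_ring

theorem TT_conj {A : M2 F} (hA : A ∈ TT F) : vv * A * vv ∈ TT F := by
  have hA' := mem_TT.1 hA
  refine mem_TT.2 ⟨?_, ?_, ?_⟩
  · obtain ⟨a, b, rfl⟩ := hA'.1
    exact ⟨a, -b, by rw [vv_kap, mul_assoc, vv_sq, mul_one]⟩
  · rw [det_mul, det_mul, hA'.2.1]; simp [vv, Matrix.det_fin_two]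
  · rw [vv_conj_pow, hA'.2.2, mul_one, vv_sq]

theorem TT_inv {A : M2 F} (hA : A ∈ TT F) : A * (vv * A * vv) = 1 := by
  have hA' := mem_TT.1 hA
  obtain ⟨a, b, rfl⟩ := hA'.1
  have := hA'.2.1
  rw [kap_det] at this
  rw [vv_kap, mul_assoc (kap a (-b)), vv_sq, mul_one, kap_mul, ← kap_one]
  congr 1
  · rw [← this]; ring
  · ring

theorem TT_inv' {A : M2 F} (hA : A ∈ TT F) : (vv * A * vv) * A = 1 := by
  rw [TT_comm (TT_conj hA) (mem_TT.1 hA).1, TT_inv hA]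

theorem m_odd (hq : Fintype.card F % 8 = 3) : Odd ((Fintype.card F + 1) / 4) := by
  rw [Nat.odd_iff]; omega

/-- scalar elements of TT are trivial -/
theorem TT_scalar (hq : Fintype.card F % 8 = 3) {z : F} (h : kap z 0 ∈ TT F) : kap z 0 = 1 := by
  have h' := mem_TT.1 h
  have h1 := h'.2.1
  rw [kap_det] at h1
  have h2 := h'.2.2
  rw [← smul_kap, smul_pow, one_pow, smul_kap, ← kap_one] at h2
  have h3 := (kap_inj h2).1
  obtain ⟨j, hj⟩ := m_odd hq
  rw [hj, pow_succ, pow_mul, show z^2 = 1 by rw [← h1]; ring, one_pow, one_mul] at h3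
  rw [h3, kap_one]

variable (r : F)
def cc : M2 F := kap r⁻¹ r⁻¹

theorem w0_eq : (w0 : M2 F) = kap 0 (-1) := by
  ext i j; fin_cases i <;> fin_cases j <;> simp [kap, w0]
theorem w0_sq : (w0 : M2 F) * w0 = kap (-1) 0 := by
  rw [w0_eq, kap_mul]; congr 1 <;> ring
theorem neg_one_kap : (kap (-1) 0 : M2 F) = -1 := by
  ext i j; fin_cases i <;> fin_cases j <;> simp [kap]

theorem r_ne (hr : r * r = -2) (h2 : (2:F) ≠ 0) : r ≠ 0 := by
  rintro rfl; apply h2; linear_combination hr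

theorem cc_sq (hr : r * r = -2) (h2 : (2:F) ≠ 0) : cc r * cc r = w0 := by
  have := r_ne r hr h2
  have h3 : r⁻¹ * r⁻¹ * 2 = -1 := by field_simp; rw [pow_two, hr]; ring
  rw [cc, kap_mul, w0_eq]
  congr 1
  · ring
  · linear_combination h3

theorem vv_cc (hr : r * r = -2) (h2 : (2:F) ≠ 0) : vv * cc r = cc r ^ 3 * vv := by
  rw [pow_succ', pow_two, cc_sq r hr h2, cc, vv_kap, w0_eq, kap_mul]
  congr 2 <;> ring

theorem cc_four (hr : r * r = -2) (h2 : (2:F) ≠ 0) : cc r ^ 4 = -1 := by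
  rw [show 4 = 2 + 2 from rfl, pow_add, pow_two, cc_sq r hr h2, w0_sq, neg_one_kap]

theorem TT_pow {A : M2 F} (hA : A ∈ TT F) (n : ℕ) : A ^ n ∈ TT F := by
  induction n with
  | zero => simpa using TT_one
  | succ n ih => rw [pow_succ]; exact TT_mul ih hA

theorem lemT (hq : Fintype.card F % 8 = 3) (hr : r * r = -2) (a b : F) (h : ¬ (a = 0 ∧ b = 0)) :
    ∃ t ∈ TT F, ∃ j : ℕ, ∃ z : F, z ≠ 0 ∧ kap a b = z • (t * cc r ^ j) := by
  have h2 := two_ne hq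
  have hr0 := r_ne r hr h2
  set m := (Fintype.card F + 1) / 4 with hm
  have hm4 : 4 * m = Fintype.card F + 1 := by omega
  set N := a*a+b*b with hN
  have hN0 : N ≠ 0 := fun h0 => h (sumsq hq h0)
  have hb := kap_pow_q1 hq a b
  rw [← hN] at hb
  suffices hs : ∃ t ∈ TT F, ∃ j : ℕ, ∃ z : F, kap a b = z • (t * cc r ^ j) by
    obtain ⟨t, ht, j, z, hz⟩ := hs
    refine ⟨t, ht, j, z, ?_, hz⟩
    rintro rfl
    have h0 : kap a b = kap 0 0 := by
      rw [hz, zero_smul]; ext i j; fin_cases i <;> fin_cases j <;> simp [kap]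
    exact h (kap_inj h0)
  obtain ⟨n', hn'⟩ : ∃ n', m * m = 1 + 8 * n' := by
    obtain ⟨i, hi⟩ := m_odd hq
    rw [← hm] at hi
    obtain ⟨e, he⟩ := Nat.even_mul_succ_self i
    refine ⟨e / 1 * 1, ?_⟩
    rw [hi]; simp; nlinarith
  have ht0 : (N⁻¹)^4 • kap a b ^ 8 ∈ TT F := by
    refine mem_TT.2 ⟨?_, ?_, ?_⟩
    · obtain ⟨c, d, hcd⟩ := kap_pow a b 8
      exact ⟨_, _, by rw [hcd, kap_smul]⟩
    · rw [det_smul, det_pow, kap_det, ← hN]; simp; field_simp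
    · rw [← hm, smul_pow, ← pow_mul, ← pow_mul, hm4, show 8 * m = (Fintype.card F + 1) * 2 by omega,
        pow_mul (kap a b), hb, smul_pow, one_pow, smul_smul, pow_succ, FiniteField.pow_card]
      field_simp; simp
  have ht1 := TT_pow ht0 n'
  set t1 := ((N⁻¹)^4 • kap a b ^ 8) ^ n' with ht1'
  obtain ⟨d0, d1, hd⟩ := kap_pow a b (m * m)
  have h4 : kap d0 d1 ^ 4 = kap (N^m) 0 := by
    rw [← hd, ← pow_mul, show m * m * 4 = (Fintype.card F + 1) * m by rw [← hm4]; ring, pow_mul, hb,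
      smul_pow, one_pow, smul_kap]
  have hδ : ∃ j : ℕ, ∃ z : F, kap d0 d1 = z • cc r ^ j := by
    rw [show 4 = 2 + 2 from rfl, pow_add, pow_two, kap_mul, kap_mul] at h4
    have h5 := (kap_inj h4).2
    have h6 : (2:F) * 2 * d0 * d1 * ((d0 - d1) * (d0 + d1)) = 0 := by linear_combination h5
    rcases mul_eq_zero.1 h6 with h7 | h7
    · rcases mul_eq_zero.1 h7 with h8 | h8
      · have : d0 = 0 := by
          rcases mul_eq_zero.1 h8 with h9 | h9
          · exact absurd h9 (mul_ne_zero h2 h2)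
          · exact h9
        subst this
        refine ⟨2, -d1, ?_⟩
        rw [pow_two, cc_sq r hr h2, w0_eq, kap_smul]; congr 1 <;> ring
      · subst h8
        exact ⟨0, d0, by rw [pow_zero, smul_kap]⟩
    · rcases mul_eq_zero.1 h7 with h8 | h8
      · refine ⟨1, d0 * r, ?_⟩
        have : d1 = d0 := by linear_combination -h8
        subst this
        rw [pow_one, cc, kap_smul]; congr 1 <;> field_simp
      · refine ⟨3, d0 * r, ?_⟩
        have : d1 = -d0 := by linear_combination h8
        subst this
        rw [pow_succ, pow_two, cc_sq r hr h2, cc, w0_eq, kap_mul, kap_smul]; congr 1 <;> field_simp <;> ring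
  obtain ⟨j, z, hz⟩ := hδ
  have hβ : kap a b * t1 = ((N⁻¹)^4)^n' • kap d0 d1 := by
    rw [ht1', smul_pow, ← hd, hn', pow_add, pow_one, pow_mul (kap a b), mul_smul_comm]
  refine ⟨vv * t1 * vv, TT_conj ht1, j, ((N⁻¹)^4)^n' * z, ?_⟩
  calc kap a b = kap a b * (t1 * (vv * t1 * vv)) := by rw [TT_inv ht1, mul_one]
    _ = (((N⁻¹)^4)^n' • (z • cc r ^ j)) * (vv * t1 * vv) := by rw [← mul_assoc, hβ, hz]
    _ = _ := by
      rw [smul_smul, smul_mul_assoc]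
      congr 1
      obtain ⟨c, d, hcd⟩ := kap_pow r⁻¹ r⁻¹ j
      exact (TT_comm (TT_conj ht1) ⟨c, d, hcd⟩).symm

/-- `t c^j` scalar with `j<4` forces triviality -/
theorem tc_scalar (hq : Fintype.card F % 8 = 3) (hr : r * r = -2) {t : M2 F} (ht : t ∈ TT F) {j : ℕ}
    (hj : j < 4) (h : (t * cc r ^ j) 1 0 = 0) : t = 1 ∧ j = 0 := by
  have h2 := two_ne hq
  have hr0 := r_ne r hr h2
  obtain ⟨c, d, hcd⟩ := kap_pow r⁻¹ r⁻¹ j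
  obtain ⟨⟨a, b, hab⟩, -, htm⟩ := mem_TT.1 ht
  have hcomm : Commute t (cc r ^ j) := TT_comm ht ⟨c, d, hcd⟩
  have hz : ∃ z, t * cc r ^ j = kap z 0 := by
    rw [cc, hcd, hab, kap_mul] at h ⊢
    simp [kap] at h
    exact ⟨_, by rw [h]⟩
  obtain ⟨z, hz⟩ := hz
  have h3 := hcomm.mul_pow ((Fintype.card F + 1) / 4)
  rw [htm, hz, one_mul, ← pow_mul, ← smul_kap, smul_pow, one_pow] at h3
  obtain ⟨i, hi⟩ := m_odd hq
  have key : ∀ n : ℕ, (cc r ^ n) 1 0 = 0 → 4 ∣ n := by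
    intro n hn
    have e : n = 4 * (n / 4) + n % 4 := by omega
    rw [e, pow_add, pow_mul, cc_four r hr h2] at hn
    have : n % 4 < 4 := Nat.mod_lt _ (by norm_num)
    have hn' : (cc r ^ (n % 4)) 1 0 = 0 := by
      rcases neg_one_pow_eq_or (M2 F) (n / 4) with h | h <;> rw [h] at hn <;> simpa using hn
    have h1 : cc r ^ 1 = kap r⁻¹ r⁻¹ := by rw [pow_one, cc]
    have h22 : cc r ^ 2 = kap 0 (-1) := by rw [pow_two, cc_sq r hr h2, w0_eq]
    have h33 : cc r ^ 3 = kap r⁻¹ (-r⁻¹) := by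
      rw [pow_succ, h22, cc, kap_mul]; congr 1 <;> ring
    have : n % 4 = 0 ∨ n % 4 = 1 ∨ n % 4 = 2 ∨ n % 4 = 3 := by omega
    rcases this with h | h | h | h <;> rw [h] at hn'
    · omega
    · rw [h1] at hn'; simp [kap, hr0] at hn'
    · rw [h22] at hn'; simp [kap] at hn'
    · rw [h33] at hn'; simp [kap, hr0] at hn'
  have h4 := key _ (by rw [← h3, smul_kap]; simp [kap])
  have hj0 : j = 0 := by
    have h5 : Nat.Coprime 4 ((Fintype.card F + 1) / 4) := by
      rw [show 4 = 2^2 from rfl]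
      exact (Nat.coprime_two_left.2 (m_odd hq)).pow_left 2
    have := h5.dvd_of_dvd_mul_right h4
    omega
  subst hj0
  rw [pow_zero, mul_one] at hz
  exact ⟨by rw [hz] at ht ⊢; exact TT_scalar hq ht, rfl⟩
end
end Alg

set_option linter.unusedSectionVars false
set_option linter.unusedVariables false
namespace Alg
open Module

section
variable {k V : Type} [Field k] [CharP k 2] [AddCommGroup V] [Module k V] [FiniteDimensional k V]

theorem add_self2 (k : Type) {V : Type} [Field k] [CharP k 2] [AddCommGroup V] [Module k V] (x : V) :
    x + x = 0 := by
  rw [← two_smul k, show (2 : k) = 0 from CharP.cast_eq_zero k 2, zero_smul]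

theorem eq_of_add_zero (k : Type) {V : Type} [Field k] [CharP k 2] [AddCommGroup V] [Module k V]
    {x y : V} (h : x + y = 0) : x = y := by
  have := add_self2 k y
  exact add_right_cancel (h.trans this.symm)

/-- rank-nullity on a submodule -/
theorem rn (f : End k V) (S : Submodule k V) :
    finrank k (S.map f) + finrank k (S ⊓ LinearMap.ker f : Submodule k V) = finrank k S := by
  have h := LinearMap.finrank_range_add_finrank_ker (f.domRestrict S)
  rw [LinearMap.range_domRestrict] at h
  rw [← h]
  congr 1
  have : LinearMap.ker (f.domRestrict S) = (LinearMap.ker f).comap S.subtype := by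
    ext x; simp
  rw [this, ← Submodule.map_comap_subtype, Submodule.finrank_map_subtype_eq]

/-- existence of a stable basis -/
def PB (C W : End k V) (D : Submodule k V) : Prop :=
  ∃ B : Set V, LinearIndepOn k id B ∧ Submodule.span k B = D ∧ ∀ b ∈ B, C b ∈ B ∧ W b ∈ B

theorem PB_cyc (C W : End k V) (d : V) (N : ℕ) (s : ℕ) (hN : 0 < N)
    (hW : ∀ x, W (C x) = (C ^ 3) (W x))
    (hd : (C ^ N) d = d) (hs : W d = (C ^ s) d)
    (hli : LinearIndependent k (fun j : Fin N => (C ^ (j : ℕ)) d)) (D : Submodule k V)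
    (hD : Submodule.span k (Set.range (fun j : Fin N => (C ^ (j : ℕ)) d)) = D) : PB C W D := by
  have h1 : ∀ n : ℕ, (C ^ n) d ∈ Set.range (fun j : Fin N => (C ^ (j : ℕ)) d) := by
    intro n
    refine ⟨⟨n % N, Nat.mod_lt _ hN⟩, ?_⟩
    have e : n = n % N + N * (n / N) := by rw [Nat.mod_add_div]
    have h2 : ∀ i : ℕ, ((C ^ N) ^ i) d = d := by
      intro i
      induction i with
      | zero => simp
      | succ i ih => rw [pow_succ, Module.End.mul_apply, hd, ih]
    conv_rhs => rw [e, pow_add, Module.End.mul_apply, pow_mul, h2]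
  have h3 : ∀ n : ℕ, W ((C ^ n) d) = (C ^ (3 * n + s)) d := by
    intro n
    induction n with
    | zero => simpa using hs
    | succ n ih =>
      rw [pow_succ', Module.End.mul_apply, hW, ih, ← Module.End.mul_apply, ← pow_add]
      congr 2; ring
  refine ⟨_, hli.linearIndepOn_id, hD, ?_⟩
  rintro _ ⟨j, rfl⟩
  constructor
  · have := h1 (j + 1)
    rwa [pow_succ', Module.End.mul_apply] at this
  · dsimp only
    rw [h3]; exact h1 _

theorem four_indep (C : End k V) (d : V) (h4 : (C ^ 4) d = d)
    (hN : d + C d + (C ^ 2) d + (C ^ 3) d ≠ 0) :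
    LinearIndependent k (fun j : Fin 4 => (C ^ (j : ℕ)) d) := by
  rw [Fintype.linearIndependent_iff]
  intro g hg
  have t2 : (2 : k) = 0 := CharP.cast_eq_zero k 2
  obtain ⟨x0, hx0⟩ : ∃ x, x = d := ⟨_, rfl⟩
  obtain ⟨x1, hx1⟩ : ∃ x, x = C d := ⟨_, rfl⟩
  obtain ⟨x2, hx2⟩ : ∃ x, x = (C ^ 2) d := ⟨_, rfl⟩
  obtain ⟨x3, hx3⟩ : ∃ x, x = (C ^ 3) d := ⟨_, rfl⟩
  have e0 : C x0 = x1 := by rw [hx0, hx1]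
  have e1 : C x1 = x2 := by rw [hx2, hx1, pow_two, Module.End.mul_apply]
  have e2 : C x2 = x3 := by rw [hx2, hx3, pow_succ' C 2, Module.End.mul_apply]
  have e3 : C x3 = x0 := by rw [hx0, hx3, ← Module.End.mul_apply, ← pow_succ', h4]
  rw [Fin.sum_univ_four] at hg
  simp only [Fin.val_zero, pow_zero, Fin.val_one, pow_one, Module.End.one_apply] at hg
  change g 0 • d + g 1 • C d + g 2 • (C ^ 2) d + g 3 • (C ^ 3) d = 0 at hg
  rw [← hx1, ← hx2, ← hx3, ← hx0] at hg hN
  set a := g 0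
  set b := g 1
  set c := g 2
  set e := g 3
  have f1 : a • x1 + b • x2 + c • x3 + e • x0 = 0 := by
    have := congrArg C hg
    simpa only [map_add, map_smul, e0, e1, e2, e3, map_zero] using this
  have f2 : a • x2 + b • x3 + c • x0 + e • x1 = 0 := by
    have := congrArg C f1
    simpa only [map_add, map_smul, e0, e1, e2, e3, map_zero] using this
  have f3 : a • x3 + b • x0 + c • x1 + e • x2 = 0 := by
    have := congrArg C f2
    simpa only [map_add, map_smul, e0, e1, e2, e3, map_zero] using this
  have s0 : (a + b + c + e) • (x0 + x1 + x2 + x3) = 0 := by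
    linear_combination (norm := module) hg + f1 + f2 + f3
  have z0 : a + b + c + e = 0 := (smul_eq_zero.1 s0).resolve_right hN
  have s1 : (a + c) • (x0 + x1 + x2 + x3) = 0 := by
    have h := congrArg₂ (· + ·) hg f2
    have h' : b + e = a + c := by linear_combination z0 - (a+c) * t2
    have h2 : (a + c) • (x0 + x2) + (b + e) • (x1 + x3) = 0 := by
      linear_combination (norm := module) hg + f2
    rw [h'] at h2
    linear_combination (norm := module) h2
  have z1 : a + c = 0 := (smul_eq_zero.1 s1).resolve_right hN
  have s2 : (a + b) • (x0 + x1 + x2 + x3) = 0 := by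
    have hc : c = a := by linear_combination z1 - a * t2
    have he : e = b := by linear_combination z0 - z1 - b * t2
    rw [hc, he] at hg f1
    linear_combination (norm := module) hg + f1
  have z2 : a + b = 0 := (smul_eq_zero.1 s2).resolve_right hN
  have s3 : a • (x0 + x1 + x2 + x3) = 0 := by
    have hc : c = a := by linear_combination z1 - a * t2
    have hb : b = a := by linear_combination z2 - a * t2
    have he : e = a := by linear_combination z0 - z1 - b * t2 + hb
    rw [hc, he, hb] at hg
    linear_combination (norm := module) hg
  have z3 : a = 0 := (smul_eq_zero.1 s3).resolve_right hN
  have zb : b = 0 := by linear_combination z2 - z3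
  have zc : c = 0 := by linear_combination z1 - z3
  have ze : e = 0 := by linear_combination z0 - z1 - zb
  intro i; fin_cases i <;> assumption

theorem two_indep (C : End k V) (d : V) (h2 : (C ^ 2) d = d) (hN : d + C d ≠ 0) :
    LinearIndependent k (fun j : Fin 2 => (C ^ (j : ℕ)) d) := by
  rw [Fintype.linearIndependent_iff]
  intro g hg
  have t2 : (2 : k) = 0 := CharP.cast_eq_zero k 2
  rw [Fin.sum_univ_two] at hg
  simp only [Fin.val_zero, pow_zero, Fin.val_one, pow_one, Module.End.one_apply] at hg
  have e : C (C d) = d := by rw [← Module.End.mul_apply, ← pow_two, h2]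
  have f1 : g 0 • C d + g 1 • d = 0 := by
    have := congrArg C hg
    simpa only [map_add, map_smul, e, map_zero] using this
  have s0 : (g 0 + g 1) • (d + C d) = 0 := by linear_combination (norm := module) hg + f1
  have z0 := (smul_eq_zero.1 s0).resolve_right hN
  have s1 : g 0 • (d + C d) = 0 := by
    have h : g 1 = g 0 := by linear_combination z0 - g 0 * t2
    rw [h] at hg
    linear_combination (norm := module) hg
  have z1 := (smul_eq_zero.1 s1).resolve_right hN
  intro i; fin_cases i
  · exact z1
  · change g 1 = 0
    linear_combination z0 - z1

theorem map_lt (n : End k V) (S : Submodule k V) (hS : ∀ x ∈ S, n x ∈ S) (h4 : ∀ x ∈ S, (n ^ 4) x = 0)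
    (h0 : 0 < finrank k S) : finrank k (S.map n) < finrank k S := by
  have hle : S.map n ≤ S := by rintro _ ⟨x, hx, rfl⟩; exact hS x hx
  by_contra hcon
  have heq : S.map n = S := Submodule.eq_of_le_of_finrank_le hle (not_lt.1 hcon)
  have h1 : ∀ x ∈ S, ∃ y ∈ S, n y = x := by
    intro x hx; rw [← heq] at hx; exact hx
  have : S = ⊥ := by
    rw [eq_bot_iff]
    intro x hx
    obtain ⟨a, ha, rfl⟩ := h1 x hx
    obtain ⟨b, hb, rfl⟩ := h1 a ha
    obtain ⟨c, hc, rfl⟩ := h1 b hb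
    obtain ⟨d, hd, rfl⟩ := h1 c hc
    exact h4 d hd
  rw [this, finrank_bot] at h0
  exact lt_irrefl _ h0

/-- square-zero free criterion -/
theorem free_dim (f : End k V) (S : Submodule k V) (h1 : S.map f = S ⊓ LinearMap.ker f) :
    finrank k S = 2 * finrank k (S ⊓ LinearMap.ker f : Submodule k V) := by
  have := rn f S
  rw [h1] at this; omega

theorem dim_four (n : End k V) (h4 : n ^ 4 = 0)
    (h2 : 2 * finrank k (LinearMap.ker (n ^ 2)) = finrank k V) :
    finrank k V = 4 * finrank k (LinearMap.ker n) := by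
  have hn4 : ∀ x, n (n (n (n x))) = 0 := fun x => by
    have := LinearMap.congr_fun h4 x; simpa [pow_succ] using this
  have hp2 : ∀ x, (n ^ 2) x = n (n x) := fun x => by simp [pow_succ]
  have hp3 : ∀ x, (n ^ 3) x = n (n (n x)) := fun x => by simp [pow_succ]
  have hle : LinearMap.range (n ^ 2) ≤ LinearMap.ker (n ^ 2) := by
    rintro _ ⟨x, rfl⟩
    rw [LinearMap.mem_ker, hp2, hp2]; exact hn4 x
  have hr := LinearMap.finrank_range_add_finrank_ker (n ^ 2)
  have heq : LinearMap.range (n ^ 2) = LinearMap.ker (n ^ 2) :=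
    Submodule.eq_of_le_of_finrank_le hle (by omega)
  have key : ∀ x, n (n x) = 0 → ∃ y, n (n y) = x := by
    intro x hx
    have : x ∈ LinearMap.ker (n ^ 2) := by rw [LinearMap.mem_ker, hp2]; exact hx
    rw [← heq] at this
    obtain ⟨y, hy⟩ := this
    exact ⟨y, by rw [← hp2, hy]⟩
  have h13 : LinearMap.range (n ^ 3) = LinearMap.ker n := by
    apply le_antisymm
    · rintro _ ⟨x, rfl⟩
      rw [LinearMap.mem_ker, hp3]; exact hn4 x
    · intro v hv
      rw [LinearMap.mem_ker] at hv
      obtain ⟨w, rfl⟩ := key v (by rw [hv, map_zero])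
      obtain ⟨z, hz⟩ := key (n w) hv
      obtain ⟨z', hz'⟩ := key (w - n z) (by rw [map_sub, hz, sub_self, map_zero])
      refine ⟨z, ?_⟩
      rw [hp3]
      have : w = n z + n (n z') := by rw [hz']; abel
      rw [this]; simp [hn4]
  have r3 := LinearMap.finrank_range_add_finrank_ker (n ^ 3)
  have q := rn (n ^ 2) (LinearMap.ker (n ^ 3))
  have e1 : (LinearMap.ker (n ^ 3)).map (n ^ 2) = LinearMap.ker n := by
    apply le_antisymm
    · rintro _ ⟨x, hx, rfl⟩
      have hx' : (n ^ 3) x = 0 := hx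
      rw [LinearMap.mem_ker, hp2, ← hp3, hx']
    · intro v hv
      rw [LinearMap.mem_ker] at hv
      obtain ⟨w, rfl⟩ := key v (by rw [hv, map_zero])
      refine ⟨w, ?_, hp2 w⟩
      change (n ^ 3) w = 0
      rw [hp3, hv]
  have e2 : LinearMap.ker (n ^ 3) ⊓ LinearMap.ker (n ^ 2) = LinearMap.ker (n ^ 2) := by
    rw [inf_eq_right]
    intro x hx
    rw [LinearMap.mem_ker, hp2] at hx
    rw [LinearMap.mem_ker, hp3, hx, map_zero]
  rw [e1, e2] at q
  rw [h13] at r3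
  omega
end
end Alg

set_option linter.unusedSectionVars false
set_option linter.unusedVariables false
namespace Alg
open Module

section
variable {k V : Type} [Field k] [CharP k 2] [AddCommGroup V] [Module k V] [FiniteDimensional k V]

def fixE (e : End k V) : Submodule k V := LinearMap.ker (e - 1)
theorem mem_fixE {e : End k V} {x : V} : x ∈ fixE e ↔ e x = x := by
  simp [fixE, sub_eq_zero]

theorem mem_kp {f : End k V} {x : V} : x ∈ LinearMap.ker (f + 1) ↔ f x = x := by
  rw [LinearMap.mem_ker, LinearMap.add_apply, Module.End.one_apply]
  constructor
  · exact eq_of_add_zero k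
  · intro h; rw [h, add_self2 k]

theorem caseA_LA (C W e φ φ2 g : End k V) (he : ∀ x, e (e x) = e x) (hCe : ∀ x, e (C x) = C (e x))
    (hWe : ∀ x, e (W x) = W (e x)) (hC4 : ∀ x, (C ^ 4) x = x) (hW2 : ∀ x, W (W x) = x)
    (hW : ∀ x, W (C x) = (C ^ 3) (W x))
    (hg1 : ∀ x y, e x = x → e y = y → C x = x → C y = y → x ≠ 0 → ∃ c : k, y = c • x)
    (hφ : ∀ x, φ x + W (φ (W x)) = x)
    (hφe : ∀ x, e (φ2 x) = φ2 (e x))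
    (hφ2 : ∀ x, e x = 0 → φ2 x + C (W (φ2 (C (W x)))) = x)
    (hgi : Function.Bijective g) (hgc : ∀ x, g (C (C x)) = C (W (g x)))
    (hdim : finrank k V % 4 = 2) : PB C W (fixE e) := by
  have hC4' : ∀ x, C (C (C (C x))) = x := fun x => by
    have := hC4 x; simpa [pow_succ] using this
  set D := fixE e with hD
  set R := LinearMap.ker e with hR
  set n := C + 1 with hn
  set y := C * W with hy
  set X := C * C with hX
  have ya : ∀ x, y x = C (W x) := fun _ => rfl
  have Xa : ∀ x, X x = C (C x) := fun _ => rfl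
  have na : ∀ x, n x = C x + x := fun _ => rfl
  have n2 : n ^ 2 = X + 1 := by
    apply LinearMap.ext; intro x
    rw [pow_two, Module.End.mul_apply, na, na, map_add, LinearMap.add_apply, Xa]
    have := add_self2 k (C x)
    simp only [Module.End.one_apply]
    calc _ = C (C x) + (C x + C x) + x := by abel
      _ = _ := by rw [this, add_zero]
  have hXX : ∀ x, X (X x) = x := hC4'
  have n4 : n ^ 4 = 0 := by
    apply LinearMap.ext; intro x
    rw [show 4 = 2 + 2 from rfl, pow_add, n2, Module.End.mul_apply]
    simp only [LinearMap.add_apply, Module.End.one_apply, map_add, hXX, LinearMap.zero_apply]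
    calc _ = (x + x) + (X x + X x) := by abel
      _ = 0 := by rw [add_self2 k, add_self2 k, add_zero]
  have hDn : ∀ x ∈ D, n x ∈ D := by
    intro x hx; rw [hD, mem_fixE] at *; rw [na, map_add, hCe, hx]
  have hDmem : ∀ {x}, x ∈ D ↔ e x = x := mem_fixE
  have hyy : ∀ x, y (y x) = x := by
    intro x
    have h3 : (C ^ 3) x = C (C (C x)) := by simp [pow_succ]
    rw [ya, ya, hW, hW2, h3, hC4']
  -- D is W-free
  have evenD : finrank k D = 2 * finrank k (D ⊓ LinearMap.ker (W + 1) : Submodule k V) := by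
    apply free_dim
    apply le_antisymm
    · rintro _ ⟨x, hx, rfl⟩
      refine ⟨?_, ?_⟩
      · have hx' := hDmem.1 hx
        apply hDmem.2
        simp [hWe, hx']
      · apply mem_kp.2
        simp [hW2, add_comm]
    · rintro x ⟨hx, hx2⟩
      have hx' := hDmem.1 hx
      have hx3 := mem_kp.1 hx2
      refine ⟨e (φ x), hDmem.2 (he _), ?_⟩
      have := congrArg e (hφ x)
      rw [map_add, hWe, hx3, hx'] at this
      simpa [add_comm] using this
  -- R is y-free
  have evenR : finrank k R = 2 * finrank k (R ⊓ LinearMap.ker (y + 1) : Submodule k V) := by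
    apply free_dim
    apply le_antisymm
    · rintro _ ⟨x, hx, rfl⟩
      have hx' : e x = 0 := hx
      refine ⟨?_, ?_⟩
      · change e _ = 0
        simp [ya, hWe, hCe, hx']
      · apply mem_kp.2
        simp [hyy, add_comm]
    · rintro x ⟨hx, hx2⟩
      have hx' : e x = 0 := hx
      have hx3 := mem_kp.1 hx2
      refine ⟨φ2 x, ?_, ?_⟩
      · change e _ = 0
        rw [hφe, hx', map_zero]
      · have := hφ2 x hx'
        rw [← ya, ← ya, hx3] at this
        simpa [add_comm] using this
  have leR : finrank k R ≤ 2 * finrank k (R ⊓ LinearMap.ker (X + 1) : Submodule k V) := by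
    have h1 := rn (X + 1) R
    have h2 : R.map (X + 1) ≤ R ⊓ LinearMap.ker (X + 1) := by
      rintro _ ⟨x, hx, rfl⟩
      have hx' : e x = 0 := hx
      refine ⟨?_, ?_⟩
      · change e _ = 0
        simp [Xa, hCe, hx']
      · apply mem_kp.2
        simp [hXX, add_comm]
    have := Submodule.finrank_mono h2
    omega
  -- decomposition of e-stable submodules
  have dec : ∀ S : Submodule k V, (∀ x ∈ S, e x ∈ S) → finrank k S =
      finrank k (D ⊓ S : Submodule k V) + finrank k (R ⊓ S : Submodule k V) := by
    intro S hS
    have h1 := rn e S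
    have h2 : S.map e = D ⊓ S := by
      apply le_antisymm
      · rintro _ ⟨x, hx, rfl⟩
        exact ⟨hDmem.2 (he x), hS x hx⟩
      · rintro x ⟨h, h'⟩
        exact ⟨x, h', hDmem.1 h⟩
    rw [h2, inf_comm S, ← hR] at h1
    omega
  have decV := dec ⊤ (fun _ _ => trivial)
  rw [finrank_top, inf_top_eq, inf_top_eq] at decV
  have decX := dec (LinearMap.ker (X + 1)) (fun x hx => by
    rw [mem_kp] at *; rw [Xa, ← hCe, ← hCe, ← Xa, hx])
  have decy := dec (LinearMap.ker (y + 1)) (fun x hx => by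
    rw [mem_kp] at *; rw [ya, ← hWe, ← hCe, ← ya, hx])
  have conj : finrank k (LinearMap.ker (X + 1)) = finrank k (LinearMap.ker (y + 1)) := by
    have h1 : (LinearMap.ker (X + 1)).map g = LinearMap.ker (y + 1) := by
      apply le_antisymm
      · rintro _ ⟨x, hx, rfl⟩
        have hx' := mem_kp.1 hx
        rw [mem_kp, ya, ← hgc, ← Xa, hx']
      · intro z hz
        obtain ⟨x, rfl⟩ := hgi.2 z
        refine ⟨x, ?_, rfl⟩
        rw [mem_kp, ya, ← hgc, ← Xa] at hz
        exact mem_kp.2 (hgi.1 hz)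
    rw [← h1]
    exact (LinearEquiv.finrank_eq (Submodule.equivMapOfInjective g hgi.1 _))
  -- the kernel of n on D has dimension at most one
  have k1 : finrank k (D ⊓ LinearMap.ker n : Submodule k V) ≤ 1 := by
    by_cases hb : D ⊓ LinearMap.ker n = ⊥
    · rw [hb, finrank_bot]; omega
    · obtain ⟨x, hx, hx0⟩ := Submodule.exists_mem_ne_zero_of_ne_bot hb
      apply finrank_le_one (⟨x, hx⟩ : (D ⊓ LinearMap.ker n : Submodule k V))
      rintro ⟨z, hz⟩
      obtain ⟨c, hc⟩ := hg1 x z (hDmem.1 hx.1) (hDmem.1 hz.1) (mem_kp.1 hx.2) (mem_kp.1 hz.2) hx0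
      exact ⟨c, Subtype.ext hc.symm⟩
  have kstep : ∀ i, finrank k (D ⊓ LinearMap.ker (n ^ (i+1)) : Submodule k V) ≤
      finrank k (D ⊓ LinearMap.ker (n ^ i) : Submodule k V) + 1 := by
    intro i
    have h1 := rn n (D ⊓ LinearMap.ker (n ^ (i+1)))
    have h2 : (D ⊓ LinearMap.ker (n ^ (i+1))).map n ≤ D ⊓ LinearMap.ker (n ^ i) := by
      rintro _ ⟨x, hx, rfl⟩
      refine ⟨hDn x hx.1, ?_⟩
      have h3 : (n ^ (i+1)) x = 0 := hx.2
      change (n ^ i) (n x) = 0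
      rw [← Module.End.mul_apply, ← pow_succ, h3]
    have h3 : D ⊓ LinearMap.ker (n ^ (i+1)) ⊓ LinearMap.ker n ≤ D ⊓ LinearMap.ker n :=
      inf_le_inf_right _ inf_le_left
    have h4 := Submodule.finrank_mono h2
    have h5 := Submodule.finrank_mono h3
    omega
  obtain ⟨K, hK⟩ : ∃ K : ℕ → ℕ, ∀ i, K i = finrank k (D ⊓ LinearMap.ker (n ^ i) : Submodule k V) :=
    ⟨_, fun _ => rfl⟩
  have s1 : K 1 ≤ K 0 + 1 := by rw [hK, hK]; exact kstep 0
  have s2 : K 2 ≤ K 1 + 1 := by rw [hK, hK]; exact kstep 1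
  have s3 : K 3 ≤ K 2 + 1 := by rw [hK, hK]; exact kstep 2
  have s4 : K 4 ≤ K 3 + 1 := by rw [hK, hK]; exact kstep 3
  have z0 : K 0 = 0 := by
    have : D ⊓ LinearMap.ker (n ^ 0) = ⊥ := by
      rw [eq_bot_iff]; rintro x ⟨-, hx⟩
      simpa using hx
    rw [hK, this, finrank_bot]
  have z4 : K 4 = finrank k D := by
    have : D ⊓ LinearMap.ker (n ^ 4) = D := by
      rw [inf_eq_left]
      intro x _
      rw [LinearMap.mem_ker, n4]; rfl
    rw [hK, this]
  have d4 : finrank k D ≤ 4 := by omega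
  have hD02 : finrank k D = 0 ∨ finrank k D = 2 ∨ finrank k D = 4 := by omega
  rcases hD02 with h0 | h2 | h4
  · have : D = ⊥ := Submodule.finrank_eq_zero.1 h0
    rw [this]
    exact ⟨∅, linearIndepOn_empty _ _, by simp, by simp⟩
  · -- dimension two
    have l1 := map_lt n D hDn (fun x _ => by rw [n4]; rfl) (by omega)
    have hn2 : ∀ x ∈ D, (n ^ 2) x = 0 := by
      have hS : ∀ x ∈ D.map n, n x ∈ D.map n := by
        rintro _ ⟨x, hx, rfl⟩; exact ⟨n x, hDn x hx, rfl⟩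
      have l2 : finrank k ((D.map n).map n) = 0 := by
        by_cases h0 : 0 < finrank k (D.map n)
        · have := map_lt n (D.map n) hS (fun x _ => by rw [n4]; rfl) h0
          omega
        · have h1 : D.map n = ⊥ := Submodule.finrank_eq_zero.1 (by omega)
          rw [h1, Submodule.map_bot, finrank_bot]
      intro x hx
      have h1 : (D.map n).map n = ⊥ := Submodule.finrank_eq_zero.1 l2
      have h2 : n (n x) ∈ (D.map n).map n := ⟨n x, ⟨x, hx, rfl⟩, rfl⟩
      rw [h1] at h2
      rw [pow_two]; exact h2
    have hDX : D ⊓ LinearMap.ker (X + 1) = D := by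
      rw [inf_eq_left]; intro x hx
      rw [← n2, LinearMap.mem_ker]; exact hn2 x hx
    rw [hDX] at decX
    have hDy : D ⊓ LinearMap.ker (y + 1) = D :=
      Submodule.eq_of_le_of_finrank_le inf_le_left (by omega)
    have hy1 : ∀ x ∈ D, C (W x) = x := by
      intro x hx; rw [← hDy] at hx; exact mem_kp.1 hx.2
    have hX1 : ∀ x ∈ D, C (C x) = x := by
      intro x hx; rw [← hDX] at hx; exact mem_kp.1 hx.2
    obtain ⟨v, hv, hnv⟩ : ∃ v ∈ D, n v ≠ 0 := by
      by_contra hcon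
      push Not at hcon
      have : D ⊓ LinearMap.ker n = D := by
        rw [inf_eq_left]; exact fun x hx => hcon x hx
      rw [this] at k1; omega
    have hCD : ∀ x ∈ D, C x ∈ D := by
      intro x hx; rw [hDmem] at *; rw [hCe, hx]
    have hWD : ∀ x ∈ D, W x ∈ D := by
      intro x hx; rw [hDmem] at *; rw [hWe, hx]
    have hli := two_indep C v (by rw [pow_two]; exact hX1 v hv) (by rw [add_comm]; exact hnv)
    refine PB_cyc C W v 2 1 (by norm_num) hW (by rw [pow_two]; exact hX1 v hv) ?_ hli D ?_
    · rw [pow_one]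
      calc W v = C (C (W v)) := (hX1 _ (hWD v hv)).symm
        _ = _ := by rw [hy1 v hv]
    · apply Submodule.eq_of_le_of_finrank_le
      · rw [Submodule.span_le]
        rintro _ ⟨j, rfl⟩
        fin_cases j
        · simpa using hv
        · simpa using hCD v hv
      · rw [finrank_span_eq_card hli, h2]; simp
  · -- dimension four
    have e2 : finrank k (D ⊓ LinearMap.ker (X + 1) : Submodule k V) = 2 := by
      rw [← n2, ← hK]; have := Submodule.finrank_mono (show D ⊓ LinearMap.ker (n ^ 2) ≤ D from inf_le_left); omega
    have e3 : finrank k (D ⊓ LinearMap.ker (n ^ 3) : Submodule k V) = 3 := by rw [← hK]; omega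
    have ey : 3 ≤ finrank k (D ⊓ LinearMap.ker (y + 1) : Submodule k V) := by
      by_contra hcon
      have := dim_four n n4 (by rw [n2]; omega)
      omega
    have hn3 : ∀ x, (n ^ 3) x = x + C x + (C ^ 2) x + (C ^ 3) x := by
      intro x
      rw [pow_succ, Module.End.mul_apply, n2, na]
      simp [Xa, pow_succ]; abel
    obtain ⟨v, hv, hvy, hnv⟩ : ∃ v ∈ D, C (W v) = v ∧ (n ^ 3) v ≠ 0 := by
      by_contra hcon
      push Not at hcon
      have hle : D ⊓ LinearMap.ker (y + 1) ≤ D ⊓ LinearMap.ker (n ^ 3) := by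
        rintro x ⟨hx, hx2⟩
        exact ⟨hx, hcon x hx (mem_kp.1 hx2)⟩
      have heq := Submodule.eq_of_le_of_finrank_le hle (by omega)
      -- n D ≤ ker n^3
      have hfix : ∀ x ∈ D, y (n x) = n x := by
        intro x hx
        have : n x ∈ D ⊓ LinearMap.ker (n ^ 3) := by
          refine ⟨hDn x hx, ?_⟩
          change (n ^ 3) (n x) = 0
          rw [← Module.End.mul_apply, ← pow_succ, n4]; rfl
        rw [← heq] at this
        exact mem_kp.1 this.2
      have hz : ∀ x ∈ D, (n ^ 3) x = 0 := by
        intro x hx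
        have a1 := hfix x hx
        have hCx : C x ∈ D := by rw [hDmem] at *; rw [hCe, hx]
        have a2 := hfix (C x) hCx
        have a3 : n (C x) = C (n x) := by simp [na]
        rw [a3] at a2
        -- y C = C^3 y
        have a4 : y (C (n x)) = (C ^ 3) (y (n x)) := by
          rw [ya, hW, ya]; simp [pow_succ]
        rw [a4, a1] at a2
        have a5 : C (C (n x)) = n x := by
          have := congrArg (fun z => C (C (C z))) a2
          simpa [pow_succ, hC4'] using this
        rw [pow_succ, Module.End.mul_apply, n2, LinearMap.add_apply, Xa, a5]
        exact add_self2 k _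
      have : D ⊓ LinearMap.ker (n ^ 3) = D := by
        rw [inf_eq_left]; exact fun x hx => hz x hx
      rw [this] at e3; omega
    have hCD : ∀ (j : ℕ), (C ^ j) v ∈ D := by
      intro j
      induction j with
      | zero => simpa using hv
      | succ j ih => rw [hDmem] at *; rw [pow_succ', Module.End.mul_apply, hCe, ih]
    rw [hn3] at hnv
    have hli := four_indep C v (hC4 v) hnv
    refine PB_cyc C W v 4 3 (by norm_num) hW (hC4 v) ?_ hli D ?_
    · calc W v = C (C (C (C (W v)))) := (hC4' _).symm
        _ = (C ^ 3) v := by rw [hvy]; simp [pow_succ]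
    · apply Submodule.eq_of_le_of_finrank_le
      · rw [Submodule.span_le]
        rintro _ ⟨j, rfl⟩
        exact hCD j
      · rw [finrank_span_eq_card hli, h4]; simp
end
end Alg

set_option linter.unusedSectionVars false
set_option linter.unusedVariables false
namespace Alg
open Module

theorem common_eig {k V ι : Type} [Field k] [IsAlgClosed k] [AddCommGroup V] [Module k V]
    [FiniteDimensional k V] (f : ι → End k V) (hc : ∀ i j x, f i (f j x) = f j (f i x)) :
    ∀ (N : ℕ) (S : Submodule k V), finrank k S ≤ N → S ≠ ⊥ → (∀ i, ∀ v ∈ S, f i v ∈ S) →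
    ∃ v ∈ S, v ≠ 0 ∧ ∀ i, ∃ c : k, f i v = c • v := by
  intro N
  induction N with
  | zero =>
    intro S hN hS
    exact absurd (Submodule.finrank_eq_zero.1 (Nat.le_zero.1 hN)) hS
  | succ N ih =>
    intro S hN hS hst
    obtain ⟨v, hv, hv0⟩ := Submodule.exists_mem_ne_zero_of_ne_bot hS
    by_cases hall : ∀ i, ∃ c : k, f i v = c • v
    · exact ⟨v, hv, hv0, hall⟩
    · push Not at hall
      obtain ⟨i, hi⟩ := hall
      haveI : Nontrivial S := Submodule.nontrivial_iff_ne_bot.2 hS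
      obtain ⟨μ, hμ⟩ := Module.End.exists_eigenvalue ((f i).restrict (hst i))
      obtain ⟨w, hw⟩ := hμ.exists_hasEigenvector
      have hw1 : f i (w : V) = μ • (w : V) := by
        have := hw.apply_eq_smul
        exact congrArg Subtype.val this
      have hw2 : (w : V) ≠ 0 := fun h => hw.2 (Subtype.ext h)
      obtain ⟨S', hS'⟩ : ∃ S' : Submodule k V, ∀ x, x ∈ S' ↔ x ∈ S ∧ f i x = μ • x :=
        ⟨S ⊓ LinearMap.ker (f i - algebraMap k (End k V) μ), fun x => by
          simp [sub_eq_zero, Module.algebraMap_end_apply]⟩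
      have hlt : S' < S := by
        refine lt_of_le_of_ne (fun x hx => ((hS' x).1 hx).1) ?_
        intro h
        rw [← h] at hv
        exact hi μ ((hS' v).1 hv).2
      have h1 := Submodule.finrank_lt_finrank_of_lt hlt
      obtain ⟨x, hx, hx0, hx1⟩ := ih S' (by omega)
        (fun h => hw2 (by
          have : (w : V) ∈ S' := (hS' _).2 ⟨w.2, hw1⟩
          rw [h] at this; simpa using this))
        (fun j x hx => by
          rw [hS'] at *
          exact ⟨hst j x hx.1, by rw [hc, hx.2, map_smul]⟩)
      exact ⟨x, ((hS' x).1 hx).1, hx0, hx1⟩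

section
variable {k V L : Type} [Field k] [AddCommGroup V] [Module k V] [Monoid L]

def Stab (R : L →* End k V) (S : Submodule k V) : Prop := ∀ A, ∀ v ∈ S, R A v ∈ S
def Simp (R : L →* End k V) : Prop := ∀ S, Stab R S → S = ⊥ ∨ S = ⊤

theorem span_top (R : L →* End k V) (hS : Simp R) (s : V) (hs : s ≠ 0) (S : Submodule k V)
    (h : ∀ g, R g s ∈ S) : S = ⊤ := by
  have h1 : Submodule.span k (Set.range fun g => R g s) = ⊤ := by
    refine (hS _ ?_).resolve_left ?_
    · intro A v hv
      have : Submodule.span k (Set.range fun g => R g s) ≤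
          (Submodule.span k (Set.range fun g => R g s)).comap (R A) := by
        rw [Submodule.span_le]
        rintro _ ⟨g, rfl⟩
        exact Submodule.subset_span ⟨A * g, by simp⟩
      exact this hv
    · intro h0
      have : s ∈ Submodule.span k (Set.range fun g => R g s) :=
        Submodule.subset_span ⟨1, by simp⟩
      rw [h0] at this; exact hs (by simpa using this)
  rw [eq_top_iff, ← h1, Submodule.span_le]
  rintro _ ⟨g, rfl⟩; exact h g

theorem schur [IsAlgClosed k] [FiniteDimensional k V] (R : L →* End k V) (hS : Simp R) [Nontrivial V]
    (T : End k V) (hT : ∀ g x, T (R g x) = R g (T x)) : ∃ μ : k, ∀ x, T x = μ • x := by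
  obtain ⟨μ, hμ⟩ := Module.End.exists_eigenvalue T
  refine ⟨μ, ?_⟩
  have h1 : Module.End.eigenspace T μ = ⊤ := by
    refine (hS _ ?_).resolve_left hμ
    intro A v hv
    rw [Module.End.mem_eigenspace_iff] at *
    rw [hT, hv, map_smul]
  intro x
  rw [← Module.End.mem_eigenspace_iff, h1]; trivial

theorem gk [IsAlgClosed k] [FiniteDimensional k V] [Finite L] (R : L →* End k V) (hS : Simp R)
    (σ : L → L) (hσ : ∀ a b, σ (a * b) = σ b * σ a) (hσs : Function.Surjective σ)
    (l : V →ₗ[k] k) (hl : l ≠ 0) (s1 s2 : V) (h1 : s1 ≠ 0)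
    (hs1 : ∀ g, l (R (σ g) s1) = l (R g s1)) (hs2 : ∀ g, l (R (σ g) s2) = l (R g s2)) :
    ∃ c : k, s2 = c • s1 := by
  classical
  haveI : Fintype L := Fintype.ofFinite L
  haveI : Nontrivial V := ⟨s1, 0, h1⟩
  let Φ : V → (L → k) →ₗ[k] V := fun s => Fintype.linearCombination k (fun g => R g s)
  have hΦ : ∀ s a, Φ s a = ∑ g, a g • R g s := fun s a => Fintype.linearCombination_apply _ _ _
  have hΦ1 : ∀ s g, Φ s (Pi.single g 1) = R g s := by
    intro s g
    simp [hΦ, Pi.single_apply]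
  have hker : ∀ a, Φ s1 a = 0 → Φ s2 a = 0 := by
    intro a ha
    let lam : V →ₗ[k] k := ∑ g, a g • (l ∘ₗ R (σ g))
    have hlam : ∀ v, lam v = ∑ g, a g * l (R (σ g) v) := by
      intro v; simp [lam, LinearMap.sum_apply]
    have ht : LinearMap.ker lam = ⊤ := by
      apply span_top R hS s1 h1
      intro h
      obtain ⟨h', rfl⟩ := hσs h
      rw [LinearMap.mem_ker, hlam]
      have : ∀ g, a g * l (R (σ g) (R (σ h') s1)) = l (R h' (a g • R g s1)) := by
        intro g
        rw [← Module.End.mul_apply, ← map_mul, ← hσ, hs1, map_smul, map_smul, map_mul,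
          Module.End.mul_apply, smul_eq_mul]
      rw [Finset.sum_congr rfl fun g _ => this g, ← map_sum, ← map_sum, ← hΦ, ha, map_zero, map_zero]
    obtain ⟨S, hSm⟩ : ∃ S : Submodule k V, ∀ v, v ∈ S ↔ ∀ b, l (R b v) = 0 :=
      ⟨⨅ b, LinearMap.ker (l ∘ₗ R b), fun v => by simp [Submodule.mem_iInf]⟩
    have hS0 : S = ⊥ := by
      refine (hS S ?_).resolve_right ?_
      · intro A v hv
        rw [hSm] at *
        intro b
        rw [← Module.End.mul_apply, ← map_mul]; exact hv _
      · intro htop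
        apply hl
        ext v
        have : v ∈ S := by rw [htop]; trivial
        simpa using (hSm v).1 this 1
    have : Φ s2 a ∈ S := by
      rw [hSm]
      intro b
      have h3 : lam (R (σ b) s2) = 0 := by
        have : R (σ b) s2 ∈ LinearMap.ker lam := by rw [ht]; trivial
        exact this
      rw [hlam] at h3
      rw [← h3, hΦ, map_sum, map_sum]
      refine Finset.sum_congr rfl fun g _ => ?_
      rw [← Module.End.mul_apply (R (σ g)), ← map_mul, ← hσ, hs2, map_smul, map_smul, map_mul,
          Module.End.mul_apply, smul_eq_mul]
    rw [hS0] at this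
    simpa using this
  have hsurj : LinearMap.range (Φ s1) = ⊤ := by
    apply span_top R hS s1 h1
    intro g
    exact ⟨_, hΦ1 s1 g⟩
  obtain ⟨j, hj⟩ := LinearMap.exists_rightInverse_of_surjective (Φ s1) hsurj
  have hj' : ∀ x, Φ s1 (j x) = x := fun x => LinearMap.congr_fun hj x
  let T : End k V := Φ s2 ∘ₗ j
  have hT : ∀ a, T (Φ s1 a) = Φ s2 a := by
    intro a
    have := hker (j (Φ s1 a) - a) (by rw [map_sub, hj', sub_self])
    rw [map_sub, sub_eq_zero] at this
    exact this
  have hT1 : ∀ g, T (R g s1) = R g s2 := by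
    intro g; rw [← hΦ1, hT, hΦ1]
  have hTR : ∀ h x, T (R h x) = R h (T x) := by
    intro h x
    rw [← hj' x, hT, hΦ, hΦ, map_sum, map_sum, map_sum]
    refine Finset.sum_congr rfl fun g _ => ?_
    rw [map_smul, map_smul, map_smul, ← Module.End.mul_apply (R h), ← map_mul, hT1, map_mul,
      Module.End.mul_apply]
  obtain ⟨μ, hμ⟩ := schur R hS T hTR
  refine ⟨μ, ?_⟩
  rw [← hμ s1]
  have := hT1 1
  simpa using this.symm
end

section
variable {k V F : Type} [Field k] [CharP k 2] [AddCommGroup V] [Module k V]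
  [Field F] [Fintype F]

noncomputable def eT (R : M2 F →* End k V) : End k V := ∑ t ∈ TT F, R t
theorem eT_apply (R : M2 F →* End k V) (x : V) : eT R x = ∑ t ∈ TT F, R t x := by
  simp [eT, LinearMap.sum_apply]

theorem Rmul (R : M2 F →* End k V) (A B : M2 F) (x : V) : R A (R B x) = R (A * B) x := by
  rw [map_mul, Module.End.mul_apply]

theorem eT_left (R : M2 F →* End k V) {t : M2 F} (ht : t ∈ TT F) (x : V) :
    R t (eT R x) = eT R x := by
  rw [eT_apply, map_sum]
  refine Finset.sum_nbij' (fun a => t * a) (fun a => (vv * t * vv) * a)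
    (fun a ha => TT_mul ht ha) (fun a ha => TT_mul (TT_conj ht) ha) ?_ ?_ ?_
  · intro a _; rw [← mul_assoc, TT_inv' ht, one_mul]
  · intro a _; rw [← mul_assoc, TT_inv ht, one_mul]
  · intro a _; rw [Rmul]

theorem eT_kap (R : M2 F →* End k V) (A : M2 F) (hA : ∃ a b, A = kap a b) (x : V) :
    eT R (R A x) = R A (eT R x) := by
  rw [eT_apply, eT_apply, map_sum]
  refine Finset.sum_congr rfl fun t ht => ?_
  rw [Rmul, Rmul, TT_comm ht hA]

theorem eT_vv (R : M2 F →* End k V) (x : V) :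
    eT R (R vv x) = R vv (eT R x) := by
  rw [eT_apply, eT_apply, map_sum]
  have : ∀ a : M2 F, vv * (vv * a * vv) * vv = a := fun a => by
    rw [mul_assoc, mul_assoc, mul_assoc, vv_sq, mul_one, ← mul_assoc, vv_sq, one_mul]
  refine Finset.sum_nbij' (fun a => vv * a * vv) (fun a => vv * a * vv)
    (fun a ha => TT_conj ha) (fun a ha => TT_conj ha) ?_ ?_ ?_
  · intro a _; exact this a
  · intro a _; exact this a
  · intro a _; rw [Rmul, Rmul, ← mul_assoc, ← mul_assoc, vv_sq, one_mul]

theorem TT_ne (hq : Fintype.card F % 8 = 3) {t : M2 F} (ht : t ∈ TT F) (h : t 1 0 = 0) : t = 1 := by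
  obtain ⟨a, b, rfl⟩ := (mem_TT.1 ht).1
  have : b = 0 := by simpa [kap] using h
  subst this
  exact TT_scalar hq ht

theorem vv_conj_10 {t : M2 F} (ht : t ∈ TT F) : (vv * t * vv : M2 F) 1 0 = - (t 1 0) := by
  obtain ⟨a, b, rfl⟩ := (mem_TT.1 ht).1
  rw [vv_kap, mul_assoc, vv_sq, mul_one]; simp [kap]

theorem TT_card (hq : Fintype.card F % 8 = 3) : ((TT F).card : k) = 1 := by
  classical
  have h2 := two_ne hq
  have h1 := Finset.add_sum_erase (TT F) (fun _ => (1 : k)) TT_one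
  have h3 : ∑ x ∈ (TT F).erase 1, (1 : k) = 0 := by
    refine Finset.sum_involution (fun t _ => vv * t * vv) ?_ ?_ ?_ ?_
    · intro t _; exact CharTwo.add_self_eq_zero 1
    · intro t ht _ h
      rw [Finset.mem_erase] at ht
      have := vv_conj_10 ht.2
      rw [h] at this
      apply ht.1
      apply TT_ne hq ht.2
      have h5 : (2 : F) * t 1 0 = 0 := by linear_combination this
      exact (mul_eq_zero.1 h5).resolve_left h2
    · intro t ht
      rw [Finset.mem_erase] at *
      refine ⟨?_, TT_conj ht.2⟩
      intro h
      have := TT_inv ht.2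
      rw [h, mul_one] at this; exact ht.1 this
    · intro t _
      rw [mul_assoc, mul_assoc, mul_assoc, vv_sq, mul_one, ← mul_assoc, vv_sq, one_mul]
  rw [h3, add_zero] at h1
  simpa using h1.symm

theorem eT_fix (hq : Fintype.card F % 8 = 3) (R : M2 F →* End k V) (x : V) (h : ∀ t ∈ TT F, R t x = x) :
    eT R x = x := by
  rw [eT_apply, Finset.sum_congr rfl h, Finset.sum_const, ← Nat.cast_smul_eq_nsmul k, TT_card hq, one_smul]

theorem eT_fixE (hq : Fintype.card F % 8 = 3) (R : M2 F →* End k V) (x : V) :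
    eT R x = x ↔ ∀ t ∈ TT F, R t x = x :=
  ⟨fun h t ht => by rw [← h]; exact eT_left R ht x, eT_fix hq R x⟩
end
end Alg

set_option linter.unusedSectionVars false
set_option linter.unusedVariables false
namespace Alg
open Module

section
variable {k V F : Type} [Field k] [CharP k 2] [IsAlgClosed k] [AddCommGroup V] [Module k V]
  [FiniteDimensional k V] [Field F] [Fintype F]

theorem uu_mul (x y : F) : uu x * uu y = uu (x + y) := by
  simp [uu, Matrix.mul_fin_two, add_comm]
theorem uu_zero : uu (0 : F) = 1 := by
  simp [uu, Matrix.one_fin_two]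

theorem card_one (hq : Fintype.card F % 8 = 3) : ((Fintype.card F : ℕ) : k) = 1 := by
  have h : Fintype.card F = 2 * (Fintype.card F / 2) + 1 := by omega
  rw [h, Nat.cast_add, Nat.cast_mul, Nat.cast_ofNat, CharTwo.two_eq_zero]; simp

theorem charsum [DecidableEq F] (hq : Fintype.card F % 8 = 3) (ψ : F → k) (hadd : ∀ x y, ψ (x + y) = ψ x * ψ y)
    (h0 : ψ 0 = 1) (x0 : F) (hx0 : ψ x0 ≠ 1) (a : F) : ∑ x, ψ (a * x) = if a = 0 then 1 else 0 := by
  split_ifs with h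
  · subst h; simp [h0, card_one hq]
  · have h1 : ∑ x, ψ (a * x) = ∑ x, ψ (a * (x + x0 / a)) :=
      (Fintype.sum_equiv (Equiv.addRight (x0 / a)) _ _ (fun x => rfl)).symm
    have h2 : ∑ x, ψ (a * (x + x0 / a)) = ψ x0 * ∑ x, ψ (a * x) := by
      rw [Finset.mul_sum]
      refine Finset.sum_congr rfl fun x _ => ?_
      rw [mul_add, mul_div_cancel₀ _ h, hadd, mul_comm]
    rw [h2] at h1
    have : (ψ x0 - 1) * ∑ x, ψ (a * x) = 0 := by linear_combination -h1
    exact (mul_eq_zero.1 this).resolve_left (sub_ne_zero.2 hx0)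

theorem whit (hq : Fintype.card F % 8 = 3) (R : M2 F →* End k V) (hR0 : ∀ A, A.det = 0 → R A = 0)
    (hS : Simp R) [Nontrivial V] (hU : ∀ v, (∀ x, R (uu x) v = v) → v = 0) :
    finrank k V = Fintype.card F - 1 := by
  classical
  obtain ⟨s, -, hs0, hsc⟩ := common_eig (fun x : F => R (uu x))
    (fun i j x => by rw [Rmul, Rmul, uu_mul, uu_mul, add_comm]) _ (⊤ : Submodule k V) le_rfl
    (by exact top_ne_bot) (fun _ _ _ => trivial)
  choose ψ hψ using hsc
  have h0 : ψ 0 = 1 := by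
    have := hψ 0
    rw [uu_zero, map_one, Module.End.one_apply] at this
    have h : (1 - ψ 0) • s = 0 := by rw [sub_smul, ← this, one_smul, sub_self]
    linear_combination -((smul_eq_zero.1 h).resolve_right hs0)
  have hadd : ∀ x y, ψ (x + y) = ψ x * ψ y := by
    intro x y
    have h1 := hψ (x + y)
    rw [← uu_mul, ← Rmul, hψ y, map_smul, hψ x, smul_smul] at h1
    have h : (ψ (x + y) - ψ y * ψ x) • s = 0 := by rw [sub_smul, ← h1, sub_self]
    linear_combination ((smul_eq_zero.1 h).resolve_right hs0)
  obtain ⟨x0, hx0⟩ : ∃ x, ψ x ≠ 1 := by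
    by_contra hcon
    push Not at hcon
    exact hs0 (hU s fun x => by rw [hψ x, hcon, one_smul])
  have hcs := charsum hq ψ hadd h0 x0 hx0
  -- projections
  let e : F → End k V := fun a => ∑ x, ψ (-(a * x)) • R (uu x)
  have he : ∀ a v, e a v = ∑ x, ψ (-(a * x)) • R (uu x) v := by
    intro a v; simp [e, LinearMap.sum_apply]
  have hcomm : ∀ a y v, e a (R (uu y) v) = R (uu y) (e a v) := by
    intro a y v
    rw [he, he, map_sum]
    refine Finset.sum_congr rfl fun x _ => ?_
    rw [map_smul, Rmul, Rmul, uu_mul, uu_mul, add_comm]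
  have hleft : ∀ a y v, R (uu y) (e a v) = ψ (a * y) • e a v := by
    intro a y v
    rw [he, map_sum, Finset.smul_sum]
    refine Fintype.sum_equiv (Equiv.addLeft y) _ _ (fun x => ?_)
    simp only [Equiv.coe_addLeft]
    rw [map_smul, Rmul, uu_mul, smul_smul, ← hadd]
    congr 2; ring
  have hproj : ∀ a b v, (∀ y, R (uu y) v = ψ (a * y) • v) → e b v = if a = b then v else 0 := by
    intro a b v hv
    rw [he]
    have : ∀ x, ψ (-(b * x)) • R (uu x) v = ψ ((a - b) * x) • v := by
      intro x; rw [hv, smul_smul, ← hadd]; congr 2; ring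
    rw [Finset.sum_congr rfl fun x _ => this x, ← Finset.sum_smul, hcs]
    simp only [sub_eq_zero]
    split_ifs <;> simp
  have hsum : ∀ v, ∑ a, e a v = v := by
    intro v
    simp only [he]
    rw [Finset.sum_comm]
    have : ∀ x, ∑ a, ψ (-(a * x)) • R (uu x) v = if x = 0 then v else 0 := by
      intro x
      rw [← Finset.sum_smul]
      have h2 : ∑ a, ψ (-(a * x)) = if -x = 0 then 1 else 0 := by
        rw [← hcs]; refine Finset.sum_congr rfl fun a _ => ?_
        congr 1; ring
      rw [h2]
      simp only [neg_eq_zero]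
      split_ifs with h
      · subst h; rw [uu_zero, map_one, Module.End.one_apply, one_smul]
      · rw [zero_smul]
    rw [Finset.sum_congr rfl fun x _ => this x]
    simp
  have he0 : ∀ v, e 0 v = 0 := by
    intro v; apply hU; intro x
    rw [hleft, zero_mul, h0, one_smul]
  -- uniqueness of Whittaker vectors
  have hone : ∀ s', (∀ y, R (uu y) s' = ψ y • s') → ∃ c : k, s' = c • s := by
    intro s' hs'
    obtain ⟨l0, hl0, -⟩ := Submodule.exists_dual_map_eq_bot_of_notMem
      (p := (⊥ : Submodule k V)) (x := s) (by simpa using hs0) inferInstance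
    let l : V →ₗ[k] k := l0 ∘ₗ e 1
    have hlu : ∀ x v, l (R (uu x) v) = ψ x * l v := by
      intro x v
      simp only [l, LinearMap.comp_apply]
      rw [hcomm, hleft, map_smul, one_mul, smul_eq_mul]
    have hls : l s ≠ 0 := by
      simp only [l, LinearMap.comp_apply]
      rw [hproj 1 1 s (fun y => by rw [one_mul]; exact hψ y), if_pos rfl]
      exact hl0
    have key : ∀ s', (∀ y, R (uu y) s' = ψ y • s') → ∀ g : M2 F,
        l (R (!![g 1 1, g 0 1; g 1 0, g 0 0]) s') = l (R g s') := by
      intro s' hs' g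
      have hz : ∀ a b d : F, a ≠ d → a ≠ 0 → d ≠ 0 → l (R !![a, b; 0, d] s') = 0 := by
        intro a b d had ha hd
        by_contra hne
        have h1 : ∀ y, !![a, b; 0, d] * uu y = uu (a * y / d) * !![a, b; 0, d] := by
          intro y
          simp [uu, Matrix.mul_fin_two]
          field_simp
          ring
        have h2 : ∀ y, ψ y = ψ (a * y / d) := by
          intro y
          have h3 : l (R (!![a, b; 0, d] * uu y) s') = l (R (uu (a * y / d) * !![a, b; 0, d]) s') := by
            rw [h1]
          rw [← Rmul, ← Rmul, hs', map_smul, map_smul, hlu, smul_eq_mul] at h3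
          exact mul_right_cancel₀ hne h3
        apply hx0
        have h4 : (1 : F) - a / d ≠ 0 := by
          rw [sub_ne_zero]; intro h; apply had; field_simp at h; exact h.symm
        have h5 := h2 (x0 / (1 - a / d))
        have h6 : x0 / (1 - a / d) = x0 + a * (x0 / (1 - a / d)) / d := by
          field_simp
          ring
        rw [h6, hadd, ← h6] at h5
        have h7 : ψ (a * (x0 / (1 - a / d)) / d) ≠ 0 := by
          intro h
          have := hadd (a * (x0 / (1 - a / d)) / d) (-(a * (x0 / (1 - a / d)) / d))
          rw [add_neg_cancel, h0, h, zero_mul] at this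
          exact one_ne_zero this
        exact mul_right_cancel₀ h7 (by rw [h5, one_mul])
      obtain ⟨a, b, c, d, rfl⟩ : ∃ a b c d, g = !![a, b; c, d] := ⟨_, _, _, _, Matrix.eta_fin_two g⟩
      simp only [Matrix.of_apply, Matrix.cons_val', Matrix.cons_val_zero, Matrix.cons_val_one,
        Matrix.cons_val_fin_one]
      by_cases hc : c = 0
      · subst hc
        by_cases had : a = d
        · rw [had]
        · by_cases ha : a = 0
          · rw [hR0 !![d, b; 0, a] (by simp [Matrix.det_fin_two, ha]),
              hR0 !![a, b; 0, d] (by simp [Matrix.det_fin_two, ha])]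
          · by_cases hd : d = 0
            · rw [hR0 !![d, b; 0, a] (by simp [Matrix.det_fin_two, hd]),
                hR0 !![a, b; 0, d] (by simp [Matrix.det_fin_two, hd])]
            · rw [hz a b d had ha hd, hz d b a (Ne.symm had) hd ha]
      · have dec : ∀ a d : F, !![a, b; c, d] =
            uu (a / c) * (!![0, -((a * d - b * c) / c); c, 0] * uu (d / c)) := by
          intro a d
          simp [uu, Matrix.mul_fin_two]
          field_simp
          simp
        rw [dec a d, dec d a, ← Rmul, ← Rmul, ← Rmul, ← Rmul, hlu, hlu, hs', hs', map_smul, map_smul,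
          map_smul, map_smul, smul_eq_mul, smul_eq_mul, mul_comm d a]
        ring
    refine gk R hS (fun g => !![g 1 1, g 0 1; g 1 0, g 0 0]) ?_ ?_ l ?_ s s' hs0 (key s hψ) (key s' hs')
    · intro a b
      rw [Matrix.mul_fin_two]
      simp only [Matrix.mul_apply, Fin.sum_univ_two]
      congr 1
      ext i j; fin_cases i <;> fin_cases j <;> simp <;> ring
    · intro g
      refine ⟨!![g 1 1, g 0 1; g 1 0, g 0 0], ?_⟩
      ext i j; fin_cases i <;> fin_cases j <;> simp
    · intro h; apply hls; rw [h]; rfl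
  -- basis
  have hdu : ∀ (a : Fˣ) y, uu y * dg (a : F) 1 = dg (a : F) 1 * uu ((a : F)⁻¹ * y) := by
    intro a y
    simp [uu, dg, Matrix.mul_fin_two]
  have hdd : ∀ (a : Fˣ) v, R (dg (a : F) 1) (R (dg (a : F)⁻¹ 1) v) = v := by
    intro a v
    rw [Rmul]
    have : dg (a : F) 1 * dg (a : F)⁻¹ 1 = 1 := by simp [dg, Matrix.mul_fin_two, Matrix.one_fin_two]
    rw [this, map_one]; rfl
  let f : Fˣ → V := fun a => R (dg (a : F) 1) s
  have hf : ∀ a y, R (uu y) (f a) = ψ ((a : F)⁻¹ * y) • f a := by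
    intro a y
    simp only [f]
    rw [Rmul, hdu, ← Rmul, hψ, map_smul]
  have hf0 : ∀ a, f a ≠ 0 := by
    intro a h
    apply hs0
    have := hdd a⁻¹ s
    simp only [Units.val_inv_eq_inv_val, inv_inv] at this
    rw [← this]
    simp only [f] at h
    rw [h, map_zero]
  have hli : LinearIndependent k f := by
    rw [Fintype.linearIndependent_iff]
    intro g hg a
    have h1 := congrArg (e (a : F)⁻¹) hg
    rw [map_sum, map_zero] at h1
    have h2 : ∀ b, e (a : F)⁻¹ (g b • f b) = if b = a then g b • f b else 0 := by
      intro b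
      rw [map_smul, hproj (b : F)⁻¹ (a : F)⁻¹ (f b) (hf b)]
      simp only [inv_inj, Units.val_inj]
      split_ifs <;> simp
    rw [Finset.sum_congr rfl fun b _ => h2 b] at h1
    simp only [Finset.sum_ite_eq', Finset.mem_univ, if_true] at h1
    exact (smul_eq_zero.1 h1).resolve_right (hf0 a)
  have hsp : Submodule.span k (Set.range f) = ⊤ := by
    rw [eq_top_iff]
    intro v _
    rw [← hsum v]
    refine Submodule.sum_mem _ fun a _ => ?_
    by_cases ha : a = 0
    · rw [ha, he0]; exact Submodule.zero_mem _
    · have h1 : ∀ y, R (uu y) (R (dg a 1) (e a v)) = ψ y • R (dg a 1) (e a v) := by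
        intro y
        rw [Rmul]
        have h2 := hdu (Units.mk0 a ha) y
        simp only [Units.val_mk0] at h2
        rw [h2, ← Rmul, hleft, map_smul, mul_inv_cancel_left₀ ha]
      obtain ⟨c, hc⟩ := hone _ h1
      have h3 := hdd (Units.mk0 a ha)⁻¹ (e a v)
      simp only [Units.val_inv_eq_inv_val, Units.val_mk0, inv_inv] at h3
      rw [← h3, hc, map_smul]
      refine Submodule.smul_mem _ _ (Submodule.subset_span ⟨(Units.mk0 a ha)⁻¹, ?_⟩)
      simp [f]
  rw [← finrank_top, ← hsp, finrank_span_eq_card hli, Fintype.card_units]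
end
end Alg

set_option linter.unusedSectionVars false
set_option linter.unusedVariables false
namespace Alg
open Module

section
variable {k V F : Type} [Field k] [CharP k 2] [IsAlgClosed k] [AddCommGroup V] [Module k V]
  [FiniteDimensional k V] [Field F] [Fintype F]

theorem R_neg_one (R : M2 F →* End k V) (hS : Simp R) [Nontrivial V] : ∀ x, R (-1) x = x := by
  have hsq : ∀ x, R (-1) (R (-1) x) = x := by
    intro x; rw [Rmul, neg_mul_neg, one_mul, map_one]; rfl
  have h1 : LinearMap.ker (R (-1) + 1) = ⊤ := by
    refine (hS _ ?_).resolve_left ?_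
    · intro A v hv
      rw [mem_kp] at *
      rw [Rmul, neg_one_mul, ← mul_neg_one, ← Rmul, hv]
    · intro h
      have hz : ∀ x, R (-1) x + x = 0 := by
        intro x
        have : R (-1) x + x ∈ LinearMap.ker (R (-1) + 1) := by
          rw [mem_kp, map_add, hsq, add_comm]
        rw [h] at this; simpa using this
      obtain ⟨x, hx⟩ := exists_ne (0 : V)
      have : x ∈ LinearMap.ker (R (-1) + 1) := hz x
      rw [h] at this; exact hx (by simpa using this)
  intro x
  rw [← mem_kp, h1]; trivial

theorem vv_uu (x : F) : vv * uu x * vv = uu (-x) := by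
  simp [vv, uu, Matrix.mul_fin_two]

theorem vv_tr (g : M2 F) : vv * g.transpose * vv = !![g 0 0, -g 1 0; -g 0 1, g 1 1] := by
  obtain ⟨a, b, c, d, rfl⟩ : ∃ a b c d, g = !![a, b; c, d] := ⟨_, _, _, _, Matrix.eta_fin_two g⟩
  have : Matrix.transpose !![a, b; c, d] = !![a, c; b, d] := by
    ext i j; fin_cases i <;> fin_cases j <;> rfl
  rw [this, vv, Matrix.mul_fin_two, Matrix.mul_fin_two]
  simp

theorem caseA (hq : Fintype.card F % 8 = 3) (r : F) (hr : r * r = -2) (R : M2 F →* End k V)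
    (hR0 : ∀ A, A.det = 0 → R A = 0) (hS : Simp R) [Nontrivial V]
    (hU : ∀ v, (∀ x, R (uu x) v = v) → v = 0) : PB (R (cc r)) (R vv) (fixE (eT R)) := by
  classical
  have h2 := two_ne hq
  have hr0 := r_ne r hr h2
  have hm1 := R_neg_one R hS
  have hC4 : ∀ x, (R (cc r) ^ 4) x = x := by
    intro x; rw [← map_pow, cc_four r hr h2, hm1]
  have hW2 : ∀ x, R vv (R vv x) = x := by
    intro x; rw [Rmul, vv_sq, map_one]; rfl
  have heC : ∀ x, eT R (R (cc r) x) = R (cc r) (eT R x) := fun x => eT_kap R _ ⟨_, _, rfl⟩ x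
  have hee : ∀ x, eT R (eT R x) = eT R x := fun x =>
    eT_fix hq R _ fun t ht => eT_left R ht x
  have heCj : ∀ j x, eT R (R (cc r ^ j) x) = R (cc r ^ j) (eT R x) := fun j x =>
    eT_kap R _ (kap_pow _ _ j) x
  refine caseA_LA (R (cc r)) (R vv) (eT R)
    (∑ x ∈ Finset.univ.filter (fun x : F => x ≠ 0 ∧ IsSquare x), R (uu x))
    (∑ t ∈ (TT F).filter (fun t => t 1 0 ≠ 0 ∧ IsSquare (t 1 0)), R t)
    (R !![1, -1 / r; 0, -1 / r]) hee heC (eT_vv R) hC4 hW2 ?_ ?_ ?_ ?_ ?_ ?_ ?_ ?_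
  · intro x
    rw [Rmul, vv_cc r hr h2, ← Rmul, map_pow]
  · -- multiplicity one
    intro x y hx hy hCx hCy hx0
    set n := R (cc r) + 1 with hn
    have hxT := (eT_fixE hq R x).1 hx
    have hyT := (eT_fixE hq R y).1 hy
    have hDn : ∀ v ∈ fixE (eT R), n v ∈ fixE (eT R) := by
      intro v hv; rw [mem_fixE] at *
      simp only [hn, LinearMap.add_apply, Module.End.one_apply, map_add, heC, hv]
    have hn4 : ∀ v, (n ^ 4) v = 0 := by
      intro v
      have hnn : ∀ v, n (n v) = R (cc r) (R (cc r) v) + v := by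
        intro v
        have := add_self2 k (R (cc r) v)
        simp only [hn, LinearMap.add_apply, Module.End.one_apply, map_add]
        linear_combination (norm := module) this
      have h4 := hC4 v
      simp only [pow_succ, pow_zero, one_mul, Module.End.mul_apply] at h4 ⊢
      rw [hnn, hnn, map_add, map_add, h4]
      have := add_self2 k (v + R (cc r) (R (cc r) v))
      linear_combination (norm := module) this
    have hlt := map_lt n (fixE (eT R)) hDn (fun v _ => hn4 v) (by
      rw [Nat.pos_iff_ne_zero, Ne, Submodule.finrank_eq_zero]
      intro h
      have : x ∈ fixE (eT R) := mem_fixE.2 hx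
      rw [h] at this; exact hx0 (by simpa using this))
    obtain ⟨d, hd, hdn⟩ : ∃ d ∈ fixE (eT R), d ∉ (fixE (eT R)).map n := by
      by_contra hcon
      push Not at hcon
      have := Submodule.finrank_mono (show fixE (eT R) ≤ (fixE (eT R)).map n from hcon)
      omega
    obtain ⟨lam, hlam, hlam0⟩ := Submodule.exists_dual_map_eq_bot_of_notMem hdn inferInstance
    have hlC : ∀ v, lam (R (cc r) (eT R v)) = lam (eT R v) := by
      intro v
      have h1 : lam (n (eT R v)) ∈ Submodule.map lam ((fixE (eT R)).map n) :=
        ⟨_, ⟨_, mem_fixE.2 (hee v), rfl⟩, rfl⟩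
      rw [hlam0] at h1
      have h1' : lam (n (eT R v)) = 0 := (Submodule.mem_bot k).1 h1
      simp only [hn, LinearMap.add_apply, Module.End.one_apply, map_add] at h1'
      exact eq_of_add_zero k h1'
    let l : V →ₗ[k] k := lam ∘ₗ eT R
    have hl : ∀ v, l v = lam (eT R v) := fun _ => rfl
    have hlCj : ∀ j v, l (R (cc r ^ j) v) = l v := by
      intro j
      induction j with
      | zero => intro v; simp
      | succ j ih => intro v; rw [pow_succ, ← Rmul, ih, hl, heC, hlC, hl]
    have hlt' : ∀ t ∈ TT F, ∀ v, l (R t v) = l v := by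
      intro t ht v
      rw [hl, eT_kap R t (mem_TT.1 ht).1, eT_left R ht, hl]
    have key : ∀ s, (∀ t ∈ TT F, R t s = s) → R (cc r) s = s → ∀ g : M2 F,
        l (R (vv * g.transpose * vv) s) = l (R g s) := by
      intro s hsT hsC g
      have hsCj : ∀ j, R (cc r ^ j) s = s := by
        intro j
        induction j with
        | zero => simp
        | succ j ih => rw [pow_succ, ← Rmul, hsC, ih]
      by_cases h0 : (g 0 0 - g 1 1 = 0) ∧ (-(g 0 1 + g 1 0) = 0)
      · have : vv * g.transpose * vv = g := by
          have e1 := h0.1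
          have e2 := h0.2
          rw [vv_tr]
          conv_rhs => rw [Matrix.eta_fin_two g]
          rw [show -g 1 0 = g 0 1 by linear_combination e2, show -g 0 1 = g 1 0 by linear_combination e2]
        rw [this]
      · obtain ⟨t, ht, j, z, hz, hk⟩ := lemT r hq hr _ _ h0
        have h1 : kap (g 0 0 - g 1 1) (-(g 0 1 + g 1 0)) * g =
            (vv * g.transpose * vv) * kap (g 0 0 - g 1 1) (-(g 0 1 + g 1 0)) := by
          rw [vv_tr]
          clear h0 hk
          obtain ⟨a, b, c, d, rfl⟩ : ∃ a b c d, g = !![a, b; c, d] :=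
            ⟨_, _, _, _, Matrix.eta_fin_two g⟩
          simp only [Matrix.of_apply, Matrix.cons_val', Matrix.cons_val_zero, Matrix.cons_val_one,
            Matrix.cons_val_fin_one, kap]
          rw [Matrix.mul_fin_two, Matrix.mul_fin_two]
          congr 1
          ext i j; fin_cases i <;> fin_cases j <;> simp <;> ring
        rw [hk, smul_mul_assoc, mul_smul_comm] at h1
        have h3 : t * cc r ^ j * g = (vv * g.transpose * vv) * (t * cc r ^ j) :=
          smul_right_injective _ hz h1
        have h4 : l (R (t * cc r ^ j * g) s) = l (R g s) := by
          rw [mul_assoc, ← Rmul, hlt' t ht, ← Rmul, hlCj]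
        rw [h3, ← Rmul R (vv * g.transpose * vv), ← Rmul R t, hsCj, hsT t ht] at h4
        exact h4
    refine gk R hS (fun g => vv * g.transpose * vv) ?_ ?_ l ?_ x y hx0 (key x hxT hCx) (key y hyT hCy)
    · intro a b
      rw [Matrix.transpose_mul]
      have : vv * b.transpose * vv * (vv * a.transpose * vv) =
        vv * b.transpose * (vv * vv) * a.transpose * vv := by simp only [mul_assoc]
      rw [this, vv_sq, mul_one]; simp only [mul_assoc]
    · intro g
      refine ⟨vv * g.transpose * vv, ?_⟩
      simp only [vv_tr]
      conv_rhs => rw [Matrix.eta_fin_two g]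
      simp
    · intro h
      apply hlam
      have := LinearMap.congr_fun h d
      rw [hl, mem_fixE.1 hd] at this
      exact this
  · -- phi
    intro x
    have hsum : ∑ z : F, R (uu z) x = 0 := by
      apply hU
      intro y
      rw [map_sum]
      refine Fintype.sum_equiv (Equiv.addLeft y) _ _ fun z => ?_
      rw [Rmul, uu_mul]; rfl
    simp only [LinearMap.sum_apply, map_sum]
    have e1 : ∑ z ∈ Finset.univ.filter (fun x : F => x ≠ 0 ∧ IsSquare x), R vv (R (uu z) (R vv x)) =
        ∑ z ∈ Finset.univ.filter (fun x : F => x ≠ 0 ∧ ¬ IsSquare x), R (uu z) x := by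
      refine Finset.sum_nbij' (fun z => -z) (fun z => -z) ?_ ?_ ?_ ?_ ?_
      · intro z hz
        simp only [Finset.mem_filter, Finset.mem_univ, true_and] at *
        refine ⟨neg_ne_zero.2 hz.1, ?_⟩
        rw [sq_xor hq hz.1, not_not]; exact hz.2
      · intro z hz
        simp only [Finset.mem_filter, Finset.mem_univ, true_and] at *
        exact ⟨neg_ne_zero.2 hz.1, (sq_xor hq hz.1).2 hz.2⟩
      · intro z _; exact neg_neg z
      · intro z _; exact neg_neg z
      · intro z _
        rw [Rmul, Rmul, vv_uu]
    rw [e1]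
    have e2 : ∑ z ∈ Finset.univ.filter (fun x : F => x ≠ 0), R (uu z) x =
        ∑ z ∈ Finset.univ.filter (fun x : F => x ≠ 0 ∧ IsSquare x), R (uu z) x +
        ∑ z ∈ Finset.univ.filter (fun x : F => x ≠ 0 ∧ ¬ IsSquare x), R (uu z) x := by
      rw [← Finset.sum_filter_add_sum_filter_not (Finset.univ.filter (fun x : F => x ≠ 0))
        (fun x => IsSquare x), Finset.filter_filter, Finset.filter_filter]
    rw [← e2]
    have e3 := Finset.sum_filter_add_sum_filter_not (Finset.univ : Finset F) (fun x => x ≠ 0)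
      (fun z => R (uu z) x)
    rw [hsum] at e3
    simp only [not_not] at e3
    rw [Finset.filter_eq' Finset.univ (0 : F)] at e3
    simp only [Finset.mem_univ, if_true, Finset.sum_singleton, uu_zero, map_one,
      Module.End.one_apply] at e3
    exact eq_of_add_zero k e3
  · intro x
    simp only [LinearMap.sum_apply, map_sum]
    refine Finset.sum_congr rfl fun t ht => ?_
    exact eT_kap R t (mem_TT.1 (Finset.mem_filter.1 ht).1).1 x
  · intro x hx
    rw [eT_apply] at hx
    simp only [LinearMap.sum_apply, map_sum]
    have e1 : ∑ t ∈ (TT F).filter (fun t => t 1 0 ≠ 0 ∧ IsSquare (t 1 0)),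
        R (cc r) (R vv (R t (R (cc r) (R vv x)))) =
        ∑ t ∈ (TT F).filter (fun t => t 1 0 ≠ 0 ∧ ¬ IsSquare (t 1 0)), R t x := by
      refine Finset.sum_nbij' (fun t => vv * t * vv) (fun t => vv * t * vv) ?_ ?_ ?_ ?_ ?_
      · intro t ht
        simp only [Finset.mem_filter] at *
        refine ⟨TT_conj ht.1, ?_⟩
        rw [vv_conj_10 ht.1]
        refine ⟨neg_ne_zero.2 ht.2.1, ?_⟩
        rw [sq_xor hq ht.2.1, not_not]; exact ht.2.2
      · intro t ht
        simp only [Finset.mem_filter] at *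
        refine ⟨TT_conj ht.1, ?_⟩
        rw [vv_conj_10 ht.1]
        exact ⟨neg_ne_zero.2 ht.2.1, (sq_xor hq ht.2.1).2 ht.2.2⟩
      · intro t _
        rw [mul_assoc, mul_assoc, mul_assoc, vv_sq, mul_one, ← mul_assoc, vv_sq, one_mul]
      · intro t _
        rw [mul_assoc, mul_assoc, mul_assoc, vv_sq, mul_one, ← mul_assoc, vv_sq, one_mul]
      · intro t ht
        have ht' := (Finset.mem_filter.1 ht).1
        have h3 : cc r * vv * t * cc r * vv = (vv * t * vv) * cc r ^ 4 := by
          have hcom : cc r * (vv * t * vv) = (vv * t * vv) * cc r :=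
            (TT_comm (TT_conj ht') ⟨_, _, rfl⟩).symm
          have h5 : vv * (cc r * vv) = cc r ^ 3 := by
            rw [← mul_assoc, vv_cc r hr h2, mul_assoc, vv_sq, mul_one]
          calc cc r * vv * t * cc r * vv = cc r * (vv * t * ((vv * vv) * (cc r * vv))) := by
                rw [vv_sq, one_mul]; simp only [mul_assoc]
            _ = cc r * (vv * t * vv) * (vv * (cc r * vv)) := by simp only [mul_assoc]
            _ = _ := by rw [hcom, h5, mul_assoc, ← pow_succ']
        rw [Rmul, Rmul, Rmul, Rmul, h3, ← Rmul, map_pow, hC4]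
    rw [e1]
    have e2 : ∑ t ∈ (TT F).filter (fun t => t 1 0 ≠ 0), R t x =
        ∑ t ∈ (TT F).filter (fun t => t 1 0 ≠ 0 ∧ IsSquare (t 1 0)), R t x +
        ∑ t ∈ (TT F).filter (fun t => t 1 0 ≠ 0 ∧ ¬ IsSquare (t 1 0)), R t x := by
      rw [← Finset.sum_filter_add_sum_filter_not ((TT F).filter (fun t => t 1 0 ≠ 0))
        (fun t => IsSquare (t 1 0)), Finset.filter_filter, Finset.filter_filter]
    rw [← e2]
    have e3 := Finset.sum_filter_add_sum_filter_not (TT F) (fun t => t 1 0 ≠ 0)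
      (fun t => R t x)
    rw [hx] at e3
    have e4 : (TT F).filter (fun t => ¬ (t 1 0 ≠ 0)) = {1} := by
      ext t
      simp only [Finset.mem_filter, not_not, Finset.mem_singleton]
      constructor
      · rintro ⟨h, h'⟩; exact TT_ne hq h h'
      · rintro rfl; exact ⟨TT_one, by simp⟩
    rw [e4] at e3
    simp only [Finset.sum_singleton, map_one, Module.End.one_apply] at e3
    exact eq_of_add_zero k e3
  · -- bijective
    have ha : (!![1, -1 / r; 0, -1 / r] : M2 F) * !![1, -1; 0, -r] = 1 := by
      rw [Matrix.mul_fin_two, Matrix.one_fin_two]; congr 1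
      ext i j; fin_cases i <;> fin_cases j <;> simp [hr0]
    have hb : (!![1, -1; 0, -r] : M2 F) * !![1, -1 / r; 0, -1 / r] = 1 := by
      rw [Matrix.mul_fin_two, Matrix.one_fin_two]; congr 1
      ext i j; fin_cases i <;> fin_cases j <;> simp <;> field_simp
    refine Function.bijective_iff_has_inverse.2 ⟨R !![1, -1; 0, -r], ?_, ?_⟩
    · intro x; rw [Rmul, hb, map_one]; rfl
    · intro x; rw [Rmul, ha, map_one]; rfl
  · intro x
    rw [Rmul, Rmul, Rmul, Rmul, mul_assoc, cc_sq r hr h2]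
    congr 2
    simp [cc, kap, vv, w0, Matrix.mul_fin_two]
    have : r * r + 2 = 0 := by rw [hr]; ring
    field_simp
    exact ⟨⟨trivial, by linear_combination this⟩, trivial⟩
  · rw [whit hq R hR0 hS hU]; omega
end
end Alg

set_option linter.unusedSectionVars false
set_option linter.unusedVariables false
namespace Alg
open Module

section
variable {k V F : Type} [Field k] [CharP k 2] [IsAlgClosed k] [AddCommGroup V] [Module k V]
  [FiniteDimensional k V] [Field F] [Fintype F]

def Eig (R : M2 F →* End k V) (n : V) : Prop :=
  (∀ x, R (uu x) n = n) ∧ ∀ a b, a ≠ 0 → b ≠ 0 → ∃ s : k, R (dg a b) n = s • n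

def An (R : M2 F →* End k V) (n : V) : Submodule k V := Submodule.span k (Set.range fun g => R g n)
def ff (R : M2 F →* End k V) (n : V) (x : F) : V := R (uu x * w0) n
def Sf (R : M2 F →* End k V) (n : V) : Submodule k V := Submodule.span k (Set.range (ff R n))
noncomputable def eU (R : M2 F →* End k V) : End k V := ∑ x : F, R (uu x)
theorem eU_apply (R : M2 F →* End k V) (v : V) : eU R v = ∑ x : F, R (uu x) v := by
  simp [eU, LinearMap.sum_apply]

theorem dg_det (a b : F) : (dg a b).det = a * b := by simp [dg, Matrix.det_fin_two]
theorem w0_det : (w0 : M2 F).det = 1 := by simp [w0, Matrix.det_fin_two]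
theorem dg_mul (a b c d : F) : dg a b * dg c d = dg (a * c) (b * d) := by simp [dg, Matrix.mul_fin_two]
theorem dg_one : dg (1 : F) 1 = 1 := by simp [dg, Matrix.one_fin_two]
theorem vv_dg : (vv : M2 F) = dg 1 (-1) := rfl
theorem neg_dg : (-1 : M2 F) = dg (-1) (-1) := by
  ext i j; fin_cases i <;> fin_cases j <;> simp [dg]

theorem bruhat (g : M2 F) (hc : g 1 0 ≠ 0) : g = uu (g 0 0 / g 1 0) * w0 *
    (dg (-(g 1 0)) (-(g.det / g 1 0)) * uu (g 1 1 / g 1 0)) := by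
  obtain ⟨a, b, c, d, rfl⟩ : ∃ a b c d, g = !![a, b; c, d] := ⟨_, _, _, _, Matrix.eta_fin_two g⟩
  simp only [Matrix.of_apply, Matrix.cons_val', Matrix.cons_val_zero, Matrix.cons_val_one,
        Matrix.cons_val_fin_one, Matrix.det_fin_two] at hc ⊢
  simp only [uu, w0, dg, Matrix.mul_fin_two]
  congr 1
  ext i j; fin_cases i <;> fin_cases j <;> simp <;> field_simp
  ring

theorem upper (g : M2 F) (hc : g 1 0 = 0) (ha : g 0 0 ≠ 0) :
    g = dg (g 0 0) (g 1 1) * uu (g 0 1 / g 0 0) := by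
  obtain ⟨a, b, c, d, rfl⟩ : ∃ a b c d, g = !![a, b; c, d] := ⟨_, _, _, _, Matrix.eta_fin_two g⟩
  simp only [Matrix.of_apply, Matrix.cons_val', Matrix.cons_val_zero, Matrix.cons_val_one,
        Matrix.cons_val_fin_one, Matrix.det_fin_two] at hc ha ⊢
  subst hc
  simp only [uu, dg, Matrix.mul_fin_two]
  congr 1
  ext i j; fin_cases i <;> fin_cases j <;> simp <;> field_simp

variable {R : M2 F →* End k V} {n : V}

theorem An_stab : Stab R (An R n) := by
  intro A v hv
  have : An R n ≤ (An R n).comap (R A) := by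
    rw [An, Submodule.span_le]
    rintro _ ⟨g, rfl⟩
    exact Submodule.subset_span ⟨A * g, by simp⟩
  exact this hv

theorem An_self : n ∈ An R n := Submodule.subset_span ⟨1, by simp⟩

theorem An_le (X : Submodule k V) (hX : Stab R X) (h : n ∈ X) : An R n ≤ X := by
  rw [An, Submodule.span_le]; rintro _ ⟨g, rfl⟩; exact hX g n h

theorem Eig.vv (h : Eig R n) {a b : F} (hab : a * a = 1) (hb : b * b = 1) : R (dg a b) n = n := by
  have ha0 : a ≠ 0 := by rintro rfl; simp at hab
  have hb0 : b ≠ 0 := by rintro rfl; simp at hb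
  by_cases hn : n = 0
  · rw [hn, map_zero]
  obtain ⟨s, hs⟩ := h.2 a b ha0 hb0
  have h2 : R (dg a b) (R (dg a b) n) = n := by
    rw [Rmul, dg_mul, hab, hb, dg_one, map_one]; rfl
  rw [hs, map_smul, hs, smul_smul] at h2
  have h3 : (s * s - 1) • n = 0 := by rw [sub_smul, h2, one_smul, sub_self]
  have h4 := (smul_eq_zero.1 h3).resolve_right hn
  have h5 : (s - 1) * (s - 1) = 0 := by
    have : (2 : k) = 0 := CharTwo.two_eq_zero
    linear_combination h4 - (s - 1) * this
  rw [hs, sub_eq_zero.1 (mul_self_eq_zero.1 h5), one_smul]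

theorem Eig.neg (h : Eig R n) : R (-1) n = n := by
  rw [neg_dg]; exact h.vv (by ring) (by ring)

theorem Eig.W (h : Eig R n) : R Alg.vv n = n := h.vv (by ring) (by ring)

theorem Eig.big (h : Eig R n) (g : M2 F) (hd : g.det ≠ 0) (hc : g 1 0 ≠ 0) :
    ∃ s : k, R g n = s • ff R n (g 0 0 / g 1 0) := by
  obtain ⟨s, hs⟩ := h.2 (-(g 1 0)) (-(g.det / g 1 0)) (neg_ne_zero.2 hc)
    (neg_ne_zero.2 (div_ne_zero hd hc))
  refine ⟨s, ?_⟩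
  conv_lhs => rw [bruhat g hc]
  rw [← Rmul, ← Rmul _ (dg _ _), h.1, hs, map_smul]; rfl

theorem Eig.small (h : Eig R n) (g : M2 F) (hd : g.det ≠ 0) (hc : g 1 0 = 0) :
    ∃ s : k, R g n = s • n := by
  rw [Matrix.det_fin_two, hc, mul_zero, sub_zero] at hd
  have ha := left_ne_zero_of_mul hd
  have hb := right_ne_zero_of_mul hd
  obtain ⟨s, hs⟩ := h.2 _ _ ha hb
  refine ⟨s, ?_⟩
  conv_lhs => rw [upper g hc ha]
  rw [← Rmul, h.1, hs]

/-- the trivial torus case -/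
def TrT (R : M2 F →* End k V) (n : V) : Prop := ∀ a : F, a ≠ 0 → R (dg a a⁻¹) n = n

theorem big1 (h : Eig R n) (ht : TrT R n) (g : M2 F) (hd : g.det = 1) (hc : g 1 0 ≠ 0) :
    R g n = ff R n (g 0 0 / g 1 0) := by
  conv_lhs => rw [bruhat g hc]
  rw [hd, one_div, ← inv_neg, ← Rmul, ← Rmul _ (dg _ _), h.1, ht _ (neg_ne_zero.2 hc)]; rfl

theorem small1 (h : Eig R n) (ht : TrT R n) (g : M2 F) (hd : g.det = 1) (hc : g 1 0 = 0) :
    R g n = n := by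
  have hd' := hd
  rw [Matrix.det_fin_two, hc, mul_zero, sub_zero] at hd
  have ha : g 0 0 ≠ 0 := by intro h; rw [h, zero_mul] at hd; exact zero_ne_one hd
  have hb : g 1 1 = (g 0 0)⁻¹ := eq_inv_of_mul_eq_one_right hd
  conv_lhs => rw [upper g hc ha]
  rw [hb, ← Rmul, h.1, ht _ ha]

theorem fix_of_w0 (h : Eig R n) (ht : TrT R n) (hw : R w0 n = n) (g : M2 F) (hd : g.det = 1) :
    R g n = n := by
  by_cases hc : g 1 0 = 0
  · exact small1 h ht g hd hc
  · rw [big1 h ht g hd hc, ff, ← Rmul, hw, h.1]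

theorem eU_fix (hq : Fintype.card F % 8 = 3) (v : V) (h : ∀ x, R (uu x) v = v) : eU R v = v := by
  rw [eU_apply, Finset.sum_congr rfl fun x _ => h x, Finset.sum_const, Finset.card_univ,
    ← Nat.cast_smul_eq_nsmul k, card_one hq, one_smul]

theorem eU_uu (x : F) (v : V) : eU R (R (uu x) v) = eU R v := by
  rw [eU_apply, eU_apply]
  refine Fintype.sum_equiv (Equiv.addRight x) _ _ fun y => ?_
  rw [Rmul, uu_mul]; rfl

noncomputable def ns (R : M2 F →* End k V) (n : V) : V := ∑ x : F, ff R n x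

theorem eU_ff (x : F) : eU R (ff R n x) = ns R n := by
  rw [ff, ← Rmul, eU_uu, eU_apply, ns]
  exact Finset.sum_congr rfl fun y _ => by rw [ff, Rmul]

theorem uu_ff (x y : F) : R (uu y) (ff R n x) = ff R n (y + x) := by
  rw [ff, ff, Rmul, ← mul_assoc, uu_mul]

theorem ff_zero : ff R n 0 = R w0 n := by rw [ff, uu_zero, one_mul]

theorem dg_ff (a b x : F) (ha : a ≠ 0) (hb : b ≠ 0) :
    R (dg a b) (ff R n x) = R (uu (a * x / b) * w0) (R (dg b a) n) := by
  rw [ff, Rmul, Rmul]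
  congr 2
  simp only [uu, w0, dg, Matrix.mul_fin_two]
  congr 1
  ext i j; fin_cases i <;> fin_cases j <;> simp <;> field_simp

theorem ns_mem : ns R n ∈ Sf R n :=
  Submodule.sum_mem _ fun x _ => Submodule.subset_span ⟨x, rfl⟩

theorem ns_fix (y : F) : R (uu y) (ns R n) = ns R n := by
  rw [ns, map_sum]
  refine Fintype.sum_equiv (Equiv.addLeft y) _ _ fun x => ?_
  rw [uu_ff]; rfl

theorem dg_ns (a b : F) (ha : a ≠ 0) (hb : b ≠ 0) (s : k) (hs : R (dg b a) n = s • n) :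
    R (dg a b) (ns R n) = s • ns R n := by
  rw [ns, map_sum, Finset.smul_sum]
  refine Fintype.sum_equiv (Equiv.mulLeft₀ (a / b) (div_ne_zero ha hb)) _ _ fun x => ?_
  rw [dg_ff a b x ha hb, hs, map_smul, ff]
  change _ = s • R (uu (a / b * x) * w0) n
  rw [div_mul_eq_mul_div]

theorem w0_ff (h : Eig R n) (x : F) (hx : x ≠ 0) : ∃ s : k, R w0 (ff R n x) = s • ff R n (-1 / x) := by
  have e : w0 * (uu x * w0) = !![-1, 0; x, -1] := by
    simp [w0, uu, Matrix.mul_fin_two]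
  rw [ff, Rmul, e]
  exact h.big _ (by simp [Matrix.det_fin_two]) (by simpa using hx)

theorem w0_ff1 (h : Eig R n) (ht : TrT R n) (x : F) (hx : x ≠ 0) :
    R w0 (ff R n x) = ff R n (-1 / x) := by
  have e : w0 * (uu x * w0) = !![-1, 0; x, -1] := by
    simp [w0, uu, Matrix.mul_fin_two]
  rw [ff, Rmul, e]
  exact big1 h ht _ (by simp [Matrix.det_fin_two]) (by simpa using hx)

theorem w0_ff0 (h : Eig R n) : R w0 (ff R n 0) = n := by
  rw [ff_zero, Rmul, w0_sq, neg_one_kap, h.neg]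

theorem w0_ns (h : Eig R n) (ht : TrT R n) : R w0 (ns R n) = n + ns R n + R w0 n := by
  classical
  rw [ns, map_sum, ← Finset.add_sum_erase _ _ (Finset.mem_univ (0 : F)), w0_ff0 h,
    ← Finset.add_sum_erase _ (fun x => ff R n x) (Finset.mem_univ (0 : F)), ff_zero]
  have : ∑ x ∈ Finset.univ.erase (0 : F), R w0 (ff R n x) = ∑ x ∈ Finset.univ.erase (0 : F), ff R n x := by
    refine Finset.sum_nbij' (fun x => -1 / x) (fun x => -1 / x) ?_ ?_ ?_ ?_ ?_
    · intro x hx; simp at *; exact hx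
    · intro x hx; simp at *; exact hx
    · intro x hx; simp at hx; field_simp
    · intro x hx; simp at hx; field_simp
    · intro x hx; simp at hx; exact w0_ff1 h ht x hx
  rw [this]
  have := add_self2 k (R w0 n)
  linear_combination (norm := module) -this

/-- elements of `An` -/
theorem An_eq (hR0 : ∀ A, A.det = 0 → R A = 0) (h : Eig R n) :
    An R n ≤ Submodule.span k {n} ⊔ Sf R n := by
  rw [An, Submodule.span_le]
  rintro _ ⟨g, rfl⟩
  by_cases hd : g.det = 0
  · simp only [hR0 g hd]; exact Submodule.zero_mem _
  · by_cases hc : g 1 0 = 0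
    · obtain ⟨s, hs⟩ := h.small g hd hc
      simp only [hs]
      exact Submodule.mem_sup_left (Submodule.smul_mem _ _ (Submodule.mem_span_singleton_self n))
    · obtain ⟨s, hs⟩ := h.big g hd hc
      simp only [hs]
      exact Submodule.mem_sup_right (Submodule.smul_mem _ _ (Submodule.subset_span ⟨_, rfl⟩))

theorem eU_Sf (v : V) (hv : v ∈ Sf R n) : ∃ a : k, eU R v = a • ns R n := by
  have : Sf R n ≤ (Submodule.span k {ns R n}).comap (eU R) := by
    rw [Sf, Submodule.span_le]
    rintro _ ⟨x, rfl⟩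
    rw [Submodule.comap_coe, Set.mem_preimage, eU_ff]
    exact Submodule.mem_span_singleton_self _
  obtain ⟨a, ha⟩ := Submodule.mem_span_singleton.1 (this hv)
  exact ⟨a, ha.symm⟩

/-- every stable submodule has fixed vectors -/
def HypB (R : M2 F →* End k V) : Prop :=
  ∀ X, Stab R X → X ≠ ⊥ → ∃ v ∈ X, v ≠ 0 ∧ ∀ x, R (uu x) v = v

theorem stab_of (hR0 : ∀ A, A.det = 0 → R A = 0) (X : Submodule k V) (h1 : ∀ x, ∀ v ∈ X, R (uu x) v ∈ X)
    (h2 : ∀ a b, a ≠ 0 → b ≠ 0 → ∀ v ∈ X, R (dg a b) v ∈ X) (h3 : ∀ v ∈ X, R w0 v ∈ X) : Stab R X := by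
  intro g v hv
  by_cases hd : g.det = 0
  · rw [hR0 g hd]; exact Submodule.zero_mem _
  · by_cases hc : g 1 0 = 0
    · rw [Matrix.det_fin_two, hc, mul_zero, sub_zero] at hd
      have ha := left_ne_zero_of_mul hd
      have hb := right_ne_zero_of_mul hd
      rw [upper g hc ha, ← Rmul]
      exact h2 _ _ ha hb _ (h1 _ _ hv)
    · rw [bruhat g hc, ← Rmul, ← Rmul, ← Rmul _ (dg _ _)]
      exact h1 _ _ (h3 _ (h2 _ _ (neg_ne_zero.2 hc) (neg_ne_zero.2 (div_ne_zero hd hc)) _ (h1 _ _ hv)))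

theorem lemA (hq : Fintype.card F % 8 = 3) (hR0 : ∀ A, A.det = 0 → R A = 0) (hB : HypB R)
    (h : Eig R n) (h0 : n ≠ 0) (hS : n ∈ Sf R n) : TrT R n ∧ R w0 n = n := by
  obtain ⟨a, ha⟩ := eU_Sf n hS
  rw [eU_fix hq n h.1] at ha
  have t2 : (2 : k) = 0 := CharTwo.two_eq_zero
  have ht : TrT R n := by
    intro b hb
    obtain ⟨s, hs⟩ := h.2 b b⁻¹ hb (inv_ne_zero hb)
    have h1 := dg_ns b⁻¹ b (inv_ne_zero hb) hb s hs
    have h2 : R (dg b⁻¹ b) n = s • n := by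
      conv_lhs => rw [ha, map_smul, h1, smul_comm, ← ha]
    have h3 : R (dg b⁻¹ b) (R (dg b b⁻¹) n) = n := by
      rw [Rmul, dg_mul, inv_mul_cancel₀ hb, mul_inv_cancel₀ hb, dg_one, map_one]; rfl
    rw [hs, map_smul, h2, smul_smul] at h3
    have h3' : (s * s - 1) • n = 0 := by rw [sub_smul, h3, one_smul, sub_self]
    have h4 := (smul_eq_zero.1 h3').resolve_right h0
    have h5 : (s - 1) * (s - 1) = 0 := by linear_combination h4 - (s - 1) * t2
    rw [hs, sub_eq_zero.1 (mul_self_eq_zero.1 h5), one_smul]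
  refine ⟨ht, ?_⟩
  have hw := w0_ns h ht
  have h1 : R w0 n = a • (n + ns R n + R w0 n) := by
    conv_lhs => rw [ha, map_smul, hw]
  by_cases ha1 : a = 1
  · subst ha1
    rw [one_smul] at ha
    -- the submodule spanned by differences
    set X : Submodule k V := Submodule.span k (Set.range fun p : F × F => ff R n p.1 - ff R n p.2) with hX
    have hmem : ∀ x y, ff R n x - ff R n y ∈ X := fun x y => Submodule.subset_span ⟨(x, y), rfl⟩
    have hgen : ∀ (T : End k V), (∀ x y, T (ff R n x - ff R n y) ∈ X) → ∀ v ∈ X, T v ∈ X := by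
      intro T hT v hv
      have : X ≤ X.comap T := by
        rw [hX, Submodule.span_le]
        rintro _ ⟨p, rfl⟩
        exact hT p.1 p.2
      exact this hv
    have hn : ∀ z, n - ff R n z ∈ X := by
      intro z
      have e : n - ff R n z = ∑ x, (ff R n x - ff R n z) := by
        rw [Finset.sum_sub_distrib, Finset.sum_const, Finset.card_univ, ← Nat.cast_smul_eq_nsmul k,
          card_one hq, one_smul]
        nth_rewrite 1 [ha]; rfl
      rw [e]
      exact Submodule.sum_mem _ fun x _ => hmem x z
    have hXs : Stab R X := by
      apply stab_of hR0
      · intro x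
        apply hgen
        intro y z; rw [map_sub, uu_ff, uu_ff]; exact hmem _ _
      · intro b c hb hc
        apply hgen
        intro y z
        obtain ⟨s, hs⟩ := h.2 c b hc hb
        rw [map_sub, dg_ff _ _ _ hb hc, dg_ff _ _ _ hb hc, hs, map_smul, map_smul, ← smul_sub]
        exact Submodule.smul_mem _ _ (hmem _ _)
      · apply hgen
        have key : ∀ y, ∃ z, R w0 (ff R n y) - ff R n z ∈ X := by
          intro y
          by_cases hy : y = 0
          · subst hy; rw [w0_ff0 h]; exact ⟨0, hn 0⟩
          · rw [w0_ff1 h ht y hy]; exact ⟨_, hmem (-1 / y) 0⟩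
        intro y z
        obtain ⟨y', hy'⟩ := key y
        obtain ⟨z', hz'⟩ := key z
        have e : R w0 (ff R n y - ff R n z) = (R w0 (ff R n y) - ff R n y') - (R w0 (ff R n z) - ff R n z')
            + (ff R n y' - ff R n z') := by rw [map_sub]; abel
        rw [e]
        exact X.add_mem (X.sub_mem hy' hz') (hmem _ _)
    have hX0 : X = ⊥ := by
      by_contra hne
      obtain ⟨v, hv, hv0, hvf⟩ := hB X hXs hne
      apply hv0
      rw [← eU_fix hq v hvf]
      have : X ≤ LinearMap.ker (eU R) := by
        rw [hX, Submodule.span_le]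
        rintro _ ⟨p, rfl⟩
        change eU R _ = 0
        rw [map_sub, eU_ff, eU_ff, sub_self]
      exact this hv
    have := hn 0
    rw [hX0, Submodule.mem_bot, sub_eq_zero, ff_zero] at this
    exact this.symm
  · have h6 : a • (n + ns R n + R w0 n) = a • n + n + a • R w0 n := by
      rw [smul_add, smul_add, ← ha]
    rw [h6] at h1
    have h7 : (1 + a) • (R w0 n - n) = 0 := by
      have e1 := congrArg (fun z : k => z • n) t2
      have e2 := congrArg (fun z : k => (z * a) • n) t2
      simp only [zero_mul, zero_smul] at e1 e2
      have e3 := congrArg (fun z : k => (z * a) • R w0 n) t2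
      simp only [zero_mul, zero_smul] at e3
      linear_combination (norm := module) h1 + e3
    have h8 : (1 + a) ≠ 0 := by
      intro h9; apply ha1; linear_combination h9 - t2
    exact sub_eq_zero.1 ((smul_eq_zero.1 h7).resolve_left h8)
end
end Alg

set_option linter.unusedSectionVars false
set_option linter.unusedVariables false
namespace Alg
open Module

section
variable {k V F : Type} [Field k] [CharP k 2] [IsAlgClosed k] [AddCommGroup V] [Module k V]
  [FiniteDimensional k V] [Field F] [Fintype F]
variable {R : M2 F →* End k V} {n : V} (r : F)

theorem cc_powkap (j : ℕ) : ∃ a b, cc r ^ j = kap a b := kap_pow _ _ _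

theorem Rpow (j : ℕ) (x : V) : ((R (cc r)) ^ j) x = R (cc r ^ j) x := by rw [map_pow]

theorem kap_fac (hq : Fintype.card F % 8 = 3) (g : M2 F) (hd : g.det ≠ 0) :
    ∃ h : M2 F, h.det ≠ 0 ∧ h 1 0 = 0 ∧ g = kap (g 0 0) (g 1 0) * h ∧ ¬ (g 0 0 = 0 ∧ g 1 0 = 0) := by
  obtain ⟨a, b, c, d, rfl⟩ : ∃ a b c d, g = !![a, b; c, d] := ⟨_, _, _, _, Matrix.eta_fin_two g⟩
  simp only [Matrix.of_apply, Matrix.cons_val', Matrix.cons_val_zero, Matrix.cons_val_one,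
        Matrix.cons_val_fin_one, Matrix.det_fin_two] at hd ⊢
  have hac : ¬ (a = 0 ∧ c = 0) := by rintro ⟨rfl, rfl⟩; simp at hd
  have hN : a * a + c * c ≠ 0 := fun h => hac (sumsq hq h)
  have hN1 : a ^ 2 + c ^ 2 ≠ 0 := by rw [pow_two, pow_two]; exact hN
  have hN2 : c ^ 2 + a ^ 2 ≠ 0 := by rw [add_comm]; exact hN1
  refine ⟨!![1, (a*b+c*d)/(a*a+c*c); 0, (a*d-b*c)/(a*a+c*c)], ?_, ?_, ?_, hac⟩
  · simp only [Matrix.of_apply, Matrix.cons_val', Matrix.cons_val_zero, Matrix.cons_val_one,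
        Matrix.cons_val_fin_one, one_mul, mul_zero, sub_zero]
    exact div_ne_zero hd hN
  · simp
  · simp only [kap, Matrix.mul_fin_two]
    congr 1
    ext i j; fin_cases i <;> fin_cases j <;> simp <;> field_simp <;> ring

theorem tc_span (hq : Fintype.card F % 8 = 3) (hr : r * r = -2) (hR0 : ∀ A, A.det = 0 → R A = 0)
    (h : Eig R n) (g : M2 F) : ∃ s : k, ∃ t ∈ TT F, ∃ j : ℕ, R g n = s • R (t * cc r ^ j) n := by
  by_cases hd : g.det = 0
  · exact ⟨0, 1, TT_one, 0, by rw [hR0 g hd]; simp⟩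
  obtain ⟨u, hu, hu0, hgu, hac⟩ := kap_fac hq g hd
  obtain ⟨s, hs⟩ := h.small u hu hu0
  obtain ⟨t, ht, j, z, hz, hk⟩ := lemT r hq hr _ _ hac
  obtain ⟨s', hs'⟩ := h.2 z z hz hz
  refine ⟨s * s', t, ht, j, ?_⟩
  have e : z • (t * cc r ^ j) = (t * cc r ^ j) * dg z z := by
    have : dg z z = z • (1 : M2 F) := by ext i j; fin_cases i <;> fin_cases j <;> simp [dg]
    rw [this, mul_smul_comm, mul_one]
  rw [hgu, hk, e, ← Rmul, hs, map_smul, ← Rmul, hs', map_smul, smul_smul]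

theorem C4 (hq : Fintype.card F % 8 = 3) (hr : r * r = -2) (h : Eig R n) :
    ((R (cc r)) ^ 4) (eT R n) = eT R n := by
  rw [Rpow, cc_four r hr (two_ne hq), ← neg_one_kap, ← eT_kap R _ ⟨_, _, rfl⟩, neg_one_kap, h.neg]

theorem Cmod (C : End k V) (d : V) (h : (C ^ 4) d = d) (j : ℕ) :
    (C ^ j) d ∈ Set.range (fun i : Fin 4 => (C ^ (i : ℕ)) d) := by
  refine ⟨⟨j % 4, Nat.mod_lt _ (by norm_num)⟩, ?_⟩
  have hm : ∀ m, ((C ^ 4) ^ m) d = d := by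
    intro m
    induction m with
    | zero => simp
    | succ m ih => rw [pow_succ, Module.End.mul_apply, h, ih]
  have e : C ^ j = C ^ (j % 4) * (C ^ 4) ^ (j / 4) := by
    rw [← pow_mul, ← pow_add, Nat.mod_add_div]
  rw [e, Module.End.mul_apply, hm]

theorem eT_tc (t : M2 F) (ht : t ∈ TT F) (j : ℕ) :
    eT R (R (t * cc r ^ j) n) = ((R (cc r)) ^ j) (eT R n) := by
  rw [TT_comm ht (cc_powkap r j), ← Rmul, eT_kap R _ (cc_powkap r j), eT_kap R _ (mem_TT.1 ht).1,
    eT_left R ht, Rpow]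

theorem eT_idem (hq : Fintype.card F % 8 = 3) (x : V) : eT R (eT R x) = eT R x :=
  eT_fix hq R _ fun t ht => eT_left R ht x

theorem eT_mem (X : Submodule k V) (hX : Stab R X) (x : V) (hx : x ∈ X) : eT R x ∈ X := by
  rw [eT_apply]; exact X.sum_mem fun t _ => hX t x hx

theorem fixAn (hq : Fintype.card F % 8 = 3) (hr : r * r = -2) (hR0 : ∀ A, A.det = 0 → R A = 0)
    (h : Eig R n) : Submodule.span k (Set.range (fun j : Fin 4 => ((R (cc r)) ^ (j : ℕ)) (eT R n)))
      = fixE (eT R) ⊓ An R n := by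
  apply le_antisymm
  · rw [Submodule.span_le]
    rintro _ ⟨j, rfl⟩
    simp only [Rpow]
    refine ⟨mem_fixE.2 ?_, An_stab _ _ (eT_mem _ An_stab _ An_self)⟩
    rw [eT_kap R _ (cc_powkap r j), eT_idem hq]
  · rintro x ⟨hx, hxA⟩
    rw [← mem_fixE.1 hx]
    have : An R n ≤ (Submodule.span k (Set.range (fun j : Fin 4 => ((R (cc r)) ^ (j : ℕ)) (eT R n)))).comap
        (eT R) := by
      rw [An, Submodule.span_le]
      rintro _ ⟨g, rfl⟩
      obtain ⟨s, t, ht, j, e⟩ := tc_span r hq hr hR0 h g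
      simp only [e]
      apply Submodule.smul_mem
      change eT R (R _ n) ∈ Submodule.span k _
      rw [eT_tc r t ht]
      exact Submodule.subset_span (Cmod _ _ (C4 r hq hr h) j)
    exact this hxA

theorem sum_ne (hq : Fintype.card F % 8 = 3) (hr : r * r = -2) (h : Eig R n) (hn : n ∉ Sf R n) :
    eT R n + R (cc r) (eT R n) + ((R (cc r)) ^ 2) (eT R n) + ((R (cc r)) ^ 3) (eT R n) ≠ 0 := by
  classical
  intro h0
  apply hn
  have e : ∑ p ∈ Finset.range 4 ×ˢ TT F, R (p.2 * cc r ^ p.1) n = 0 := by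
    rw [Finset.sum_product, ← h0]
    have : ∀ j, ∑ t ∈ TT F, R (t * cc r ^ j) n = ((R (cc r)) ^ j) (eT R n) := by
      intro j
      rw [Rpow, ← eT_kap R _ (cc_powkap r j), eT_apply]
      exact Finset.sum_congr rfl fun t _ => by rw [Rmul]
    simp only [this]
    simp [Finset.sum_range_succ]
  rw [← Finset.add_sum_erase _ _ (show ((0, 1) : ℕ × M2 F) ∈ _ from
    Finset.mem_product.2 ⟨by simp, TT_one⟩)] at e
  have e2 := eq_neg_of_add_eq_zero_left e
  simp only [pow_zero, mul_one, map_one, Module.End.one_apply] at e2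
  suffices hm : -∑ x ∈ (Finset.range 4 ×ˢ TT F).erase (0, 1), (R (x.2 * cc r ^ x.1)) n ∈ Sf R n by
    rwa [← e2] at hm
  apply Submodule.neg_mem
  apply Submodule.sum_mem
  rintro ⟨j, t⟩ hp
  rw [Finset.mem_erase, Finset.mem_product, Finset.mem_range] at hp
  obtain ⟨hne, hj, ht⟩ := hp
  have h10 : (t * cc r ^ j) 1 0 ≠ 0 := by
    intro h1
    obtain ⟨rfl, rfl⟩ := tc_scalar r hq hr ht hj h1
    exact hne rfl
  have hdet : (t * cc r ^ j).det ≠ 0 := by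
    rw [Matrix.det_mul, (mem_TT.1 ht).2.1, one_mul, Matrix.det_pow]
    apply pow_ne_zero
    intro hz
    have := congrArg Matrix.det (cc_four r hr (two_ne hq))
    rw [Matrix.det_pow, hz] at this
    simp [Matrix.det_neg] at this
  obtain ⟨s, hs⟩ := h.big _ hdet h10
  simp only [hs]
  exact Submodule.smul_mem _ _ (Submodule.subset_span ⟨_, rfl⟩)

def PBT (R : M2 F →* End k V) (X : Submodule k V) : Prop :=
  PB (R (cc r)) (R vv) (fixE (eT R) ⊓ X)

theorem WC (hq : Fintype.card F % 8 = 3) (hr : r * r = -2) (x : V) :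
    R vv (R (cc r) x) = ((R (cc r)) ^ 3) (R vv x) := by
  rw [Rpow, Rmul, Rmul, vv_cc r hr (two_ne hq)]

theorem PBT_bot : PBT r R ⊥ := by
  refine ⟨∅, linearIndepOn_empty k _, by simp, by simp⟩

theorem An_fixed (hR0 : ∀ A, A.det = 0 → R A = 0) (h : Eig R n) (hf : ∀ A, A.det = 1 → R A n = n) :
    An R n = Submodule.span k {n} := by
  apply le_antisymm
  · rw [An, Submodule.span_le]
    rintro _ ⟨g, rfl⟩
    by_cases hd : g.det = 0
    · simp only [hR0 g hd]; exact Submodule.zero_mem _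
    · obtain ⟨s, hs⟩ := h.2 1 g.det one_ne_zero hd
      have e : g = (g * dg 1 (g.det)⁻¹) * dg 1 g.det := by
        rw [mul_assoc, dg_mul, inv_mul_cancel₀ hd, one_mul, dg_one, mul_one]
      simp only []
      rw [e, ← Rmul, hs, map_smul, hf]
      · exact Submodule.smul_mem _ _ (Submodule.mem_span_singleton_self n)
      · rw [Matrix.det_mul, dg_det, one_mul, mul_inv_cancel₀ hd]
  · rw [Submodule.span_singleton_le_iff_mem]; exact An_self

theorem cc_det (hq : Fintype.card F % 8 = 3) (hr : r * r = -2) : (cc r).det = -1 := by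
  have h2 := two_ne hq
  have h0 := r_ne r hr h2
  rw [cc, kap_det]
  field_simp
  linear_combination hr

theorem PBT_fixed (hq : Fintype.card F % 8 = 3) (hr : r * r = -2) (hR0 : ∀ A, A.det = 0 → R A = 0)
    (h : Eig R n) (h0 : n ≠ 0) (hf : ∀ A, A.det = 1 → R A n = n) : PBT r R (An R n) := by
  refine ⟨{n}, ?_, ?_, ?_⟩
  · exact LinearIndepOn.singleton h0
  · rw [An_fixed hR0 h hf, eq_comm, inf_eq_right, Submodule.span_singleton_le_iff_mem, mem_fixE]
    exact eT_fix hq R n fun t ht => hf t (mem_TT.1 ht).2.1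
  · rintro b rfl
    refine ⟨?_, h.W⟩
    have e : cc r = cc r * vv * vv := by rw [mul_assoc, vv_sq, mul_one]
    rw [e, ← Rmul, h.W, hf]
    · rfl
    · rw [Matrix.det_mul, cc_det r hq hr, vv_dg, dg_det]; ring

theorem PBT_An (hq : Fintype.card F % 8 = 3) (hr : r * r = -2) (hR0 : ∀ A, A.det = 0 → R A = 0)
    (hB : HypB R) (h : Eig R n) : PBT r R (An R n) := by
  by_cases h0 : n = 0
  · have : An R n = ⊥ := by
      rw [eq_bot_iff, An, Submodule.span_le]
      rintro _ ⟨g, rfl⟩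
      simp [h0]
    rw [this]; exact PBT_bot r
  by_cases hS : n ∈ Sf R n
  · obtain ⟨ht, hw⟩ := lemA hq hR0 hB h h0 hS
    exact PBT_fixed r hq hr hR0 h h0 (fix_of_w0 h ht hw)
  · refine PB_cyc _ _ (eT R n) 4 0 (by norm_num) (WC r hq hr) (C4 r hq hr h) ?_ ?_ _
      (fixAn r hq hr hR0 h)
    · rw [← eT_vv, h.W]; rfl
    · exact four_indep _ _ (C4 r hq hr h) (sum_ne r hq hr h hS)

theorem PBT_sup (X Y : Submodule k V) (hX : Stab R X) (hY : Stab R Y) (hXY : Disjoint X Y)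
    (h1 : PBT r R X) (h2 : PBT r R Y) : PBT r R (X ⊔ Y) := by
  obtain ⟨B1, hl1, hs1, hb1⟩ := h1
  obtain ⟨B2, hl2, hs2, hb2⟩ := h2
  refine ⟨B1 ∪ B2, ?_, ?_, ?_⟩
  · apply LinearIndepOn.id_union hl1 hl2
    rw [hs1, hs2]
    exact hXY.mono inf_le_right inf_le_right
  · rw [Submodule.span_union, hs1, hs2]
    apply le_antisymm
    · exact sup_le (inf_le_inf_left _ le_sup_left) (inf_le_inf_left _ le_sup_right)
    · rintro z ⟨hz, hzs⟩
      obtain ⟨x, hx, y, hy, rfl⟩ := Submodule.mem_sup.1 hzs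
      have hz' := mem_fixE.1 hz
      rw [map_add] at hz'
      have h3 : eT R x - x = y - eT R y := by rw [sub_eq_sub_iff_add_eq_add, hz', add_comm]
      have h4 : eT R x - x = 0 := by
        apply Submodule.disjoint_def.1 hXY
        · exact X.sub_mem (eT_mem X hX x hx) hx
        · rw [h3]; exact Y.sub_mem hy (eT_mem Y hY y hy)
      rw [h4] at h3
      exact Submodule.add_mem_sup ⟨mem_fixE.2 (sub_eq_zero.1 h4), hx⟩
        ⟨mem_fixE.2 (sub_eq_zero.1 h3.symm).symm, hy⟩
  · rintro b (hb | hb)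
    · exact ⟨Or.inl (hb1 b hb).1, Or.inl (hb1 b hb).2⟩
    · exact ⟨Or.inr (hb2 b hb).1, Or.inr (hb2 b hb).2⟩

theorem PB_of_top (X : Submodule k V) (h : PBT r R X) (hX : ⊤ ≤ X) :
    PB (R (cc r)) (R vv) (fixE (eT R)) := by
  rw [PBT, top_le_iff.1 hX, inf_top_eq] at h; exact h

theorem Eig.ns (h : Eig R n) : Eig R (ns R n) := by
  refine ⟨ns_fix, fun a b ha hb => ?_⟩
  obtain ⟨s, hs⟩ := h.2 b a hb ha
  exact ⟨s, dg_ns a b ha hb s hs⟩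

theorem exists_fix (hq : Fintype.card F % 8 = 3) (hR0 : ∀ A, A.det = 0 → R A = 0) (hB : HypB R)
    (h : Eig R n) (h0 : n ≠ 0) (ht : TrT R n) :
    ∃ m : V, m ≠ 0 ∧ Eig R m ∧ ∀ A, A.det = 1 → R A m = m := by
  by_cases hz : n + ns R n = 0
  · have e : n = ns R n := eq_of_add_zero k hz
    have hS : n ∈ Sf R n := by
      have := ns_mem (R := R) (n := n)
      rwa [← e] at this
    obtain ⟨_, hw⟩ := lemA hq hR0 hB h h0 hS
    exact ⟨n, h0, h, fix_of_w0 h ht hw⟩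
  · have htn : TrT R (n + ns R n) := by
      intro a ha
      have h1 := ht a⁻¹ (inv_ne_zero ha)
      rw [inv_inv] at h1
      have := dg_ns a a⁻¹ ha (inv_ne_zero ha) (1 : k) (n := n) (R := R) (by rw [one_smul]; exact h1)
      rw [one_smul] at this
      rw [map_add, this, ht a ha]
    have hE : Eig R (n + ns R n) := by
      refine ⟨fun x => by rw [map_add, h.1, ns_fix], fun a b ha hb => ?_⟩
      obtain ⟨s, hs⟩ := h.2 b a hb ha
      have e1 : R (dg a b) n = s • n := by
        have e2 : dg a b = dg b a * dg (a / b) (a / b)⁻¹ := by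
          rw [dg_mul]; congr 1 <;> field_simp
        rw [e2, ← Rmul, ht _ (div_ne_zero ha hb), hs]
      exact ⟨s, by rw [map_add, dg_ns a b ha hb s hs, e1, smul_add]⟩
    refine ⟨_, hz, hE, fix_of_w0 hE htn ?_⟩
    rw [map_add, w0_ns h ht]
    have := add_self2 k (R w0 n)
    linear_combination (norm := module) this

theorem caseB1 (hq : Fintype.card F % 8 = 3) (hr : r * r = -2) (hR0 : ∀ A, A.det = 0 → R A = 0)
    (hB : HypB R) (m : V) (hm : Eig R m) (hm0 : m ≠ 0) (hf : ∀ A, A.det = 1 → R A m = m) (h : Eig R n)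
    (htop : ⊤ ≤ An R m ⊔ An R n) : PB (R (cc r)) (R vv) (fixE (eT R)) := by
  by_cases hmn : m ∈ An R n
  · refine PB_of_top r (An R n) (PBT_An r hq hr hR0 hB h) (htop.trans ?_)
    exact sup_le (An_le _ An_stab hmn) le_rfl
  · refine PB_of_top r _ (PBT_sup r _ _ An_stab An_stab ?_ (PBT_An r hq hr hR0 hB hm)
      (PBT_An r hq hr hR0 hB h)) htop
    rw [An_fixed hR0 hm hf, disjoint_comm]
    exact (Submodule.disjoint_span_singleton' hm0).2 hmn

theorem dichot (hq : Fintype.card F % 8 = 3) (hR0 : ∀ A, A.det = 0 → R A = 0)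
    (hB : HypB R) (hT : ∀ m : V, m ≠ 0 → Eig R m → ¬ TrT R m) (h : Eig R n) (X : Submodule k V)
    (hX : Stab R X) : An R n ≤ X ∨ Disjoint X (An R n) := by
  by_cases hd : X ⊓ An R n = ⊥
  · exact Or.inr (disjoint_iff.2 hd)
  left
  obtain ⟨v, ⟨hvX, hvA⟩, hv0, hvf⟩ := hB (X ⊓ An R n)
    (fun A v hv => ⟨hX A v hv.1, An_stab A v hv.2⟩) hd
  have t2 : (2 : k) = 0 := CharTwo.two_eq_zero
  have hn0 : n ≠ 0 := by
    rintro rfl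
    apply hv0
    have := An_le (R := R) (n := (0:V)) ⊥ (by intro A v hv; rw [Submodule.mem_bot] at *; rw [hv, map_zero]) (by simp)
    exact (Submodule.mem_bot k).1 (this hvA)
  have heU : ∀ x ∈ X, eU R x ∈ X := by
    intro x hx; rw [eU_apply]; exact X.sum_mem fun t _ => hX _ x hx
  obtain ⟨y, hy, s, hs, hys⟩ := Submodule.mem_sup.1 (An_eq hR0 h hvA)
  obtain ⟨α, rfl⟩ := Submodule.mem_span_singleton.1 hy
  obtain ⟨β, hβ⟩ := eU_Sf s hs
  have hv : v = α • n + β • ns R n := by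
    rw [← eU_fix hq v hvf, ← hys, map_add, map_smul, eU_fix hq n h.1, hβ]
  have h1 := hT n hn0 h
  rw [TrT] at h1
  push Not at h1
  obtain ⟨a, ha, hne⟩ := h1
  obtain ⟨c, hc⟩ := h.2 a a⁻¹ ha (inv_ne_zero ha)
  obtain ⟨c', hc'⟩ := h.2 a⁻¹ a (inv_ne_zero ha) ha
  have hcc : c * c' = 1 := by
    have h3 : R (dg a⁻¹ a) (R (dg a a⁻¹) n) = n := by
      rw [Rmul, dg_mul, inv_mul_cancel₀ ha, mul_inv_cancel₀ ha, dg_one, map_one]; rfl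
    rw [hc, map_smul, hc', smul_smul] at h3
    have h3' : (c * c' - 1) • n = 0 := by rw [sub_smul, h3, one_smul, sub_self]
    exact sub_eq_zero.1 ((smul_eq_zero.1 h3').resolve_right hn0)
  have hc1 : c - c' ≠ 0 := by
    intro h4
    have h5 : (c - 1) * (c - 1) = 0 := by linear_combination hcc + c * h4 - (c - 1) * t2
    apply hne
    rw [hc, sub_eq_zero.1 (mul_self_eq_zero.1 h5), one_smul]
  have h6 : (α * (c - c')) • n ∈ X := by
    have h7 := X.sub_mem (hX (dg a a⁻¹) v hvX) (X.smul_mem c' hvX)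
    have e : R (dg a a⁻¹) v - c' • v = (α * (c - c')) • n := by
      rw [hv, map_add, map_smul, map_smul, hc, dg_ns a a⁻¹ ha (inv_ne_zero ha) c' hc']
      module
    rwa [e] at h7
  apply An_le X hX
  by_cases hα : α = 0
  · rw [hα, zero_smul, zero_add] at hv
    have hβ0 : β ≠ 0 := by rintro rfl; apply hv0; rw [hv, zero_smul]
    have hnsX : ns R n ∈ X := by
      rw [hv] at hvX
      exact (Submodule.smul_mem_iff X hβ0).1 hvX
    classical
    have hw : ∃ s : k, eU R (R w0 (ns R n)) = n + s • ns R n := by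
      rw [ns, map_sum, ← Finset.add_sum_erase _ _ (Finset.mem_univ (0 : F)), w0_ff0 h, map_add,
        eU_fix hq n h.1, map_sum]
      have : ∀ x : F, x ≠ 0 → ∃ s : k, eU R (R w0 (ff R n x)) = s • ns R n := by
        intro x hx
        obtain ⟨s, hs⟩ := w0_ff h x hx
        exact ⟨s, by rw [hs, map_smul, eU_ff]⟩
      choose! f hf using this
      refine ⟨∑ x ∈ Finset.univ.erase (0 : F), f x, ?_⟩
      rw [Finset.sum_smul]
      congr 1
      exact Finset.sum_congr rfl fun x hx => hf x (Finset.ne_of_mem_erase hx)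
    obtain ⟨s, hs⟩ := hw
    have h8 := heU _ (hX w0 _ hnsX)
    rw [hs] at h8
    have h9 := X.sub_mem h8 (X.smul_mem s hnsX)
    rwa [add_sub_cancel_right] at h9
  · exact (Submodule.smul_mem_iff X (mul_ne_zero hα hc1)).1 h6

theorem Stab_sup (X Y : Submodule k V) (hX : Stab R X) (hY : Stab R Y) : Stab R (X ⊔ Y) := by
  intro A v hv
  obtain ⟨x, hx, y, hy, rfl⟩ := Submodule.mem_sup.1 hv
  rw [map_add]
  exact Submodule.add_mem_sup (hX A x hx) (hY A y hy)

theorem step (hq : Fintype.card F % 8 = 3) (hr : r * r = -2) (hR0 : ∀ A, A.det = 0 → R A = 0)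
    (hB : HypB R) (hT : ∀ m : V, m ≠ 0 → Eig R m → ¬ TrT R m) (h : Eig R n) (X : Submodule k V)
    (hX : Stab R X) (hP : PBT r R X) : PBT r R (X ⊔ An R n) := by
  rcases dichot hq hR0 hB hT h X hX with h1 | h1
  · rwa [sup_eq_left.2 h1]
  · exact PBT_sup r X _ hX An_stab h1 hP (PBT_An r hq hr hR0 hB h)

theorem caseB2 (hq : Fintype.card F % 8 = 3) (hr : r * r = -2) (hR0 : ∀ A, A.det = 0 → R A = 0)
    (hB : HypB R) (hT : ∀ m : V, m ≠ 0 → Eig R m → ¬ TrT R m) (n1 n2 n3 : V) (h1 : Eig R n1)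
    (h2 : Eig R n2) (h3 : Eig R n3)
    (htop : ⊤ ≤ An R n1 ⊔ An R n2 ⊔ An R n3) : PB (R (cc r)) (R vv) (fixE (eT R)) := by
  have hs := Stab_sup _ _ (An_stab (R := R) (n := n1)) (An_stab (R := R) (n := n2))
  exact PB_of_top r _ (step r hq hr hR0 hB hT h3 _ hs
    (step r hq hr hR0 hB hT h2 _ An_stab (PBT_An r hq hr hR0 hB h1))) htop
end
end Alg

set_option linter.unusedSectionVars false
set_option linter.unusedVariables false
set_option linter.unusedSimpArgs false
namespace Alg
open Module

section
variable {F : Type} [Field F] [Fintype F]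

abbrev S3 (F : Type) [Field F] := Matrix.SpecialLinearGroup (Fin 3) F

abbrev M3 (F : Type) := Matrix (Fin 3) (Fin 3) F
def val {F : Type} [Field F] (g : S3 F) : M3 F := g.1
def mkS {F : Type} [Field F] (M : M3 F) (h : M.det = 1) : S3 F := ⟨M, h⟩
theorem val_mk (M : M3 F) (h : M.det = 1) : val (mkS M h) = M := rfl
theorem val_mul (g h : S3 F) : val (g * h) = val g * val h := rfl
theorem val_one : val (1 : S3 F) = 1 := rfl
theorem val_det (g : S3 F) : (val g).det = 1 := g.2
theorem val_inj {g h : S3 F} (e : val g = val h) : g = h := Subtype.ext e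

/-- translation -/
def q1 (x y : F) : S3 F := mkS !![1, 0, x; 0, 1, y; 0, 0, 1] (by simp [Matrix.det_fin_three])
theorem val_q1 (x y : F) : val (q1 x y) = !![1, 0, x; 0, 1, y; 0, 0, 1] := rfl

def elm (A : M2 F) : Matrix (Fin 3) (Fin 3) F := !![A 0 0, A 0 1, 0; A 1 0, A 1 1, 0; 0, 0, (A.det)⁻¹]

theorem elm_det (A : M2 F) (h : A.det ≠ 0) : (elm A).det = 1 := by
  have e : (elm A).det = A.det * (A.det)⁻¹ := by
    rw [Matrix.det_fin_three, Matrix.det_fin_two]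
    simp [elm, Matrix.det_fin_two]
    ring
  rw [e, mul_inv_cancel₀ h]

open Classical in
noncomputable def ell (A : M2 F) : S3 F := if h : A.det ≠ 0 then mkS (elm A) (elm_det A h) else 1

theorem ell_val (A : M2 F) (h : A.det ≠ 0) : val (ell A) = elm A := by
  rw [ell, dif_pos h, val_mk]

theorem ell_mul (A B : M2 F) (hA : A.det ≠ 0) (hB : B.det ≠ 0) : ell (A * B) = ell A * ell B := by
  apply val_inj
  rw [val_mul, ell_val A hA, ell_val B hB,
    ell_val _ (by rw [Matrix.det_mul]; exact mul_ne_zero hA hB)]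
  ext i j
  fin_cases i <;> fin_cases j <;> simp [elm, Matrix.mul_apply, Fin.sum_univ_three, mul_comm]

theorem ell_one : ell (1 : M2 F) = 1 := by
  apply val_inj
  rw [ell_val _ (by simp), val_one]
  ext i j
  fin_cases i <;> fin_cases j <;> simp [elm]

theorem q1_mul (x y x' y' : F) : q1 x y * q1 x' y' = q1 (x + x') (y + y') := by
  apply val_inj
  simp only [val_mul, val_q1]
  ext i j
  fin_cases i <;> fin_cases j <;> simp [Matrix.mul_apply, Fin.sum_univ_three, add_comm]

theorem q1_zero : q1 (0 : F) 0 = 1 := by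
  apply val_inj
  rw [val_q1, val_one]
  ext i j
  fin_cases i <;> fin_cases j <;> simp

theorem q1_inv (x y : F) : (q1 x y)⁻¹ = q1 (-x) (-y) := by
  rw [inv_eq_iff_mul_eq_one, q1_mul, add_neg_cancel, add_neg_cancel, q1_zero]

theorem ell_q1 (A : M2 F) (hA : A.det ≠ 0) (x y : F) :
    ell A * q1 x y = q1 (A.det * (A 0 0 * x + A 0 1 * y)) (A.det * (A 1 0 * x + A 1 1 * y)) * ell A := by
  apply val_inj
  rw [val_mul, val_mul, ell_val A hA]
  ext i j
  fin_cases i <;> fin_cases j <;> simp [elm, val_q1, Matrix.mul_apply, Fin.sum_univ_three] <;> field_simp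

theorem q1_ell_inj (A B : M2 F) (hA : A.det ≠ 0) (hB : B.det ≠ 0) (x y x' y' : F)
    (h : q1 x y * ell A = q1 x' y' * ell B) : A = B ∧ x = x' ∧ y = y' := by
  have h' := congrArg val h
  rw [val_mul, val_mul, ell_val A hA, ell_val B hB, val_q1, val_q1] at h'
  have hh := fun i j => congrFun (congrFun h' i) j
  have e00 := hh 0 0
  have e01 := hh 0 1
  have e10 := hh 1 0
  have e11 := hh 1 1
  have e02 := hh 0 2
  have e12 := hh 1 2
  simp [elm, val_q1, Matrix.mul_apply, Fin.sum_univ_three] at e00 e01 e10 e11 e02 e12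
  have hAB : A = B := by
    ext i j; fin_cases i <;> fin_cases j <;> simpa
  subst hAB
  simp [hA] at e02 e12
  exact ⟨rfl, e02, e12⟩

theorem ell_inj (A B : M2 F) (hA : A.det ≠ 0) (hB : B.det ≠ 0) (h : ell A = ell B) : A = B :=
  (q1_ell_inj A B hA hB 0 0 0 0 (by rw [h])).1

/-- translation subgroup -/
def Q1 (F : Type) [Field F] [Fintype F] : Subgroup (S3 F) where
  carrier := {g | ∃ x y, g = q1 x y}
  mul_mem' := by rintro _ _ ⟨x, y, rfl⟩ ⟨x', y', rfl⟩; exact ⟨_, _, q1_mul _ _ _ _⟩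
  one_mem' := ⟨0, 0, q1_zero.symm⟩
  inv_mem' := by rintro _ ⟨x, y, rfl⟩; exact ⟨_, _, q1_inv _ _⟩

theorem q1_mem (x y : F) : q1 x y ∈ Q1 F := ⟨x, y, rfl⟩

theorem Q1_norm (A : M2 F) (hA : A.det ≠ 0) : ∀ w, w ∈ Q1 F → ell A * w * (ell A)⁻¹ ∈ Q1 F := by
  rintro _ ⟨x, y, rfl⟩
  rw [ell_q1 A hA, mul_inv_cancel_right]
  exact q1_mem _ _

noncomputable def Q1equiv : F × F ≃ Q1 F :=
  Equiv.ofBijective (fun p => ⟨q1 p.1 p.2, q1_mem _ _⟩) (by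
    constructor
    · rintro ⟨x, y⟩ ⟨x', y'⟩ h
      have h1 := congrArg Subtype.val h
      simp only at h1
      obtain ⟨_, h2, h3⟩ := q1_ell_inj (1 : M2 F) 1 (by simp) (by simp) x y x' y' (by rw [h1])
      rw [h2, h3]
    · rintro ⟨_, x, y, rfl⟩
      exact ⟨(x, y), rfl⟩)

theorem Q1_odd (hq : Fintype.card F % 8 = 3) : Odd (Nat.card (Q1 F)) := by
  rw [← Nat.card_congr (Q1equiv (F := F)), Nat.card_eq_fintype_card, Fintype.card_prod]
  have : Odd (Fintype.card F) := Nat.odd_iff.2 (by omega)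
  exact this.mul this

def s2 : S3 F := mkS !![1, 0, 0; 0, 0, 1; 0, -1, 0] (by simp [Matrix.det_fin_three])
theorem val_s2 : val (s2 : S3 F) = !![1, 0, 0; 0, 0, 1; 0, -1, 0] := rfl

/-- parabolic elements -/
theorem para (p : S3 F) (h0 : val p 2 0 = 0) (h1 : val p 2 1 = 0) :
    ∃ A : M2 F, A.det ≠ 0 ∧ ∃ x y, p = q1 x y * ell A ∧ A 1 0 = val p 1 0 := by
  have hd := val_det p
  rw [Matrix.det_fin_three, h0, h1] at hd
  set A : M2 F := !![val p 0 0, val p 0 1; val p 1 0, val p 1 1] with hA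
  have hdA : A.det * val p 2 2 = 1 := by
    rw [← hd, hA, Matrix.det_fin_two]; simp; ring
  have hA0 : A.det ≠ 0 := left_ne_zero_of_mul (a := A.det) (b := val p 2 2) (by rw [hdA]; exact one_ne_zero)
  refine ⟨A, hA0, A.det * val p 0 2, A.det * val p 1 2, ?_, by simp [hA]⟩
  apply val_inj
  rw [val_mul, ell_val A hA0]
  have e22 : val p 2 2 = (A.det)⁻¹ := eq_inv_of_mul_eq_one_right hdA
  have ea : A 0 0 = val p 0 0 := by simp [hA]
  have eb : A 0 1 = val p 0 1 := by simp [hA]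
  have ec : A 1 0 = val p 1 0 := by simp [hA]
  have ed : A 1 1 = val p 1 1 := by simp [hA]
  clear_value A
  ext i j
  fin_cases i <;> fin_cases j <;>
    simp [elm, val_q1, Matrix.mul_apply, Fin.sum_univ_three, h0, h1, ea, eb, ec, ed, e22] <;> field_simp

theorem rowlem (g b w : S3 F) (h1 : val g 2 = Matrix.vecMul (val w 2) (val b)) :
    val (g * b⁻¹ * w⁻¹) 2 = Pi.single 2 1 := by
  have hr : ∀ (a : S3 F) (j : Fin 3), val a j = Matrix.vecMul (Pi.single j 1) (val a) := by
    intro a j; rw [Matrix.single_one_vecMul]; rfl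
  rw [hr, val_mul, val_mul, ← Matrix.vecMul_vecMul, ← Matrix.vecMul_vecMul, ← hr g, h1,
    Matrix.vecMul_vecMul _ (val b), ← val_mul, mul_inv_cancel, val_one, Matrix.vecMul_one, hr w,
    Matrix.vecMul_vecMul, ← val_mul, mul_inv_cancel, val_one, Matrix.vecMul_one]

theorem s2w0 : val (s2 * ell w0 : S3 F) = !![0, 1, 0; 0, 0, 1; 1, 0, 0] := by
  rw [val_mul, ell_val _ (by rw [w0_det]; exact one_ne_zero)]
  ext i j
  fin_cases i <;> fin_cases j <;> simp [elm, val_s2, w0, Matrix.mul_apply, Fin.sum_univ_three, Matrix.det_fin_two]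

theorem decomp (g : S3 F) : ∃ A : M2 F, A.det ≠ 0 ∧ ∃ x y, ∃ w : S3 F, (w = 1 ∨ w = s2 ∨ w = s2 * ell w0) ∧
    ∃ B : M2 F, B.det ≠ 0 ∧ (B 1 0 = 0 ∨ w = 1) ∧ ∃ x' y', g = q1 x y * ell A * w * (q1 x' y' * ell B) := by
  have key : ∀ (w b : S3 F), (w = 1 ∨ w = s2 ∨ w = s2 * ell w0) → val g 2 = Matrix.vecMul (val w 2) (val b) →
      val b 2 0 = 0 → val b 2 1 = 0 → (val b 1 0 = 0 ∨ w = 1) → ∃ A : M2 F, A.det ≠ 0 ∧ ∃ x y, ∃ w : S3 F, (w = 1 ∨ w = s2 ∨ w = s2 * ell w0) ∧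
    ∃ B : M2 F, B.det ≠ 0 ∧ (B 1 0 = 0 ∨ w = 1) ∧ ∃ x' y', g = q1 x y * ell A * w * (q1 x' y' * ell B) := by
    intro w b hw h1 h3 h4 h5
    have h6 := rowlem g b w h1
    obtain ⟨A, hA, x, y, hp, -⟩ := para (g * b⁻¹ * w⁻¹) (by rw [h6]; simp) (by rw [h6]; simp)
    obtain ⟨B, hB, x', y', hb, hB0⟩ := para b h3 h4
    refine ⟨A, hA, x, y, w, hw, B, hB, by rw [hB0]; exact h5, x', y', ?_⟩
    rw [← hp, ← hb]; group
  by_cases h31 : val g 2 0 = 0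
  · by_cases h32 : val g 2 1 = 0
    · obtain ⟨A, hA, x, y, hp, -⟩ := para g h31 h32
      exact ⟨A, hA, x, y, 1, by tauto, 1, by simp, by simp, 0, 0, by rw [hp, q1_zero, ell_one]; simp⟩
    · refine key s2 (mkS !![1, 0, 0; 0, -val g 2 1, -val g 2 2; 0, 0, -(val g 2 1)⁻¹] ?_) (by tauto) ?_ ?_ ?_ ?_
      · rw [Matrix.det_fin_three]; simp [h32]
      · rw [val_s2, val_mk]; ext j; fin_cases j <;> simp [Matrix.vecMul, dotProduct, Fin.sum_univ_three, h31]
      · simp [val_mk]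
      · simp [val_mk]
      · simp [val_mk]
  · refine key (s2 * ell w0) (mkS !![val g 2 0, val g 2 1, val g 2 2; 0, (val g 2 0)⁻¹, 0; 0, 0, 1] ?_) (by tauto) ?_ ?_ ?_ ?_
    · rw [Matrix.det_fin_three]; simp [h31]
    · rw [s2w0, val_mk]; ext j; fin_cases j <;> simp [Matrix.vecMul, dotProduct, Fin.sum_univ_three]
    · simp [val_mk]
    · simp [val_mk]
    · simp [val_mk]
end
end Alg

set_option linter.unusedSectionVars false
set_option linter.unusedVariables false
set_option linter.unusedSimpArgs false
namespace Alg
open Module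

section
variable {F : Type} [Field F] [Fintype F]

theorem uu_det (x : F) : (uu x).det = 1 := by simp [uu, Matrix.det_fin_two]
theorem uu_det0 (x : F) : (uu x).det ≠ 0 := by rw [uu_det]; exact one_ne_zero
theorem w0_det0 : (w0 : M2 F).det ≠ 0 := by rw [w0_det]; exact one_ne_zero
theorem dg_det0 {a b : F} (ha : a ≠ 0) (hb : b ≠ 0) : (dg a b).det ≠ 0 := by
  rw [dg_det]; exact mul_ne_zero ha hb

def lo (y : F) : S3 F := mkS !![1, 0, 0; 0, 1, 0; 0, -y, 1] (by simp [Matrix.det_fin_three])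
theorem val_lo (y : F) : val (lo y) = !![1, 0, 0; 0, 1, 0; 0, -y, 1] := rfl

theorem s2_u (x : F) : ell (uu x) * s2 = s2 * q1 x 0 := by
  apply val_inj
  rw [val_mul, val_mul, ell_val _ (uu_det0 x), val_s2, val_q1]
  ext i j
  fin_cases i <;> fin_cases j <;> simp [elm, uu, Matrix.mul_apply, Fin.sum_univ_three, Matrix.det_fin_two]

theorem w3_u (x : F) : ell (uu x) * (s2 * ell w0) = s2 * ell w0 * q1 0 x := by
  apply val_inj
  rw [val_mul, val_mul _ (q1 0 x), ell_val _ (uu_det0 x), s2w0, val_q1]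
  ext i j
  fin_cases i <;> fin_cases j <;> simp [elm, uu, Matrix.mul_apply, Fin.sum_univ_three, Matrix.det_fin_two]

theorem s2_d (a b : F) (ha : a ≠ 0) (hb : b ≠ 0) : ell (dg a b) * s2 = s2 * ell (dg a (a * b)⁻¹) := by
  apply val_inj
  rw [val_mul, val_mul, ell_val _ (dg_det0 ha hb), val_s2, ell_val _ (dg_det0 ha (inv_ne_zero (mul_ne_zero ha hb)))]
  ext i j
  fin_cases i <;> fin_cases j <;> simp [elm, dg, Matrix.mul_apply, Fin.sum_univ_three, Matrix.det_fin_two, ha, hb]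
  all_goals field_simp

theorem w3_d (a b : F) (ha : a ≠ 0) (hb : b ≠ 0) :
    ell (dg a b) * (s2 * ell w0) = s2 * ell w0 * ell (dg (a * b)⁻¹ a) := by
  apply val_inj
  rw [val_mul, val_mul _ (ell (dg (a * b)⁻¹ a)), ell_val _ (dg_det0 ha hb), s2w0,
    ell_val _ (dg_det0 (inv_ne_zero (mul_ne_zero ha hb)) ha)]
  ext i j
  fin_cases i <;> fin_cases j <;> simp [elm, dg, Matrix.mul_apply, Fin.sum_univ_three, Matrix.det_fin_two, ha, hb]

theorem s2_q (x y : F) : q1 x y * s2 = s2 * (lo y * ell (uu (-x))) := by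
  apply val_inj
  rw [val_mul, val_mul, val_mul, ell_val _ (uu_det0 _), val_s2, val_q1, val_lo]
  ext i j
  fin_cases i <;> fin_cases j <;> simp [elm, uu, Matrix.mul_apply, Fin.sum_univ_three, Matrix.det_fin_two]

variable {k E : Type} [Field k] [CharP k 2] [IsAlgClosed k] [AddCommGroup E] [Module k E]
  [FiniteDimensional k E] (ρ : Representation k (S3 F) E)

theorem rmul (g h : S3 F) (v : E) : ρ g (ρ h v) = ρ (g * h) v := by
  rw [map_mul, Module.End.mul_apply]

abbrev VV := fixS ρ (Q1 F)

theorem ell_VV (A : M2 F) (hA : A.det ≠ 0) (v : E) (hv : v ∈ VV ρ) : ρ (ell A) v ∈ VV ρ := by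
  intro w hw
  obtain ⟨w', hw', e⟩ : ∃ w' ∈ Q1 F, w * ell A = ell A * w' := by
    refine ⟨(ell A)⁻¹ * w * ell A, ?_, by group⟩
    have hinv : (A⁻¹).det ≠ 0 := by
      rw [Matrix.det_nonsing_inv, Ring.inverse_eq_inv']; exact inv_ne_zero hA
    have hi : (ell A)⁻¹ = ell A⁻¹ := by
      rw [inv_eq_iff_mul_eq_one, ← ell_mul _ _ hA hinv, Matrix.mul_nonsing_inv _ (Ne.isUnit hA), ell_one]
    have := Q1_norm A⁻¹ hinv w hw
    rw [← hi, inv_inv] at this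
    exact this
  rw [rmul, e, ← rmul, hv w' hw']

open Classical in
noncomputable def RR : M2 F →* End k (VV ρ) where
  toFun A := if h : A.det ≠ 0 then (ρ (ell A)).restrict (p := VV ρ) (q := VV ρ) (fun v hv => ell_VV ρ A h v hv) else 0
  map_one' := by
    rw [dif_pos (by simp)]
    ext v
    simp [ell_one]
  map_mul' := by
    intro A B
    by_cases hA : A.det = 0
    · rw [dif_neg (by simp [hA]), dif_neg (by simp [hA]), zero_mul]
    by_cases hB : B.det = 0
    · rw [dif_neg (by simp [hB]), dif_neg (c := ¬ B.det = 0) (by simp [hB]), mul_zero]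
    rw [dif_pos (by rw [Matrix.det_mul]; exact mul_ne_zero hA hB), dif_pos hA, dif_pos hB]
    ext v
    simp [ell_mul A B hA hB]

theorem RR0 (A : M2 F) (hA : A.det = 0) : RR ρ A = 0 := dif_neg (by simp [hA])

theorem RR_coe (A : M2 F) (hA : A.det ≠ 0) (v : VV ρ) : ((RR ρ A v : VV ρ) : E) = ρ (ell A) v := by
  have : RR ρ A = (ρ (ell A)).restrict (p := VV ρ) (q := VV ρ) (fun v hv => ell_VV ρ A hA v hv) := dif_pos hA
  rw [this]; rfl

noncomputable abbrev av : E →ₗ[k] E := avg ρ (Q1 F)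

noncomputable def nw (w : S3 F) (m : VV ρ) : VV ρ := ⟨av ρ (ρ w m), avg_mem ρ _ _⟩

theorem nw_one (hq : Fintype.card F % 8 = 3) (m : VV ρ) : nw ρ 1 m = m := by
  apply Subtype.ext
  change av ρ (ρ 1 m) = m
  rw [map_one]
  exact avg_fix ρ _ (Q1_odd hq) _ m.2

theorem av_qell (x y : F) (A : M2 F) (hA : A.det ≠ 0) (v : E) :
    av ρ (ρ (q1 x y * ell A) v) = ρ (ell A) (av ρ v) := by
  rw [← rmul, av, avg_right _ _ _ _ (q1_mem x y), avg_conj _ _ _ _ (Q1_norm A hA)]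

theorem RR_nw (A : M2 F) (hA : A.det ≠ 0) (w : S3 F) (m : VV ρ) :
    RR ρ A (nw ρ w m) = ⟨av ρ (ρ (ell A * w) m), avg_mem ρ _ _⟩ := by
  apply Subtype.ext
  rw [RR_coe ρ A hA]
  change ρ (ell A) (av ρ (ρ w m)) = av ρ (ρ (ell A * w) m)
  rw [← rmul, av, avg_conj _ _ _ _ (Q1_norm A hA)]

theorem Eig_nw (m : VV ρ) (hm : Eig (RR ρ) m) (w : S3 F) (h1 : ∀ x : F, ∃ a b, ell (uu x) * w = w * q1 a b)
    (h2 : ∀ a b : F, a ≠ 0 → b ≠ 0 → ∃ c d, c ≠ 0 ∧ d ≠ 0 ∧ ell (dg a b) * w = w * ell (dg c d)) :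
    Eig (RR ρ) (nw ρ w m) := by
  constructor
  · intro x
    rw [RR_nw ρ _ (uu_det0 x)]
    obtain ⟨a, b, e⟩ := h1 x
    apply Subtype.ext
    change av ρ (ρ (ell (uu x) * w) m) = av ρ (ρ w m)
    rw [e, ← rmul, m.2 _ (q1_mem a b)]
  · intro a b ha hb
    obtain ⟨c, d, hc, hd, e⟩ := h2 a b ha hb
    obtain ⟨s, hs⟩ := hm.2 c d hc hd
    refine ⟨s, ?_⟩
    rw [RR_nw ρ _ (dg_det0 ha hb)]
    apply Subtype.ext
    change av ρ (ρ (ell (dg a b) * w) m) = s • av ρ (ρ w m)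
    rw [e, ← rmul, ← RR_coe ρ _ (dg_det0 hc hd), hs]
    simp

theorem Eig_s2 (m : VV ρ) (hm : Eig (RR ρ) m) : Eig (RR ρ) (nw ρ s2 m) :=
  Eig_nw ρ m hm _ (fun x => ⟨x, 0, s2_u x⟩) fun a b ha hb =>
    ⟨a, (a * b)⁻¹, ha, inv_ne_zero (mul_ne_zero ha hb), s2_d a b ha hb⟩

theorem Eig_w3 (m : VV ρ) (hm : Eig (RR ρ) m) : Eig (RR ρ) (nw ρ (s2 * ell w0) m) :=
  Eig_nw ρ m hm _ (fun x => ⟨0, x, w3_u x⟩) fun a b ha hb =>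
    ⟨(a * b)⁻¹, a, inv_ne_zero (mul_ne_zero ha hb), ha, w3_d a b ha hb⟩

/-- simplicity -/
def SimpG : Prop := ∀ p : Submodule k E, (∀ g, ∀ v ∈ p, ρ g v ∈ p) → p = ⊥ ∨ p = ⊤

theorem spanV (hq : Fintype.card F % 8 = 3) (hs : SimpG ρ) (m : E) (hm : m ≠ 0) (Y : Submodule k (VV ρ))
    (h : ∀ g, (⟨av ρ (ρ g m), avg_mem ρ _ _⟩ : VV ρ) ∈ Y) : ⊤ ≤ Y := by
  have htop : Submodule.span k (Set.range fun g => ρ g m) = ⊤ := by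
    refine (hs _ ?_).resolve_left ?_
    · intro g v hv
      have : Submodule.span k (Set.range fun g => ρ g m) ≤ (Submodule.span k (Set.range fun g => ρ g m)).comap (ρ g) := by
        rw [Submodule.span_le]
        rintro _ ⟨g', rfl⟩
        exact Submodule.subset_span ⟨g * g', by simp⟩
      exact this hv
    · intro hb
      apply hm
      have : m ∈ Submodule.span k (Set.range fun g => ρ g m) := Submodule.subset_span ⟨1, by simp⟩
      rw [hb] at this
      exact (Submodule.mem_bot k).1 this
  rintro v -
  have h1 : ⊤ ≤ (Y.map (VV ρ).subtype).comap (av ρ) := by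
    rw [← htop, Submodule.span_le]
    rintro _ ⟨g, rfl⟩
    exact ⟨_, h g, rfl⟩
  obtain ⟨y, hy, e⟩ := h1 (Submodule.mem_top (x := (v : E)))
  have : y = v := by
    apply Subtype.ext
    change (y : E) = av ρ v at e
    rw [e]; exact avg_fix ρ _ (Q1_odd hq) _ v.2
  rwa [← this]

theorem htopB (hq : Fintype.card F % 8 = 3) (hs : SimpG ρ) (m : VV ρ) (hm : m ≠ 0) (hE : Eig (RR ρ) m) :
    ⊤ ≤ An (RR ρ) m ⊔ An (RR ρ) (nw ρ s2 m) ⊔ An (RR ρ) (nw ρ (s2 * ell w0) m) := by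
  apply spanV ρ hq hs m (by simpa using hm)
  intro g
  obtain ⟨A, hA, x, y, w, hw, B, hB, hB0, x', y', e⟩ := decomp g
  have e1 : (⟨av ρ (ρ g m), avg_mem ρ _ _⟩ : VV ρ) = RR ρ A (nw ρ w (RR ρ B m)) := by
    rw [RR_nw ρ A hA]
    apply Subtype.ext
    change av ρ (ρ g m) = av ρ (ρ (ell A * w) (RR ρ B m : VV ρ))
    have : ρ (q1 x' y' * ell B) m = (RR ρ B m : VV ρ) := by
      rw [← rmul, ← RR_coe ρ B hB, (RR ρ B m).2 _ (q1_mem _ _)]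
    rw [e, ← rmul, this, ← rmul, av_qell ρ x y A hA, ← rmul, ← one_mul (ell A), ← q1_zero, av_qell ρ 0 0 A hA, q1_zero, one_mul]
  rw [e1]
  rcases hB0 with hB0 | rfl
  · obtain ⟨s, hs⟩ := hE.small B hB hB0
    have e2 : nw ρ w (RR ρ B m) = s • nw ρ w m := by
      apply Subtype.ext
      change av ρ (ρ w (RR ρ B m : VV ρ)) = s • av ρ (ρ w m)
      rw [hs]; simp
    rw [e2, map_smul]
    apply Submodule.smul_mem
    have h3 : RR ρ A (nw ρ w m) ∈ An (RR ρ) (nw ρ w m) := An_stab _ _ An_self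
    rcases hw with rfl | rfl | rfl
    · rw [nw_one ρ hq] at h3 ⊢
      exact Submodule.mem_sup_left (Submodule.mem_sup_left h3)
    · exact Submodule.mem_sup_left (Submodule.mem_sup_right h3)
    · exact Submodule.mem_sup_right h3
  · rw [nw_one ρ hq]
    exact Submodule.mem_sup_left (Submodule.mem_sup_left (An_stab _ _ (An_stab _ _ An_self)))

theorem nw_s2_zero (X : Submodule k (VV ρ)) (hX : Stab (RR ρ) X)
    (hU : ∀ v ∈ X, (∀ x, RR ρ (uu x) v = v) → v = 0) (s : VV ρ) (hs : s ∈ X) : nw ρ s2 s = 0 := by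
  have h0 : eU (RR ρ) s = 0 := by
    apply hU
    · rw [eU_apply]; exact X.sum_mem fun x _ => hX _ _ hs
    · intro x
      rw [eU_apply, map_sum]
      refine Fintype.sum_equiv (Equiv.addLeft x) _ _ fun y => ?_
      rw [Rmul, uu_mul]; rfl
  apply Subtype.ext
  change av ρ (ρ s2 s) = 0
  have := Fintype.ofFinite (Q1 F)
  rw [av, avg_eq, ← Equiv.sum_comp (Q1equiv (F := F)), Fintype.sum_prod_type_right]
  apply Finset.sum_eq_zero
  intro y _
  have e : ∀ x, ρ ((Q1equiv (x, y) : Q1 F) : S3 F) (ρ s2 s) = ρ (s2 * lo y) (RR ρ (uu (-x)) s : VV ρ) := by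
    intro x
    rw [RR_coe ρ _ (uu_det0 _), rmul, rmul, mul_assoc, ← s2_q]; rfl
  rw [Finset.sum_congr rfl fun x _ => e x, ← map_sum]
  have e2 : ∑ x : F, ((RR ρ (uu (-x)) s : VV ρ) : E) = (eU (RR ρ) s : VV ρ) := by
    rw [eU_apply, AddSubmonoidClass.coe_finsetSum]
    exact Fintype.sum_equiv (Equiv.neg F) _ _ fun x => rfl
  rw [e2, h0]
  simp

theorem htopA (hq : Fintype.card F % 8 = 3) (hs : SimpG ρ) (X : Submodule k (VV ρ)) (hX : Stab (RR ρ) X)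
    (hX0 : X ≠ ⊥) (hU : ∀ v ∈ X, (∀ x, RR ρ (uu x) v = v) → v = 0) : X = ⊤ := by
  obtain ⟨m, hmX, hm⟩ := X.ne_bot_iff.1 hX0
  rw [← top_le_iff]
  apply spanV ρ hq hs m (by simpa using hm)
  intro g
  obtain ⟨A, hA, x, y, w, hw, B, hB, hB0, x', y', e⟩ := decomp g
  have e1 : (⟨av ρ (ρ g m), avg_mem ρ _ _⟩ : VV ρ) = RR ρ A (nw ρ w (RR ρ B m)) := by
    rw [RR_nw ρ A hA]
    apply Subtype.ext
    change av ρ (ρ g m) = av ρ (ρ (ell A * w) (RR ρ B m : VV ρ))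
    have : ρ (q1 x' y' * ell B) m = (RR ρ B m : VV ρ) := by
      rw [← rmul, ← RR_coe ρ B hB, (RR ρ B m).2 _ (q1_mem _ _)]
    rw [e, ← rmul, this, ← rmul, av_qell ρ x y A hA, ← rmul, ← one_mul (ell A), ← q1_zero, av_qell ρ 0 0 A hA, q1_zero, one_mul]
  rw [e1]
  apply hX
  have hBm := hX B m hmX
  rcases hw with rfl | rfl | rfl
  · rw [nw_one ρ hq]; exact hBm
  · rw [nw_s2_zero ρ X hX hU _ hBm]; exact X.zero_mem
  · have e3 : nw ρ (s2 * ell w0) (RR ρ B m) = nw ρ s2 (RR ρ w0 (RR ρ B m)) := by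
      apply Subtype.ext
      change av ρ (ρ (s2 * ell w0) (RR ρ B m : VV ρ)) = av ρ (ρ s2 (RR ρ w0 (RR ρ B m) : VV ρ))
      rw [RR_coe ρ w0 w0_det0, rmul]
    rw [e3, nw_s2_zero ρ X hX hU _ (hX _ _ hBm)]; exact X.zero_mem

theorem exists_eig (hB : HypB (RR ρ)) (hne : (⊤ : Submodule k (VV ρ)) ≠ ⊥) :
    ∃ m : VV ρ, m ≠ 0 ∧ Eig (RR ρ) m := by
  let S : Submodule k (VV ρ) :=
    { carrier := {v | ∀ x, RR ρ (uu x) v = v}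
      add_mem' := by intro a b ha hb x; rw [map_add, ha x, hb x]
      zero_mem' := by intro x; simp
      smul_mem' := by intro c v hv x; rw [map_smul, hv x] }
  have hS : S ≠ ⊥ := by
    obtain ⟨v, -, hv0, hv⟩ := hB ⊤ (fun _ _ _ => Submodule.mem_top) hne
    exact S.ne_bot_iff.2 ⟨v, hv, hv0⟩
  obtain ⟨m, hmS, hm0, hme⟩ := common_eig (fun i : Fˣ × Fˣ => RR ρ (dg (i.1 : F) (i.2 : F))) (by
    intro i j x
    rw [Rmul, Rmul, dg_mul, dg_mul, mul_comm (i.1 : F), mul_comm (i.2 : F)]) _ S le_rfl hS (by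
    intro i v hv x
    have e : uu x * dg (i.1 : F) (i.2 : F) = dg (i.1 : F) (i.2 : F) * uu (i.2 * x / i.1) := by
      simp only [uu, dg, Matrix.mul_fin_two]
      congr 1
      ext a b; fin_cases a <;> fin_cases b <;> simp <;> field_simp
    rw [Rmul, e, ← Rmul, hv])
  refine ⟨m, hm0, hmS, fun a b ha hb => ?_⟩
  exact hme (Units.mk0 a ha, Units.mk0 b hb)

theorem mainPB (hq : Fintype.card F % 8 = 3) (r : F) (hr : r * r = -2) (hs : SimpG ρ) :
    PB (RR ρ (cc r)) (RR ρ vv) (fixE (eT (RR ρ))) := by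
  by_cases hne : (⊤ : Submodule k (VV ρ)) = ⊥
  · refine ⟨∅, linearIndepOn_empty k _, ?_, by simp⟩
    rw [Submodule.span_empty, eq_comm, eq_bot_iff, ← hne]
    exact le_top
  by_cases hB : HypB (RR ρ)
  · by_cases hT : ∀ m : VV ρ, m ≠ 0 → Eig (RR ρ) m → ¬ TrT (RR ρ) m
    · obtain ⟨m, hm0, hm⟩ := exists_eig ρ hB hne
      exact caseB2 r hq hr (RR0 ρ) hB hT _ _ _ hm (Eig_s2 ρ m hm) (Eig_w3 ρ m hm) (htopB ρ hq hs m hm0 hm)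
    · push Not at hT
      obtain ⟨m1, hm1, hE1, ht1⟩ := hT
      obtain ⟨m, hm0, hm, hf⟩ := exists_fix hq (RR0 ρ) hB hE1 hm1 ht1
      have htop := htopB ρ hq hs m hm0 hm
      have e : nw ρ (s2 * ell w0) m = nw ρ s2 m := by
        apply Subtype.ext
        change av ρ (ρ (s2 * ell w0) m) = av ρ (ρ s2 m)
        rw [← rmul, ← RR_coe ρ w0 w0_det0, hf _ w0_det]
      rw [e, sup_assoc, sup_idem] at htop
      exact caseB1 r hq hr (RR0 ρ) hB m hm hm0 hf (Eig_s2 ρ m hm) htop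
  · rw [HypB] at hB
    push Not at hB
    obtain ⟨X, hX, hX0, hXU⟩ := hB
    have hU : ∀ v ∈ X, (∀ x, RR ρ (uu x) v = v) → v = 0 := by
      intro v hv hvx
      by_contra h0
      obtain ⟨x, hx⟩ := hXU v hv h0
      exact hx (hvx x)
    have hXt := htopA ρ hq hs X hX hX0 hU
    have : Nontrivial (VV ρ) := by
      by_contra hn
      rw [not_nontrivial_iff_subsingleton] at hn
      exact hne (Subsingleton.elim _ _)
    apply caseA hq r hr (RR ρ) (RR0 ρ)
    · intro Y hY
      by_cases hY0 : Y = ⊥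
      · exact Or.inl hY0
      · exact Or.inr (htopA ρ hq hs Y hY hY0 fun v _ => hU v (by rw [hXt]; trivial))
    · intro v; exact hU v (by rw [hXt]; trivial)
end
end Alg

set_option linter.unusedSectionVars false
set_option linter.unusedVariables false
set_option linter.unusedSimpArgs false
namespace Alg
open Module

theorem inv_closed {G : Type} [Group G] [Finite G] (S : Set G) (h1 : (1 : G) ∈ S)
    (hm : ∀ a ∈ S, ∀ b ∈ S, a * b ∈ S) (a : G) (ha : a ∈ S) : a⁻¹ ∈ S := by
  have hp : ∀ n : ℕ, a ^ n ∈ S := by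
    intro n
    induction n with
    | zero => simpa using h1
    | succ n ih => rw [pow_succ]; exact hm _ ih _ ha
  have h : a ^ (Nat.card G - 1) * a = 1 := by
    rw [← pow_succ, Nat.sub_add_cancel Nat.card_pos, pow_card_eq_one']
  rw [← eq_inv_of_mul_eq_one_left h]; exact hp _

theorem cyc1 {G : Type} [Group G] (P K : Subgroup G) (c : G)
    (h : ∀ g ∈ P, g ∈ K → g ∈ Subgroup.zpowers c) : IsCyclic (K.subgroupOf P) := by
  let f : K.subgroupOf P →* G := P.subtype.comp (K.subgroupOf P).subtype
  let f' : K.subgroupOf P →* Subgroup.zpowers c :=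
    f.codRestrict _ (fun x => h _ x.1.2 x.2)
  refine isCyclic_of_injective f' ?_
  intro a b hab
  have : f a = f b := congrArg (Subgroup.zpowers c).subtype hab
  exact Subtype.ext (Subtype.ext this)

theorem cyc2 {G : Type} [Group G] (P K : Subgroup G)
    (h : ∀ g ∈ P, g ∈ K → g ≠ 1 → ∀ g' ∈ P, g' ∈ K → g' ≠ 1 → g * g' = 1) : IsCyclic (K.subgroupOf P) := by
  by_cases ht : ∃ g ∈ P, g ∈ K ∧ g ≠ 1
  · obtain ⟨g, hg, hk, h1⟩ := ht
    apply cyc1 P K g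
    intro g' hg' hk'
    by_cases h1' : g' = 1
    · rw [h1']; exact Subgroup.one_mem _
    · rw [eq_inv_of_mul_eq_one_right (h g hg hk h1 g' hg' hk' h1')]
      exact Subgroup.inv_mem _ (Subgroup.mem_zpowers g)
  · push Not at ht
    apply cyc1 P K 1
    intro g hg hk
    rw [ht g hg hk]; exact Subgroup.one_mem _

section
variable {F : Type} [Field F] [Fintype F]

theorem S3_finite : Finite (S3 F) := by
  classical
  infer_instance

theorem card_S3 : Nat.card (S3 F) * (Fintype.card F - 1) =
    ∏ i : Fin 3, (Fintype.card F ^ 3 - Fintype.card F ^ (i : ℕ)) := by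
  classical
  rw [← Matrix.card_GL_field]
  rw [Subgroup.card_eq_card_quotient_mul_card_subgroup (Matrix.GeneralLinearGroup.det (n := Fin 3) (R := F)).ker]
  rw [Nat.card_congr (QuotientGroup.quotientKerEquivOfSurjective (Matrix.GeneralLinearGroup.det (n := Fin 3) (R := F)) Matrix.GeneralLinearGroup.det_surjective).toEquiv,
    Nat.card_eq_fintype_card (α := Fˣ), Fintype.card_units, mul_comm]
  congr 1
  refine Nat.card_congr (Equiv.ofBijective (β := (Matrix.GeneralLinearGroup.det (n := Fin 3) (R := F)).ker) (fun g : S3 F => ⟨Matrix.SpecialLinearGroup.toGL g, ?_⟩) ⟨?_, ?_⟩)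
  · rw [MonoidHom.mem_ker]; ext; simp
  · intro a b h
    exact Matrix.SpecialLinearGroup.toGL_injective (congrArg Subtype.val h)
  · rintro ⟨g, hg⟩
    refine ⟨⟨g.1, ?_⟩, ?_⟩
    · have := congrArg Units.val (MonoidHom.mem_ker.1 hg)
      simpa using this
    · apply Subtype.ext; ext; rfl

theorem card_S3_16 (hq : Fintype.card F % 8 = 3) : ∃ n, Nat.card (S3 F) = 16 * n ∧ Odd n := by
  have h := card_S3 (F := F)
  generalize Fintype.card F = q at *
  obtain ⟨a, rfl⟩ : ∃ a, q = 8 * a + 3 := ⟨q / 8, by omega⟩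
  simp only [Fin.prod_univ_three, Fin.val_zero, Fin.val_one, Fin.val_two, pow_zero, pow_one] at h
  refine ⟨(8*a+3)^3 * ((4*a+1)*(4*a+1)*(2*a+1)) * ((8*a+3)^2+(8*a+3)+1), ?_, ?_⟩
  · have h1 : (8*a+3)^3 - 1 = (8*a+2) * ((8*a+3)^2+(8*a+3)+1) := by
      rw [Nat.sub_eq_iff_eq_add (Nat.one_le_pow _ _ (by omega))]; ring
    have h2 : (8*a+3)^3 - (8*a+3) = (8*a+3) * (8 * ((4*a+1)*(2*a+1))) := by
      rw [Nat.sub_eq_iff_eq_add (Nat.le_self_pow (by omega) _)]; ring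
    have h3 : (8*a+3)^3 - (8*a+3)^2 = (8*a+3)^2 * (8*a+2) := by
      rw [Nat.sub_eq_iff_eq_add (Nat.pow_le_pow_right (by omega) (by omega))]; ring
    rw [h1, h2, h3, show 8*a+3-1 = 8*a+2 by omega] at h
    apply Nat.eq_of_mul_eq_mul_right (show 0 < 8*a+2 by omega)
    rw [h]; ring
  · have o : Odd (8*a+3) := ⟨4*a+1, by ring⟩
    refine ((o.pow).mul (Odd.mul (Odd.mul ⟨2*a, by ring⟩ ⟨2*a, by ring⟩) ⟨a, by ring⟩)).mul ?_
    exact ((o.pow).add_odd o).add_one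

variable (r : F)

def InP (A : M2 F) : Prop := ∃ j : ℕ, A = cc r ^ j ∨ A = cc r ^ j * vv

theorem vv_det : (vv : M2 F).det = -1 := by simp [vv, Matrix.det_fin_two]

theorem InP_det (hq : Fintype.card F % 8 = 3) (hr : r * r = -2) {A : M2 F} (h : InP r A) :
    A.det = 1 ∨ A.det = -1 := by
  obtain ⟨j, rfl | rfl⟩ := h
  · rw [Matrix.det_pow, cc_det r hq hr]; exact neg_one_pow_eq_or F j
  · rw [Matrix.det_mul, Matrix.det_pow, cc_det r hq hr, vv_det]
    rcases neg_one_pow_eq_or F j with h | h <;> rw [h] <;> simp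

theorem InP_det0 (hq : Fintype.card F % 8 = 3) (hr : r * r = -2) {A : M2 F} (h : InP r A) :
    A.det ≠ 0 := by
  rcases InP_det r hq hr h with h | h <;> rw [h] <;> simp

theorem vv_ccpow (hq : Fintype.card F % 8 = 3) (hr : r * r = -2) (j : ℕ) :
    vv * cc r ^ j = cc r ^ (3 * j) * vv := by
  induction j with
  | zero => simp
  | succ j ih =>
    rw [pow_succ, ← mul_assoc, ih, mul_assoc, vv_cc r hr (two_ne hq), ← mul_assoc, ← pow_add]
    rfl

theorem InP_mul (hq : Fintype.card F % 8 = 3) (hr : r * r = -2) {A B : M2 F} (hA : InP r A) (hB : InP r B) :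
    InP r (A * B) := by
  obtain ⟨j, rfl | rfl⟩ := hA <;> obtain ⟨i, rfl | rfl⟩ := hB
  · exact ⟨j + i, Or.inl (pow_add _ _ _).symm⟩
  · exact ⟨j + i, Or.inr (by rw [pow_add, mul_assoc])⟩
  · exact ⟨j + 3 * i, Or.inr (by rw [mul_assoc, vv_ccpow r hq hr, pow_add, mul_assoc])⟩
  · exact ⟨j + 3 * i, Or.inl (by
      rw [mul_assoc, ← mul_assoc vv, vv_ccpow r hq hr, mul_assoc, vv_sq, mul_one, pow_add])⟩

theorem InP_vv (hq : Fintype.card F % 8 = 3) (hr : r * r = -2) (j i : ℕ) :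
    ∃ n, cc r ^ j * vv * (cc r ^ i * vv) = cc r ^ n :=
  ⟨j + 3 * i, by rw [mul_assoc, ← mul_assoc vv, vv_ccpow r hq hr, mul_assoc, vv_sq, mul_one, pow_add]⟩

/-- Sylow subgroup -/
def PP (hq : Fintype.card F % 8 = 3) (hr : r * r = -2) : Subgroup (S3 F) :=
  have h1 : (1 : S3 F) ∈ {g | ∃ A : M2 F, InP r A ∧ g = ell A} := ⟨1, ⟨0, Or.inl (by simp)⟩, ell_one.symm⟩
  have hm : ∀ a ∈ {g | ∃ A : M2 F, InP r A ∧ g = ell A}, ∀ b ∈ {g | ∃ A : M2 F, InP r A ∧ g = ell A},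
      a * b ∈ {g | ∃ A : M2 F, InP r A ∧ g = ell A} := by
    rintro _ ⟨A, hA, rfl⟩ _ ⟨B, hB, rfl⟩
    exact ⟨A * B, InP_mul r hq hr hA hB, (ell_mul A B (InP_det0 r hq hr hA) (InP_det0 r hq hr hB)).symm⟩
  { carrier := {g | ∃ A : M2 F, InP r A ∧ g = ell A}
    one_mem' := h1
    mul_mem' := fun ha hb => hm _ ha _ hb
    inv_mem' := fun {a} ha => have := S3_finite (F := F); inv_closed _ h1 hm a ha }

theorem mem_PP (hq : Fintype.card F % 8 = 3) (hr : r * r = -2) {g : S3 F} :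
    g ∈ PP r hq hr ↔ ∃ A : M2 F, InP r A ∧ g = ell A := Iff.rfl

theorem TT_det0 {t : M2 F} (ht : t ∈ TT F) : t.det ≠ 0 := by
  rw [(mem_TT.1 ht).2.1]; exact one_ne_zero

theorem q1ell_mul (x y x' y' : F) (A B : M2 F) (hA : A.det ≠ 0) (hB : B.det ≠ 0) :
    q1 x y * ell A * (q1 x' y' * ell B) =
    q1 (x + A.det*(A 0 0*x'+A 0 1*y')) (y + A.det*(A 1 0*x'+A 1 1*y')) * ell (A * B) := by
  rw [mul_assoc, ← mul_assoc (ell A), ell_q1 A hA, mul_assoc, ← ell_mul A B hA hB, ← mul_assoc, q1_mul]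

def WW (F : Type) [Field F] [Fintype F] : Subgroup (S3 F) :=
  have h1 : (1 : S3 F) ∈ {g : S3 F | ∃ t ∈ TT F, ∃ x y, g = q1 x y * ell t} :=
    ⟨1, TT_one, 0, 0, by rw [q1_zero, ell_one, one_mul]⟩
  have hm : ∀ a ∈ {g : S3 F | ∃ t ∈ TT F, ∃ x y, g = q1 x y * ell t},
      ∀ b ∈ {g : S3 F | ∃ t ∈ TT F, ∃ x y, g = q1 x y * ell t},
      a * b ∈ {g : S3 F | ∃ t ∈ TT F, ∃ x y, g = q1 x y * ell t} := by
    rintro _ ⟨A, hA, x, y, rfl⟩ _ ⟨B, hB, x', y', rfl⟩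
    exact ⟨A * B, TT_mul hA hB, _, _, q1ell_mul x y x' y' A B (TT_det0 hA) (TT_det0 hB)⟩
  { carrier := {g : S3 F | ∃ t ∈ TT F, ∃ x y, g = q1 x y * ell t}
    one_mem' := h1
    mul_mem' := fun ha hb => hm _ ha _ hb
    inv_mem' := fun {a} ha => have := S3_finite (F := F); inv_closed _ h1 hm a ha }

theorem mem_WW {g : S3 F} : g ∈ WW F ↔ ∃ t ∈ TT F, ∃ x y, g = q1 x y * ell t := Iff.rfl

theorem ell_inj_iff (hq : Fintype.card F % 8 = 3) (hr : r * r = -2) {A : M2 F} (h : InP r A) (n : ℕ) :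
    ell (A ^ n) = ell A ^ n := by
  induction n with
  | zero => simp [ell_one]
  | succ n ih => rw [pow_succ, pow_succ, ell_mul _ _ (by
      rw [Matrix.det_pow]; exact pow_ne_zero _ (InP_det0 r hq hr h)) (InP_det0 r hq hr h), ih]

theorem InP_cc : InP r (cc r) := ⟨1, Or.inl (by simp)⟩
theorem InP_v : InP r vv := ⟨0, Or.inr (by simp)⟩
theorem InP_ccp (j : ℕ) : InP r (cc r ^ j) := ⟨j, Or.inl rfl⟩
theorem InP_ccpv (j : ℕ) : InP r (cc r ^ j * vv) := ⟨j, Or.inr rfl⟩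

theorem cc8 (hq : Fintype.card F % 8 = 3) (hr : r * r = -2) : cc r ^ 8 = 1 := by
  rw [show 8 = 4 + 4 from rfl, pow_add, cc_four r hr (two_ne hq)]; simp

theorem vv_ne (hq : Fintype.card F % 8 = 3) (a b : F) : vv ≠ kap a b := by
  intro h
  have h1 := congrFun (congrFun h 0) 0
  have h2 := congrFun (congrFun h 1) 1
  simp [vv, kap] at h1 h2
  apply two_ne hq
  linear_combination h1 - h2

theorem card_PP (hq : Fintype.card F % 8 = 3) (hr : r * r = -2) : Nat.card (PP r hq hr) = 16 := by
  have := S3_finite (F := F)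
  have hle : Nat.card (PP r hq hr) ≤ 16 := by
    have h := Nat.card_le_card_of_surjective (α := Fin 8 × Bool) (β := PP r hq hr)
      (fun x => ⟨ell (cc r ^ (x.1 : ℕ) * (if x.2 then vv else 1)), by
        rcases x with ⟨j, b⟩
        cases b
        · exact ⟨_, InP_ccp r j, by simp⟩
        · exact ⟨_, InP_ccpv r j, by simp⟩⟩) (by
        rintro ⟨_, A, ⟨j, rfl | rfl⟩, rfl⟩
        · refine ⟨(⟨j % 8, by omega⟩, false), Subtype.ext ?_⟩
          simp [← pow_eq_pow_mod j (cc8 r hq hr)]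
        · refine ⟨(⟨j % 8, by omega⟩, true), Subtype.ext ?_⟩
          simp [← pow_eq_pow_mod j (cc8 r hq hr)])
    simpa using h
  have ho : orderOf (ell (cc r)) = 8 := by
    have : Fact (Nat.Prime 2) := ⟨Nat.prime_two⟩
    rw [orderOf_eq_prime_pow (p := 2) (n := 2)]
    · rfl
    · rw [← ell_inj_iff r hq hr (InP_cc r), show 2 ^ 2 = 4 from rfl]
      intro h
      rw [← ell_one] at h
      have h2 := ell_inj _ _ (InP_det0 r hq hr (InP_ccp r 4)) (by simp) h
      rw [cc_four r hr (two_ne hq)] at h2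
      have := congrFun (congrFun h2 0) 0
      simp at this
      apply two_ne hq
      linear_combination -this
    · rw [← ell_inj_iff r hq hr (InP_cc r), show 2 ^ (2+1) = 8 from rfl, cc8 r hq hr, ell_one]
  have hzle : Subgroup.zpowers (ell (cc r)) ≤ PP r hq hr := by
    rw [Subgroup.zpowers_le]; exact ⟨_, InP_cc r, rfl⟩
  have hd : 8 ∣ Nat.card (PP r hq hr) := by
    rw [← ho, ← Nat.card_zpowers]; exact Subgroup.card_dvd_of_le hzle
  have hne : Nat.card (PP r hq hr) ≠ 8 := by
    intro h8
    have he := Subgroup.eq_of_le_of_card_ge hzle (by rw [h8, Nat.card_zpowers, ho])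
    have hv : ell vv ∈ PP r hq hr := ⟨_, InP_v r, rfl⟩
    rw [← he, ← mem_powers_iff_mem_zpowers] at hv
    obtain ⟨n, hn⟩ := hv
    change ell (cc r) ^ n = _ at hn
    rw [← ell_inj_iff r hq hr (InP_cc r)] at hn
    have := ell_inj _ _ (InP_det0 r hq hr (InP_ccp r n)) (InP_det0 r hq hr (InP_v r)) hn
    obtain ⟨a, b, hab⟩ := cc_powkap r n
    exact vv_ne hq a b (by rw [← this, hab])
  have hpos : 0 < Nat.card (PP r hq hr) := Nat.card_pos
  omega

theorem index_PP (hq : Fintype.card F % 8 = 3) (hr : r * r = -2) : Odd (PP r hq hr).index := by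
  obtain ⟨n, hn, ho⟩ := card_S3_16 hq
  have := (PP r hq hr).card_mul_index
  rw [card_PP, hn] at this
  rw [Nat.eq_of_mul_eq_mul_left (by norm_num) this]
  exact ho

theorem InP_TT (hq : Fintype.card F % 8 = 3) (hr : r * r = -2) {A t : M2 F} (hA : InP r A) (ht : t ∈ TT F) :
    ∃ t' ∈ TT F, A * t = t' * A := by
  obtain ⟨j, rfl | rfl⟩ := hA
  · exact ⟨t, ht, (TT_comm ht (cc_powkap r j)).symm⟩
  · refine ⟨vv * t * vv, TT_conj ht, ?_⟩
    rw [← mul_assoc, TT_comm (TT_conj ht) (cc_powkap r j), mul_assoc, mul_assoc, mul_assoc (vv * t), vv_sq, mul_one]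

theorem norm_WW (hq : Fintype.card F % 8 = 3) (hr : r * r = -2) :
    ∀ g ∈ PP r hq hr, ∀ w, w ∈ WW F → g * w * g⁻¹ ∈ WW F := by
  rintro _ ⟨A, hA, rfl⟩ _ ⟨t, ht, x, y, rfl⟩
  obtain ⟨t', ht', e⟩ := InP_TT r hq hr hA ht
  refine ⟨t', ht', A.det*(A 0 0*x+A 0 1*y), A.det*(A 1 0*x+A 1 1*y), ?_⟩
  have hA0 := InP_det0 r hq hr hA
  rw [mul_inv_eq_iff_eq_mul, ← mul_assoc, ell_q1 A hA0, mul_assoc, ← ell_mul _ _ hA0 (TT_det0 ht), e,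
    ell_mul _ _ (TT_det0 ht') hA0, mul_assoc]

theorem TT_sq (hq : Fintype.card F % 8 = 3) {t : M2 F} (ht : t ∈ TT F) (h : t * t = 1) : t = 1 := by
  obtain ⟨n, hn⟩ := m_odd hq
  have h1 := (mem_TT.1 ht).2.2
  rw [hn, pow_succ, pow_mul, pow_two, h, one_pow, one_mul] at h1
  exact h1

theorem cent (hq : Fintype.card F % 8 = 3) (hr : r * r = -2) {A t : M2 F} (hA : InP r A) (ht : t ∈ TT F)
    (x y : F) (h : ell A ∈ Subgroup.centralizer {q1 x y * ell t}) :
    A * t = t * A ∧ A.det*(A 0 0*x+A 0 1*y) = x ∧ A.det*(A 1 0*x+A 1 1*y) = y := by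
  have hA0 := InP_det0 r hq hr hA
  have h1 := Subgroup.mem_centralizer_singleton_iff.1 h
  rw [← mul_assoc, ell_q1 A hA0, mul_assoc, mul_assoc, ← ell_mul _ _ hA0 (TT_det0 ht),
    ← ell_mul _ _ (TT_det0 ht) hA0] at h1
  exact q1_ell_inj _ _ (by rw [Matrix.det_mul]; exact mul_ne_zero hA0 (TT_det0 ht))
    (by rw [Matrix.det_mul]; exact mul_ne_zero (TT_det0 ht) hA0) _ _ _ _ h1

theorem fix_one (hq : Fintype.card F % 8 = 3) (hr : r * r = -2) (j : ℕ) (x y : F) (hxy : ¬ (x = 0 ∧ y = 0))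
    (h1 : (cc r ^ j).det*((cc r ^ j) 0 0*x+(cc r ^ j) 0 1*y) = x)
    (h2 : (cc r ^ j).det*((cc r ^ j) 1 0*x+(cc r ^ j) 1 1*y) = y) : cc r ^ j = 1 := by
  have hd := InP_det r hq hr (InP_ccp r j)
  obtain ⟨a, b, e⟩ := cc_powkap r j
  rw [e] at h1 h2 hd ⊢
  rw [kap_det] at h1 h2 hd
  simp [kap] at h1 h2
  set d := a * a + b * b with hdd
  have e1 : ((d*a-1)*(d*a-1)+(d*b)*(d*b)) * x = 0 := by linear_combination (d*a-1)*h1 + d*b*h2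
  have e2 : ((d*a-1)*(d*a-1)+(d*b)*(d*b)) * y = 0 := by linear_combination (d*a-1)*h2 - d*b*h1
  have e3 : (d*a-1)*(d*a-1)+(d*b)*(d*b) = 0 := by
    by_contra hn
    exact hxy ⟨(mul_eq_zero.1 e1).resolve_left hn, (mul_eq_zero.1 e2).resolve_left hn⟩
  obtain ⟨f1, f2⟩ := sumsq hq e3
  rcases hd with hd | hd
  · rw [hd] at f1 f2
    rw [show a = 1 by linear_combination f1, show b = 0 by linear_combination f2, kap_one]
  · exfalso
    rw [hd] at f1 f2
    have ha : a = -1 := by linear_combination -f1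
    have hb : b = 0 := by linear_combination -f2
    rw [hdd, ha, hb] at hd
    apply two_ne hq
    linear_combination hd

theorem cyc_WW (hq : Fintype.card F % 8 = 3) (hr : r * r = -2) :
    ∀ w ∈ WW F, w ≠ 1 → IsCyclic ((Subgroup.centralizer {w}).subgroupOf (PP r hq hr)) := by
  rintro _ ⟨t, ht, x, y, rfl⟩ hw
  by_cases h1 : t = 1
  · subst h1
    have hxy : ¬ (x = 0 ∧ y = 0) := by
      rintro ⟨rfl, rfl⟩
      exact hw (by rw [q1_zero, ell_one, one_mul])
    have key : ∀ j : ℕ, ell (cc r ^ j) ∈ Subgroup.centralizer {q1 x y * ell 1} → ell (cc r ^ j) = 1 := by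
      intro j hj
      obtain ⟨-, a, b⟩ := cent r hq hr (InP_ccp r j) ht x y hj
      rw [fix_one r hq hr j x y hxy a b, ell_one]
    apply cyc2
    rintro _ ⟨A, ⟨j, rfl | rfl⟩, rfl⟩ hk hne _ ⟨B, ⟨i, rfl | rfl⟩, rfl⟩ hk' hne'
    · exact absurd (key j hk) hne
    · exact absurd (key j hk) hne
    · exact absurd (key i hk') hne'
    · have := Subgroup.mul_mem _ hk hk'
      rw [← ell_mul _ _ (InP_det0 r hq hr (InP_ccpv r j)) (InP_det0 r hq hr (InP_ccpv r i))] at this ⊢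
      obtain ⟨n, hn⟩ := InP_vv r hq hr j i
      rw [hn] at this ⊢
      exact key n this
  · apply cyc1 _ _ (ell (cc r))
    rintro _ ⟨A, hA, rfl⟩ hk
    have hc := (cent r hq hr hA ht x y hk).1
    obtain ⟨j, rfl | rfl⟩ := hA
    · rw [ell_inj_iff r hq hr (InP_cc r)]
      exact Subgroup.npow_mem_zpowers _ _
    · exfalso
      apply h1
      apply TT_sq hq ht
      have hu : IsUnit (cc r ^ j) := (Matrix.isUnit_iff_isUnit_det _).2 (Ne.isUnit (InP_det0 r hq hr (InP_ccp r j)))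
      have h3 : vv * t = t * vv := by
        apply hu.mul_left_cancel
        rw [← mul_assoc, hc, ← mul_assoc, TT_comm ht (cc_powkap r j), mul_assoc]
      have h4 := TT_inv ht
      rw [h3, mul_assoc t vv, vv_sq, mul_one] at h4
      exact h4

variable {k E : Type} [Field k] [CharP k 2] [IsAlgClosed k] [AddCommGroup E] [Module k E]
  [FiniteDimensional k E] (ρ : Representation k (S3 F) E)

theorem good_main (hq : Fintype.card F % 8 = 3) (hr : r * r = -2) (hs : SimpG ρ) :
    Good (ρ.comp (PP r hq hr).subtype) := by
  have := S3_finite (F := F)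
  obtain ⟨B, hB, hsp, hst⟩ := mainPB ρ hq r hr hs
  refine good_of_W ρ (PP r hq hr) (WW F) (norm_WW r hq hr) (cyc_WW r hq hr)
    (Subtype.val '' B) ?_ ?_ ?_
  · have h1 : LinearIndepOn k ((VV ρ).subtype ∘ id) B :=
      LinearIndependent.map' hB (VV ρ).subtype (Submodule.ker_subtype _)
    exact LinearIndepOn.id_image h1
  · intro v
    have hm := avg_mem ρ (WW F) v
    have hV : avg ρ (WW F) v ∈ VV ρ := by
      rintro w ⟨x, y, rfl⟩
      exact hm _ ⟨1, TT_one, x, y, by rw [ell_one, mul_one]⟩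
    have hx : (⟨avg ρ (WW F) v, hV⟩ : VV ρ) ∈ Submodule.span k B := by
      rw [hsp, mem_fixE, eT_fixE hq]
      intro t ht
      apply Subtype.ext
      rw [RR_coe ρ t (TT_det0 ht)]
      exact hm _ ⟨t, ht, 0, 0, by rw [q1_zero, one_mul]⟩
    have := Submodule.mem_map_of_mem (f := (VV ρ).subtype) hx
    rw [Submodule.map_span] at this
    exact this
  · rintro _ ⟨A, hA, rfl⟩ _ ⟨b, hb, rfl⟩
    rw [← RR_coe ρ A (InP_det0 r hq hr hA)]
    refine ⟨_, ?_, rfl⟩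
    have hcp : ∀ j : ℕ, ∀ b ∈ B, RR ρ (cc r ^ j) b ∈ B := by
      intro j
      induction j with
      | zero => intro b hb; simpa using hb
      | succ j ih => intro b hb; rw [pow_succ, map_mul]; exact ih _ (hst b hb).1
    obtain ⟨j, rfl | rfl⟩ := hA
    · exact hcp j b hb
    · rw [map_mul]; exact hcp j _ (hst b hb).2
end

theorem final {F : Type} [Field F] [Fintype F] (hq : Fintype.card F % 8 = 3) (k : Type) [Field k] [IsAlgClosed k]
    [CharP k 2] (M : FDRep k (PSL 3 F)) (hM : CategoryTheory.Simple M) : AlgebraicModule.IsAlgebraic M := by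
  have := S3_finite (F := F)
  obtain ⟨r, hr⟩ := exists_r hq
  let π : S3 F →* PSL 3 F := QuotientGroup.mk' _
  have hπ : Function.Surjective π := QuotientGroup.mk'_surjective _
  refine algebraic_of_good π hπ (PP r hq hr) ?_ M ?_
  · obtain ⟨n, hn⟩ := index_PP r hq hr
    rw [hn]
    have : (2 : k) = 0 := CharTwo.two_eq_zero
    push_cast
    rw [this]; ring
  · refine good_main (E := M) r ((M.ρ.comp π : S3 F →* Module.End k M)) hq hr ?_
    intro p hp
    refine (simple_sub M hM).2 p ?_
    intro g v hv
    obtain ⟨g, rfl⟩ := hπ g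
    exact hp g v hv
end Alg

/-- For `q ≡ 3 mod 8` and `k` algebraically closed of characteristic `2`, every simple
`k PSL_3(q)`-module is algebraic. -/
theorem psl3_simple_algebraic (p s : ℕ) [Fact p.Prime] (hs : 1 ≤ s) (hq : p ^ s % 8 = 3)
    (k : Type) [Field k] [IsAlgClosed k] (hk : CharP k 2) :
    ∀ M : FDRep k (PSL 3 (GaloisField p s)), Simple M → IsAlgebraic M := by
  have : Fintype (GaloisField p s) := Fintype.ofFinite _
  have hc : Fintype.card (GaloisField p s) % 8 = 3 := by
    rw [← Nat.card_eq_fintype_card, GaloisField.card p s (by omega)]; exact hq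
  intro M hM
  exact Alg.final hc k M hM
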